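/- arXiv:2009.07178 — 7 statements merged into one kernel-verified Lean document; each statement's English description precedes it below -/
import Mathlib

section
/- Let ℓ, u be reals with 0 ≤ ℓ < u, let n ≥ 2 be an integer, and let p > 2. Then the volume function V_p has a unique minimizer on the domain D. -/
/-- The full sequence of linearization points: `ξ 0 = ℓ`, `ξ n = u`,
interior coordinates given by `x`. -/
noncomputable def xiSeq (l u : ℝ) (n : ℕ) (x : Fin (n - 1) → ℝ) (i : ℕ) : ℝ :=
  if h : 0 < i ∧ i < n then x ⟨i - 1, by omega⟩ else if i = 0 then l else u

/-- The open domain `D = {ℓ < ξ₁ < ⋯ < ξ_{n-1} < u}`. -/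
def domD (l u : ℝ) (n : ℕ) : Set (Fin (n - 1) → ℝ) :=
  {x | ∀ i < n, xiSeq l u n x i < xiSeq l u n x (i + 1)}

/-- The volume function `V_p` of the perspective relaxation of the piecewise-linear
under-estimator of `x^p` with linearization points `ℓ = ξ₀ < ξ₁ < ⋯ < ξ_n = u`. -/
noncomputable def Vp (l u p : ℝ) (n : ℕ) (x : Fin (n - 1) → ℝ) : ℝ :=
  -((p - 1) ^ 2 / (6 * p)) * ∑ i ∈ Finset.Icc 1 n,
      (xiSeq l u n x (i - 1)) ^ (p - 1) * (xiSeq l u n x i) ^ (p - 1)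
        * (xiSeq l u n x i - xiSeq l u n x (i - 1)) ^ 2
        / ((xiSeq l u n x i) ^ (p - 1) - (xiSeq l u n x (i - 1)) ^ (p - 1))
  + ((p - 1) / (6 * p)) * (u ^ (p + 1) - l ^ (p + 1)) - (1 / 6) * (u ^ p * l - u * l ^ p)


namespace VpAux

/-- One summand. -/
noncomputable def g (q a b : ℝ) : ℝ := a ^ q * b ^ q * (b - a) ^ 2 / (b ^ q - a ^ q)

noncomputable def phi (q v : ℝ) : ℝ := v ^ q * (1 - v) ^ 2 / (1 - v ^ q)

noncomputable def Hf (q w : ℝ) : ℝ := phi q (w ^ (q + 2)⁻¹)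

noncomputable def Af (q v : ℝ) : ℝ := (1 - v) / (v * (1 - v ^ q))

lemma g_self (q a : ℝ) : g q a a = 0 := by simp [g]

lemma g_zero (q b : ℝ) (hq : 1 < q) : g q 0 b = 0 := by
  simp [g, Real.zero_rpow (by linarith : q ≠ 0)]

lemma g_pos (q a b : ℝ) (hq : 1 < q) (ha : 0 < a) (hab : a < b) : 0 < g q a b := by
  have h1 : a ^ q < b ^ q := Real.rpow_lt_rpow ha.le hab (by linarith)
  have h2 : 0 < a ^ q := Real.rpow_pos_of_pos ha _
  have h3 : 0 < b ^ q := by linarith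
  have h4 : 0 < b - a := by linarith
  have h5 : 0 < b ^ q - a ^ q := by linarith
  unfold g; positivity

lemma g_nonneg (q a b : ℝ) (hq : 1 < q) (ha : 0 ≤ a) (hab : a ≤ b) : 0 ≤ g q a b := by
  have h1 : a ^ q ≤ b ^ q := Real.rpow_le_rpow ha hab (by linarith)
  have h2 : 0 ≤ a ^ q := Real.rpow_nonneg ha _
  have h3 : 0 ≤ b ^ q := by linarith
  have h5 : 0 ≤ b ^ q - a ^ q := by linarith
  unfold g; positivity

lemma g_le (q a b : ℝ) (hq : 1 < q) (ha : 0 ≤ a) (hab : a ≤ b) :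
    g q a b ≤ a ^ q * b * (b - a) := by
  rcases hab.eq_or_lt with rfl | hab
  · simp [g]
  have hb : 0 < b := by linarith
  have h1 : a ^ q < b ^ q := Real.rpow_lt_rpow ha hab (by linarith)
  have h2 : 0 ≤ a ^ q := Real.rpow_nonneg ha _
  have h5 : 0 < b ^ q - a ^ q := by linarith
  have hbq : b ^ q = b ^ (q - 1) * b := by
    rw [← Real.rpow_add_one hb.ne']; ring_nf
  have haq : a ^ q ≤ b ^ (q - 1) * a := by
    rcases ha.eq_or_lt with rfl | ha
    · simp [Real.zero_rpow (by linarith : q ≠ 0)]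
    have : a ^ q = a ^ (q - 1) * a := by
      rw [← Real.rpow_add_one ha.ne']; ring_nf
    rw [this]
    have := Real.rpow_le_rpow ha.le hab.le (by linarith : 0 ≤ q - 1)
    gcongr
  unfold g
  rw [div_le_iff₀ h5]
  have key : b ^ q * (b - a) ≤ b * (b ^ q - a ^ q) := by
    nlinarith [mul_le_mul_of_nonneg_left haq hb.le]
  have : 0 ≤ a ^ q * (b - a) := mul_nonneg h2 (by linarith)
  nlinarith [mul_le_mul_of_nonneg_left key this]

lemma g_contOn (q : ℝ) (hq : 1 < q) :
    ContinuousOn (fun z : ℝ × ℝ => g q z.1 z.2) {z | 0 ≤ z.1 ∧ z.1 ≤ z.2} := by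
  have hq0 : 0 ≤ q := by linarith
  rintro ⟨a, b⟩ ⟨ha, hab⟩
  simp only at ha hab
  rcases hab.eq_or_lt with rfl | hab
  · unfold ContinuousWithinAt
    simp only [g_self]
    have hc : Continuous (fun z : ℝ × ℝ => z.1 ^ q * z.2 * (z.2 - z.1)) :=
      ((continuous_fst.rpow_const (fun _ => Or.inr hq0)).mul continuous_snd).mul
        (continuous_snd.sub continuous_fst)
    have ht := (hc.tendsto (a, a)).mono_left
      (nhdsWithin_le_nhds (s := {z : ℝ × ℝ | 0 ≤ z.1 ∧ z.1 ≤ z.2}))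
    simp only [sub_self, mul_zero] at ht
    refine tendsto_of_tendsto_of_tendsto_of_le_of_le' tendsto_const_nhds ht ?_ ?_
    · filter_upwards [self_mem_nhdsWithin] with z hz
      exact g_nonneg q _ _ hq hz.1 hz.2
    · filter_upwards [self_mem_nhdsWithin] with z hz
      exact g_le q _ _ hq hz.1 hz.2
  · apply ContinuousAt.continuousWithinAt
    have h1 : a ^ q < b ^ q := Real.rpow_lt_rpow ha hab (by linarith)
    have c1 : Continuous (fun z : ℝ × ℝ => z.1 ^ q) :=
      continuous_fst.rpow_const (fun _ => Or.inr hq0)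
    have c2 : Continuous (fun z : ℝ × ℝ => z.2 ^ q) :=
      continuous_snd.rpow_const (fun _ => Or.inr hq0)
    unfold g
    refine ContinuousAt.div (Continuous.continuousAt ?_) (c2.sub c1).continuousAt ?_
    · exact (c1.mul c2).mul ((continuous_snd.sub continuous_fst).pow 2)
    · simp only; linarith

lemma strictConvexOn_rpow_neg' (q : ℝ) (hq : 1 < q) :
    StrictConvexOn ℝ (Set.Ioi 0) (fun x : ℝ => x ^ (-q)) := by
  refine StrictMonoOn.strictConvexOn_of_deriv (convex_Ioi 0) ?_ ?_
  · intro x hx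
    exact (Real.continuousAt_rpow_const x (-q) (Or.inl (ne_of_gt hx))).continuousWithinAt
  · rw [interior_Ioi]
    intro x hx y hy hxy
    have hx' : 0 < x := hx
    have hy' : 0 < y := hy
    rw [(Real.hasDerivAt_rpow_const (x := x) (p := -q) (Or.inl hx'.ne')).deriv,
      (Real.hasDerivAt_rpow_const (x := y) (p := -q) (Or.inl hy'.ne')).deriv]
    have := Real.rpow_lt_rpow_of_neg hx' hxy (by linarith : -q - 1 < 0)
    nlinarith

/-- Inserting a point strictly increases the sum (Cauchy-Schwarz and strict convexity). -/
lemma g_superadd (q a b c : ℝ) (hq : 1 < q) (ha : 0 ≤ a) (hab : a < b) (hbc : b < c) :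
    g q a c < g q a b + g q b c := by
  have hb : 0 < b := by linarith
  rcases ha.eq_or_lt with rfl | ha
  · rw [g_zero _ _ hq, g_zero _ _ hq]
    have := g_pos q b c hq hb hbc
    linarith
  have hc : 0 < c := by linarith
  have key : ∀ x y : ℝ, 0 < x → x < y → g q x y = (y - x) ^ 2 / (x ^ (-q) - y ^ (-q)) := by
    intro x y hx hxy
    have h1 : x ^ q < y ^ q := Real.rpow_lt_rpow hx.le hxy (by linarith)
    have h2 : 0 < x ^ q := Real.rpow_pos_of_pos hx _
    have h3 : 0 < y ^ q := by linarith
    have h5 : y ^ q - x ^ q ≠ 0 := by linarith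
    rw [Real.rpow_neg hx.le, Real.rpow_neg (by linarith), g]
    have : (x ^ q)⁻¹ - (y ^ q)⁻¹ = (y ^ q - x ^ q) / (x ^ q * y ^ q) := by
      field_simp
    rw [this]
    field_simp
  rw [key a c ha (by linarith), key a b ha hab, key b c hb hbc]
  have hA : b ^ (-q) < a ^ (-q) := Real.rpow_lt_rpow_of_neg ha hab (by linarith)
  have hB : c ^ (-q) < b ^ (-q) := Real.rpow_lt_rpow_of_neg hb hbc (by linarith)
  have hconv : StrictConvexOn ℝ (Set.Ioi 0) (fun x : ℝ => x ^ (-q)) :=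
    strictConvexOn_rpow_neg' q hq
  have hs := hconv.slope_strict_mono_adjacent (x := a) (y := b) (z := c) ha hc hab hbc
  have hx : 0 < b - a := by linarith
  have hy : 0 < c - b := by linarith
  rw [div_lt_div_iff₀ hx hy] at hs
  obtain ⟨X, hX⟩ : ∃ X, X = b - a := ⟨_, rfl⟩
  obtain ⟨Y, hY⟩ : ∃ Y, Y = c - b := ⟨_, rfl⟩
  obtain ⟨S, hS⟩ : ∃ S, S = a ^ (-q) - b ^ (-q) := ⟨_, rfl⟩
  obtain ⟨T, hT⟩ : ∃ T, T = b ^ (-q) - c ^ (-q) := ⟨_, rfl⟩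
  have e1 : c - a = X + Y := by linarith
  have e2 : a ^ (-q) - c ^ (-q) = S + T := by linarith
  rw [e1, e2, ← hX, ← hY, ← hS, ← hT]
  have hS0 : 0 < S := by linarith
  have hT0 : 0 < T := by linarith
  rw [← hX, ← hY] at hs
  have hs' : 0 < S * Y - T * X := by nlinarith
  rw [div_add_div _ _ hS0.ne' hT0.ne', div_lt_div_iff₀ (by positivity) (by positivity)]
  nlinarith [mul_pos hs' hs']

lemma rpow_succ' (q v : ℝ) (hv : 0 < v) : v ^ (q + 1) = v ^ q * v :=
  Real.rpow_add_one hv.ne' q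

lemma Af_gt (q v : ℝ) (hq : 1 < q) (hv : 0 < v) (hv1 : v < 1) : 1 < q * Af q v := by
  have h1 : v ^ q < 1 := Real.rpow_lt_one hv.le hv1 (by linarith)
  have hb := one_add_mul_self_lt_rpow_one_add (s := v - 1) (by linarith) (by linarith)
    (p := q + 1) (by linarith)
  rw [show 1 + (v - 1) = v by ring, rpow_succ' q v hv] at hb
  have : 0 < v * (1 - v ^ q) := mul_pos hv (by linarith)
  unfold Af
  rw [← mul_div_assoc, lt_div_iff₀ this]
  nlinarith

lemma Af_anti (q v w : ℝ) (hq : 1 < q) (hv : 0 < v) (hvw : v < w) (hw : w < 1) :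
    Af q w < Af q v := by
  have hw0 : 0 < w := by linarith
  have h1 : v ^ q < 1 := Real.rpow_lt_one hv.le (by linarith) (by linarith)
  have h2 : w ^ q < 1 := Real.rpow_lt_one hw0.le hw (by linarith)
  have hconv : StrictConvexOn ℝ (Set.Ici 0) (fun x : ℝ => x ^ (q + 1)) :=
    strictConvexOn_rpow (by linarith)
  have hs := hconv.slope_strict_mono_adjacent (x := v) (y := w) (z := 1) hv.le
    (by simp) hvw hw
  simp only [Real.one_rpow] at hs
  rw [rpow_succ' q v hv, rpow_succ' q w hw0, div_lt_div_iff₀ (by linarith) (by linarith)] at hs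
  unfold Af
  rw [div_lt_div_iff₀ (mul_pos hw0 (by linarith)) (mul_pos hv (by linarith))]
  nlinarith

lemma phi_deriv (q v : ℝ) (hq : 1 < q) (hv : 0 < v) (hv1 : v < 1) :
    HasDerivAt (phi q) ((q * Af q v ^ 2 - 2 * Af q v) * (v ^ q * v)) v := by
  have h1 : v ^ q < 1 := Real.rpow_lt_one hv.le hv1 (by linarith)
  have hne : 1 - v ^ q ≠ 0 := by linarith
  have d1 : HasDerivAt (fun v : ℝ => v ^ q) (q * (v ^ q / v)) v := by
    have := Real.hasDerivAt_rpow_const (x := v) (p := q) (Or.inl hv.ne')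
    rwa [Real.rpow_sub_one hv.ne'] at this
  have d2 : HasDerivAt (fun v : ℝ => (1 - v) ^ 2) (2 * (1 - v) * (-1)) v := by
    have := ((hasDerivAt_id v).const_sub 1).pow 2
    exact this.congr_deriv (by simp)
  have d3 := (d1.mul d2).div (d1.const_sub 1) hne
  refine HasDerivAt.congr_deriv (f := phi q) d3 ?_
  simp only [Pi.mul_apply]
  unfold Af
  generalize v ^ q = V at *
  field_simp
  ring

lemma Hf_deriv (q w : ℝ) (hq : 1 < q) (hw : 0 < w) (hw1 : w < 1) :
    HasDerivAt (Hf q) ((q + 2)⁻¹ * (q * Af q (w ^ (q + 2)⁻¹) ^ 2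
      - 2 * Af q (w ^ (q + 2)⁻¹))) w := by
  have hQ : 0 < (q + 2)⁻¹ := by positivity
  have hv : 0 < w ^ (q + 2)⁻¹ := Real.rpow_pos_of_pos hw _
  have hv1 : w ^ (q + 2)⁻¹ < 1 := Real.rpow_lt_one hw.le hw1 hQ
  have d1 := Real.hasDerivAt_rpow_const (x := w) (p := (q + 2)⁻¹) (Or.inl hw.ne')
  have d2 := (phi_deriv q _ hq hv hv1).comp w d1
  refine HasDerivAt.congr_deriv (f := Hf q) d2 ?_
  rw [Real.rpow_sub_one hw.ne']
  have hw' : w = (w ^ (q + 2)⁻¹) ^ q * (w ^ (q + 2)⁻¹) ^ 2 := by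
    rw [← Real.rpow_natCast, ← Real.rpow_add hv, ← Real.rpow_mul hw.le]
    have : (q + 2)⁻¹ * (q + ((2 : ℕ) : ℝ)) = 1 := by
      push_cast; field_simp
    rw [this, Real.rpow_one]
  generalize w ^ (q + 2)⁻¹ = v at *
  have hV : 0 < v ^ q := Real.rpow_pos_of_pos hv _
  generalize Af q v = A at *
  generalize v ^ q = V at *
  subst hw'
  field_simp

lemma Hf_concave (q : ℝ) (hq : 1 < q) : StrictConcaveOn ℝ (Set.Ico 0 1) (Hf q) := by
  have hQ : 0 < (q + 2)⁻¹ := by positivity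
  refine StrictAntiOn.strictConcaveOn_of_deriv (convex_Ico 0 1) ?_ ?_
  · have c1 : Continuous (fun w : ℝ => w ^ (q + 2)⁻¹) :=
      continuous_id.rpow_const (fun _ => Or.inr hQ.le)
    have c2 : Continuous (fun w : ℝ => (w ^ (q + 2)⁻¹) ^ q) :=
      c1.rpow_const (fun _ => Or.inr (by linarith))
    unfold Hf phi
    refine ContinuousOn.div (Continuous.continuousOn ?_) (Continuous.continuousOn ?_) ?_
    · exact c2.mul ((continuous_const.sub c1).pow 2)
    · exact continuous_const.sub c2
    · intro w hw
      have h0 : 0 ≤ w ^ (q + 2)⁻¹ := Real.rpow_nonneg hw.1 _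
      have h1 : w ^ (q + 2)⁻¹ < 1 := Real.rpow_lt_one hw.1 hw.2 hQ
      have h2 : (w ^ (q + 2)⁻¹) ^ q < 1 := Real.rpow_lt_one h0 h1 (by linarith)
      linarith
  · rw [interior_Ico]
    intro x hx y hy hxy
    rw [(Hf_deriv q x hq hx.1 hx.2).deriv, (Hf_deriv q y hq hy.1 hy.2).deriv]
    have hvx : 0 < x ^ (q + 2)⁻¹ := Real.rpow_pos_of_pos hx.1 _
    have hvy : 0 < y ^ (q + 2)⁻¹ := Real.rpow_pos_of_pos hy.1 _
    have hvxy : x ^ (q + 2)⁻¹ < y ^ (q + 2)⁻¹ := Real.rpow_lt_rpow hx.1.le hxy hQ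
    have hvy1 : y ^ (q + 2)⁻¹ < 1 := Real.rpow_lt_one hy.1.le hy.2 hQ
    have hA := Af_anti q _ _ hq hvx hvxy hvy1
    have hB := Af_gt q _ hq hvy hvy1
    have hC := Af_gt q _ hq hvx (by linarith)
    generalize Af q (x ^ (q + 2)⁻¹) = A at *
    generalize Af q (y ^ (q + 2)⁻¹) = B at *
    refine mul_lt_mul_of_pos_left ?_ hQ
    nlinarith [mul_pos (sub_pos.2 hA) (add_pos (sub_pos.2 hB) (sub_pos.2 hC))]

lemma g_eq (q X Y : ℝ) (hq : 1 < q) (hX : 0 ≤ X) (hXY : X < Y) :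
    g q (X ^ (q + 2)⁻¹) (Y ^ (q + 2)⁻¹) = Y * Hf q (X / Y) := by
  have hQ : 0 < (q + 2)⁻¹ := by positivity
  have hY : 0 < Y := by linarith
  have hb : 0 < Y ^ (q + 2)⁻¹ := Real.rpow_pos_of_pos hY _
  have ha : 0 ≤ X ^ (q + 2)⁻¹ := Real.rpow_nonneg hX _
  have hab : X ^ (q + 2)⁻¹ < Y ^ (q + 2)⁻¹ := Real.rpow_lt_rpow hX hXY hQ
  have hY' : Y = (Y ^ (q + 2)⁻¹) ^ q * (Y ^ (q + 2)⁻¹) ^ 2 := by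
    rw [← Real.rpow_natCast, ← Real.rpow_add hb, ← Real.rpow_mul hY.le]
    have : (q + 2)⁻¹ * (q + ((2 : ℕ) : ℝ)) = 1 := by
      push_cast; field_simp
    rw [this, Real.rpow_one]
  unfold Hf phi g
  rw [Real.div_rpow hX hY.le, Real.div_rpow ha hb.le]
  have h1 : (X ^ (q + 2)⁻¹) ^ q < (Y ^ (q + 2)⁻¹) ^ q :=
    Real.rpow_lt_rpow ha hab (by linarith)
  have hV : 0 < (Y ^ (q + 2)⁻¹) ^ q := Real.rpow_pos_of_pos hb _
  generalize X ^ (q + 2)⁻¹ = a at *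
  generalize Y ^ (q + 2)⁻¹ = b at *
  generalize a ^ q = A at *
  generalize b ^ q = B at *
  subst hY'
  have h2 : B - A ≠ 0 := by linarith
  have h3 : 1 - A / B = (B - A) / B := by field_simp
  rw [h3]
  field_simp

/-- The power mean used for the midpoint argument. -/
noncomputable def pm (q a b : ℝ) : ℝ := ((a ^ (q + 2) + b ^ (q + 2)) / 2) ^ (q + 2)⁻¹

lemma pm_self (q a : ℝ) (hq : 1 < q) (ha : 0 ≤ a) : pm q a a = a := by
  unfold pm
  rw [add_self_div_two, Real.rpow_rpow_inv ha (by linarith)]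

lemma pm_lt (q a b a' b' : ℝ) (hq : 1 < q) (ha : 0 ≤ a) (hab : a < b)
    (ha' : 0 ≤ a') (hab' : a' < b') : pm q a a' < pm q b b' := by
  have h1 := Real.rpow_lt_rpow ha hab (by linarith : 0 < q + 2)
  have h2 := Real.rpow_lt_rpow ha' hab' (by linarith : 0 < q + 2)
  have h3 := Real.rpow_nonneg ha (q + 2)
  have h4 := Real.rpow_nonneg ha' (q + 2)
  exact Real.rpow_lt_rpow (by linarith) (by linarith) (by positivity)

lemma g_pm (q a b a' b' : ℝ) (hq : 1 < q) (ha : 0 ≤ a) (hab : a < b)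
    (ha' : 0 ≤ a') (hab' : a' < b') :
    g q a b + g q a' b' ≤ 2 * g q (pm q a a') (pm q b b') ∧
    (a ≠ a' → b = b' → g q a b + g q a' b' < 2 * g q (pm q a a') (pm q b b')) := by
  have hq2 : q + 2 ≠ 0 := by linarith
  have h1 := Real.rpow_lt_rpow ha hab (by linarith : 0 < q + 2)
  have h2 := Real.rpow_lt_rpow ha' hab' (by linarith : 0 < q + 2)
  have h3 := Real.rpow_nonneg ha (q + 2)
  have h4 := Real.rpow_nonneg ha' (q + 2)
  have e1 : g q a b = b ^ (q + 2) * Hf q (a ^ (q + 2) / b ^ (q + 2)) := by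
    rw [← g_eq q _ _ hq h3 h1, Real.rpow_rpow_inv ha hq2,
      Real.rpow_rpow_inv (by linarith) hq2]
  have e2 : g q a' b' = b' ^ (q + 2) * Hf q (a' ^ (q + 2) / b' ^ (q + 2)) := by
    rw [← g_eq q _ _ hq h4 h2, Real.rpow_rpow_inv ha' hq2,
      Real.rpow_rpow_inv (by linarith) hq2]
  have hinj : a ≠ a' → a ^ (q + 2) ≠ a' ^ (q + 2) := by
    intro hne h
    exact hne ((Real.rpow_left_inj ha ha' hq2).1 h)
  have hbb : b = b' → b ^ (q + 2) = b' ^ (q + 2) := by rintro rfl; rfl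
  have e3 : g q (pm q a a') (pm q b b') = _ :=
    g_eq q ((a ^ (q + 2) + a' ^ (q + 2)) / 2) ((b ^ (q + 2) + b' ^ (q + 2)) / 2) hq
      (by linarith) (by linarith)
  rw [e1, e2, e3]
  generalize a ^ (q + 2) = X at *
  generalize b ^ (q + 2) = Y at *
  generalize a' ^ (q + 2) = X' at *
  generalize b' ^ (q + 2) = Y' at *
  have hY : 0 < Y := by linarith
  have hY' : 0 < Y' := by linarith
  have m1 : X / Y ∈ Set.Ico (0 : ℝ) 1 := ⟨by positivity, (div_lt_one hY).2 h1⟩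
  have m2 : X' / Y' ∈ Set.Ico (0 : ℝ) 1 := ⟨by positivity, (div_lt_one hY').2 h2⟩
  have hsum : Y / (Y + Y') + Y' / (Y + Y') = 1 := by field_simp
  have hcomb : Y / (Y + Y') * (X / Y) + Y' / (Y + Y') * (X' / Y')
      = (X + X') / 2 / ((Y + Y') / 2) := by field_simp
  have hl : ∀ P P' : ℝ, Y * P + Y' * P' = (Y + Y') * (Y / (Y + Y') * P + Y' / (Y + Y') * P') := by
    intro P P'; field_simp
  have hr : ∀ P : ℝ, 2 * ((Y + Y') / 2 * P) = (Y + Y') * P := by intro P; ring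
  rw [hl, hr, ← hcomb]
  constructor
  · have := (Hf_concave q hq).concaveOn.2 m1 m2 (by positivity : 0 ≤ Y / (Y + Y'))
      (by positivity : 0 ≤ Y' / (Y + Y')) hsum
    simp only [smul_eq_mul] at this
    exact mul_le_mul_of_nonneg_left this (by positivity)
  · intro hne hb
    have hXX := hinj hne
    have hYY := hbb hb
    have hne2 : X / Y ≠ X' / Y' := by
      rw [hYY]
      intro h
      rw [div_left_inj' hY'.ne'] at h
      exact hXX h
    have := (Hf_concave q hq).2 m1 m2 hne2 (by positivity : 0 < Y / (Y + Y'))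
      (by positivity : 0 < Y' / (Y + Y')) hsum
    simp only [smul_eq_mul] at this
    exact mul_lt_mul_of_pos_left this (by positivity)

lemma xi_zero (l u : ℝ) (n : ℕ) (x : Fin (n - 1) → ℝ) : xiSeq l u n x 0 = l := by
  simp [xiSeq]

lemma xi_n (l u : ℝ) (n : ℕ) (hn : 2 ≤ n) (x : Fin (n - 1) → ℝ) : xiSeq l u n x n = u := by
  have : n ≠ 0 := by omega
  simp [xiSeq, this]

lemma xi_mk (l u : ℝ) (n : ℕ) (s : ℕ → ℝ) (h0 : s 0 = l) (h1 : s n = u) (k : ℕ) (hk : k ≤ n) :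
    xiSeq l u n (fun i => s (i + 1)) k = s k := by
  unfold xiSeq
  split_ifs with h h'
  · simp only
    congr 1; omega
  · rw [h', h0]
  · rw [← h1]; congr 1; omega

lemma xi_ext (l u : ℝ) (n : ℕ) (x y : Fin (n - 1) → ℝ)
    (h : ∀ k ≤ n, xiSeq l u n x k = xiSeq l u n y k) : x = y := by
  funext i
  have hi := i.2
  have := h (i + 1) (by omega)
  have hc : 0 < (i : ℕ) + 1 ∧ (i : ℕ) + 1 < n := by omega
  simpa [xiSeq, hc] using this

lemma xi_cont (l u : ℝ) (n k : ℕ) : Continuous (fun x => xiSeq l u n x k) := by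
  unfold xiSeq
  split_ifs <;> fun_prop

noncomputable def F (l u q : ℝ) (n : ℕ) (x : Fin (n - 1) → ℝ) : ℝ :=
  ∑ i ∈ Finset.range n, g q (xiSeq l u n x i) (xiSeq l u n x (i + 1))

lemma Vp_eq (l u p : ℝ) (n : ℕ) (x : Fin (n - 1) → ℝ) :
    Vp l u p n x = -((p - 1) ^ 2 / (6 * p)) * F l u (p - 1) n x
      + (((p - 1) / (6 * p)) * (u ^ (p + 1) - l ^ (p + 1))
      - (1 / 6) * (u ^ p * l - u * l ^ p)) := by
  unfold Vp F g
  have : Finset.Icc 1 n = Finset.Ico 1 (n + 1) := by ext; simp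
  rw [this, Finset.sum_Ico_eq_sum_range]
  simp only [Nat.add_sub_cancel, add_comm 1]
  ring

lemma Vp_le_iff (l u p : ℝ) (hp : 2 < p) (n : ℕ) (x y : Fin (n - 1) → ℝ) :
    Vp l u p n x ≤ Vp l u p n y ↔ F l u (p - 1) n y ≤ F l u (p - 1) n x := by
  have h1 : 0 < p - 1 := by linarith
  have h2 : 0 < (p - 1) ^ 2 / (6 * p) := by positivity
  rw [Vp_eq, Vp_eq]
  constructor
  · intro h
    refine le_of_mul_le_mul_left ?_ h2
    linarith
  · intro h
    have := mul_le_mul_of_nonneg_left h h2.le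
    linarith

def K (l u : ℝ) (n : ℕ) : Set (Fin (n - 1) → ℝ) :=
  {x | ∀ i < n, xiSeq l u n x i ≤ xiSeq l u n x (i + 1)}

lemma K_ge (l u : ℝ) (n : ℕ) (x : Fin (n - 1) → ℝ) (hx : x ∈ K l u n) (k : ℕ) (hk : k ≤ n) :
    l ≤ xiSeq l u n x k := by
  induction k with
  | zero => rw [xi_zero]
  | succ k ih => exact (ih (by omega)).trans (hx k (by omega))

lemma K_le (l u : ℝ) (n : ℕ) (hn : 2 ≤ n) (x : Fin (n - 1) → ℝ) (hx : x ∈ K l u n)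
    (k : ℕ) (hk : k ≤ n) : xiSeq l u n x k ≤ u := by
  induction hk using Nat.decreasingInduction with
  | self => rw [xi_n l u n hn]
  | of_succ k hk ih => exact (hx k hk).trans ih

lemma dom_sub (l u : ℝ) (n : ℕ) : domD l u n ⊆ K l u n := fun _ hx i hi => (hx i hi).le

lemma K_compact (l u : ℝ) (n : ℕ) (hn : 2 ≤ n) : IsCompact (K l u n) := by
  have hc : IsClosed (K l u n) := by
    unfold K
    simp only [Set.ofPred_forall]
    exact isClosed_iInter fun i => isClosed_iInter fun _ =>
      isClosed_le (xi_cont l u n i) (xi_cont l u n (i + 1))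
  refine IsCompact.of_isClosed_subset (isCompact_Icc (a := fun _ => l) (b := fun _ => u)) hc ?_
  intro x hx
  have key : ∀ i : Fin (n - 1), xiSeq l u n x (i + 1) = x i := by
    intro i
    have hi := i.2
    have hc : 0 < (i : ℕ) + 1 ∧ (i : ℕ) + 1 < n := by omega
    simp [xiSeq, hc]
  constructor
  · intro i
    have hi := i.2
    rw [← key i]; exact K_ge l u n x hx _ (by omega)
  · intro i
    have hi := i.2
    rw [← key i]; exact K_le l u n hn x hx _ (by omega)

lemma F_cont (l u q : ℝ) (hl : 0 ≤ l) (hq : 1 < q) (n : ℕ) :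
    ContinuousOn (F l u q n) (K l u n) := by
  unfold F
  refine continuousOn_finsetSum _ fun i hi => ?_
  have hi' := Finset.mem_range.1 hi
  have hc : Continuous (fun x => (xiSeq l u n x i, xiSeq l u n x (i + 1))) :=
    (xi_cont l u n i).prodMk (xi_cont l u n (i + 1))
  have hm : Set.MapsTo (fun x => (xiSeq l u n x i, xiSeq l u n x (i + 1))) (K l u n)
      {z : ℝ × ℝ | 0 ≤ z.1 ∧ z.1 ≤ z.2} :=
    fun x hx => ⟨hl.trans (K_ge l u n x hx i hi'.le), hx i hi'⟩
  have := ContinuousOn.comp (g_contOn q hq) hc.continuousOn hm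
  exact this

/-- At a maximizer over the closed domain, an interior point is strictly between its neighbours
as soon as those differ. -/
lemma max_local (l u q : ℝ) (hl : 0 ≤ l) (hq : 1 < q) (n : ℕ)
    (hn : 2 ≤ n)
    (x : Fin (n - 1) → ℝ) (hx : x ∈ K l u n) (hmax : ∀ y ∈ K l u n, F l u q n y ≤ F l u q n x)
    (j : ℕ) (hj : j + 1 < n) (hlt : xiSeq l u n x j < xiSeq l u n x (j + 2)) :
    xiSeq l u n x j < xiSeq l u n x (j + 1) ∧ xiSeq l u n x (j + 1) < xiSeq l u n x (j + 2) := by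
  by_contra hcon
  have ha0 : 0 ≤ xiSeq l u n x j := hl.trans (K_ge l u n x hx j (by omega))
  have h1 := hx j (by omega)
  have h2 := hx (j + 1) (by omega)
  have h0l := xi_zero l u n x
  have hnu := xi_n l u n hn x
  have hFx : ∀ i < n, xiSeq l u n x i ≤ xiSeq l u n x (i + 1) := hx
  have hFdef : F l u q n x = ∑ i ∈ Finset.range n, g q (xiSeq l u n x i) (xiSeq l u n x (i + 1)) :=
    rfl
  generalize xiSeq l u n x = s at *
  obtain ⟨b, hb1, hb2⟩ := exists_between hlt
  have hold : g q (s j) (s (j + 1)) + g q (s (j + 1)) (s (j + 2)) = g q (s j) (s (j + 2)) := by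
    rcases h1.eq_or_lt with h | h
    · rw [← h, g_self, zero_add]
    · rcases h2.eq_or_lt with h' | h'
      · rw [← h', g_self, add_zero]
      · exact absurd ⟨h, h'⟩ hcon
  have hsup := g_superadd q _ _ _ hq ha0 hb1 hb2
  set t : ℕ → ℝ := Function.update s (j + 1) b with ht
  have tj : t (j + 1) = b := by simp [ht]
  have tne : ∀ k, k ≠ j + 1 → t k = s k := fun k hk => by simp [ht, hk]
  have t0 : t 0 = l := by rw [tne 0 (by omega), h0l]
  have tn : t n = u := by rw [tne n (by omega), hnu]
  have hxi := xi_mk l u n t t0 tn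
  have hyK : (fun i : Fin (n - 1) => t (i + 1)) ∈ K l u n := by
    intro i hi
    rw [hxi i hi.le, hxi (i + 1) hi]
    by_cases e1 : i = j
    · subst e1
      rw [tj, tne i (by omega)]; exact hb1.le
    by_cases e2 : i = j + 1
    · subst e2
      rw [tj, tne (j + 1 + 1) (by omega)]; exact hb2.le
    rw [tne i e2, tne (i + 1) (by omega)]
    exact hFx i hi
  have hle := hmax _ hyK
  have hFy : F l u q n (fun i : Fin (n - 1) => t (i + 1)) =
      ∑ i ∈ Finset.range n, g q (t i) (t (i + 1)) := by
    unfold F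
    refine Finset.sum_congr rfl fun i hi => ?_
    have hi' := Finset.mem_range.1 hi
    rw [hxi i hi'.le, hxi (i + 1) hi']
  rw [hFdef, hFy, ← sub_nonpos, ← Finset.sum_sub_distrib] at hle
  have hsub : ({j, j + 1} : Finset ℕ) ⊆ Finset.range n := by
    intro k hk
    simp only [Finset.mem_insert, Finset.mem_singleton] at hk
    rw [Finset.mem_range]; omega
  rw [← Finset.sum_subset hsub, Finset.sum_pair (by omega), tj, tne j (by omega),
    tne (j + 1 + 1) (by omega)] at hle
  · have e : j + 1 + 1 = j + 2 := rfl
    rw [e] at hle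
    linarith
  · intro i _ hi
    simp only [Finset.mem_insert, Finset.mem_singleton, not_or] at hi
    rw [tne i hi.2, tne (i + 1) (by omega), sub_self]

lemma max_mem (l u q : ℝ) (hl : 0 ≤ l) (hlu : l < u) (hq : 1 < q) (n : ℕ) (hn : 2 ≤ n)
    (x : Fin (n - 1) → ℝ) (hx : x ∈ K l u n) (hmax : ∀ y ∈ K l u n, F l u q n y ≤ F l u q n x) :
    x ∈ domD l u n := by
  have hloc := max_local l u q hl hq n hn x hx hmax
  have hstep : ∀ i, i + 1 < n → (xiSeq l u n x i < xiSeq l u n x (i + 1) ↔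
      xiSeq l u n x (i + 1) < xiSeq l u n x (i + 2)) := by
    intro i hi
    have h1 := hx i (by omega)
    have h2 := hx (i + 1) hi
    exact ⟨fun h => (hloc i hi (h.trans_le h2)).2, fun h => (hloc i hi (h1.trans_lt h)).1⟩
  have hall : ∀ i, i < n → (xiSeq l u n x 0 < xiSeq l u n x 1 ↔
      xiSeq l u n x i < xiSeq l u n x (i + 1)) := by
    intro i
    induction i with
    | zero => intro _; simp
    | succ i ih => intro hi; rw [ih (by omega)]; exact hstep i hi
  have h0 : xiSeq l u n x 0 < xiSeq l u n x 1 := by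
    by_contra h
    have hc : ∀ k ≤ n, xiSeq l u n x k = l := by
      intro k
      induction k with
      | zero => intro _; exact xi_zero l u n x
      | succ k ih =>
        intro hk
        have e := hx k (by omega)
        have e2 : ¬ _ := fun h' => h ((hall k (by omega)).2 h')
        rw [← ih (by omega)]
        exact le_antisymm (not_lt.1 e2) e
    have := hc n le_rfl
    rw [xi_n l u n hn] at this
    linarith
  exact fun i hi => (hall i hi).1 h0

lemma max_unique (l u q : ℝ) (hl : 0 ≤ l) (hlu : l < u) (hq : 1 < q) (n : ℕ) (hn : 2 ≤ n)
    (x y : Fin (n - 1) → ℝ) (hx : x ∈ domD l u n) (hy : y ∈ domD l u n)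
    (hmx : ∀ z ∈ domD l u n, F l u q n z ≤ F l u q n x)
    (hmy : ∀ z ∈ domD l u n, F l u q n z ≤ F l u q n y) : x = y := by
  set s := xiSeq l u n x with hs
  set t := xiSeq l u n y with ht
  have s0 : ∀ k ≤ n, 0 ≤ s k := fun k hk => hl.trans (K_ge l u n x (dom_sub l u n hx) k hk)
  have t0 : ∀ k ≤ n, 0 ≤ t k := fun k hk => hl.trans (K_ge l u n y (dom_sub l u n hy) k hk)
  have hsx : ∀ i < n, s i < s (i + 1) := hx
  have hty : ∀ i < n, t i < t (i + 1) := hy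
  set m : ℕ → ℝ := fun k => pm q (s k) (t k) with hm
  have m0 : m 0 = l := by
    simp only [hm, hs, ht, xi_zero]; exact pm_self q l hq hl
  have mn : m n = u := by
    simp only [hm, hs, ht, xi_n l u n hn]; exact pm_self q u hq (by linarith)
  have hxi := xi_mk l u n m m0 mn
  have hmD : (fun i : Fin (n - 1) => m (i + 1)) ∈ domD l u n := by
    intro i hi
    rw [hxi i hi.le, hxi (i + 1) hi]
    exact pm_lt q _ _ _ _ hq (s0 i hi.le) (hsx i hi) (t0 i hi.le) (hty i hi)
  have hFm : F l u q n (fun i : Fin (n - 1) => m (i + 1)) =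
      ∑ i ∈ Finset.range n, g q (m i) (m (i + 1)) := by
    unfold F
    refine Finset.sum_congr rfl fun i hi => ?_
    have hi' := Finset.mem_range.1 hi
    rw [hxi i hi'.le, hxi (i + 1) hi']
  have hkey := fun i (hi : i < n) =>
    g_pm q (s i) (s (i + 1)) (t i) (t (i + 1)) hq (s0 i hi.le) (hsx i hi) (t0 i hi.le) (hty i hi)
  have h1 := hmx _ hmD
  have h2 := hmy _ hmD
  have hno : ∀ i < n, ¬ (g q (s i) (s (i + 1)) + g q (t i) (t (i + 1))
      < 2 * g q (m i) (m (i + 1))) := by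
    intro i hi hlt
    have : ∑ i ∈ Finset.range n, (g q (s i) (s (i + 1)) + g q (t i) (t (i + 1)))
        < ∑ i ∈ Finset.range n, 2 * g q (m i) (m (i + 1)) :=
      Finset.sum_lt_sum (fun k hk => (hkey k (Finset.mem_range.1 hk)).1)
        ⟨i, Finset.mem_range.2 hi, hlt⟩
    rw [Finset.sum_add_distrib, ← Finset.mul_sum, ← hFm] at this
    have e1 : F l u q n x = ∑ i ∈ Finset.range n, g q (s i) (s (i + 1)) := rfl
    have e2 : F l u q n y = ∑ i ∈ Finset.range n, g q (t i) (t (i + 1)) := rfl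
    linarith
  apply xi_ext l u n
  intro k hk
  induction hk using Nat.decreasingInduction with
  | self => rw [xi_n l u n hn, xi_n l u n hn]
  | of_succ k hk ih =>
    by_contra hne
    exact hno k hk ((hkey k hk).2 hne ih)

end VpAux

/-- For `p > 2`, the volume function `V_p` has a unique minimizer on `D`. -/
theorem Vp_unique_minimizer_of_two_lt_p
    (l u : ℝ) (hl : 0 ≤ l) (hlu : l < u) (n : ℕ) (hn : 2 ≤ n)
    (p : ℝ) (hp : 2 < p) :
    ∃! x : Fin (n - 1) → ℝ, x ∈ domD l u n ∧
      ∀ y ∈ domD l u n, Vp l u p n x ≤ Vp l u p n y := by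
  have hq : 1 < p - 1 := by linarith
  have hne : (VpAux.K l u n).Nonempty := by
    refine ⟨fun _ => u, fun i hi => ?_⟩
    unfold xiSeq
    split_ifs <;> first | exact hlu.le | exact le_rfl | (exfalso; omega)
  obtain ⟨x, hxK, hmax⟩ := (VpAux.K_compact l u n hn).exists_isMaxOn hne
    (VpAux.F_cont l u (p - 1) hl hq n)
  have hmax' : ∀ y ∈ VpAux.K l u n, VpAux.F l u (p - 1) n y ≤ VpAux.F l u (p - 1) n x :=
    fun y hy => hmax hy
  have hxD := VpAux.max_mem l u (p - 1) hl hlu hq n hn x hxK hmax'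
  simp only [VpAux.Vp_le_iff l u p hp n]
  refine ⟨x, ⟨hxD, fun y hy => hmax' y (VpAux.dom_sub l u n hy)⟩, ?_⟩
  rintro y ⟨hyD, hy⟩
  exact VpAux.max_unique l u (p - 1) hl hlu hq n hn y x hyD hxD hy
    (fun z hz => hmax' z (VpAux.dom_sub l u n hz))
end

section
/- Let ℓ, u be reals with 0 ≤ ℓ < u and let n ≥ 2 be an integer. For p > 1, let ξ(p) = (ξ_1(p), …, ξ_{n−1}(p)) ∈ D denote the unique minimizer of the volume function V_p on D. Then each coordinate is strictly increasing in p: for all 1 < p < q and all i = 1, …, n−1, ξ_i(p) < ξ_i(q). -/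
/-- `c coth c`. -/
noncomputable def hc (c : ℝ) : ℝ := c * Real.cosh c / Real.sinh c

theorem hc_deriv (c : ℝ) (hc0 : 0 < c) :
    HasDerivAt hc ((Real.sinh c * Real.cosh c - c) / Real.sinh c ^ 2) c := by
  have hs : 0 < Real.sinh c := Real.sinh_pos_iff.2 hc0
  have h := ((hasDerivAt_id c).mul (Real.hasDerivAt_cosh c)).div (Real.hasDerivAt_sinh c) hs.ne'
  refine h.congr_deriv ?_
  simp only [id, Pi.mul_apply]
  congr 1
  have := Real.cosh_sq c
  linear_combination (-c) * this

theorem hc_deriv_pos (c : ℝ) (hc0 : 0 < c) :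
    0 < (Real.sinh c * Real.cosh c - c) / Real.sinh c ^ 2 := by
  have hs : 0 < Real.sinh c := Real.sinh_pos_iff.2 hc0
  have h1 : 2 * c < Real.sinh (2 * c) := Real.self_lt_sinh_iff.2 (by linarith)
  rw [Real.sinh_two_mul] at h1
  apply div_pos _ (by positivity)
  linarith

theorem hc_deriv2 (c : ℝ) (hc0 : 0 < c) :
    HasDerivAt (fun c => (Real.sinh c * Real.cosh c - c) / Real.sinh c ^ 2)
      (2 * (c * Real.cosh c - Real.sinh c) / Real.sinh c ^ 3) c := by
  have hs : 0 < Real.sinh c := Real.sinh_pos_iff.2 hc0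
  have h := (((Real.hasDerivAt_sinh c).mul (Real.hasDerivAt_cosh c)).sub (hasDerivAt_id c)).div
    ((Real.hasDerivAt_sinh c).pow 2) (pow_pos hs 2).ne'
  refine h.congr_deriv ?_
  simp only [id, Pi.mul_apply, Pi.sub_apply, Pi.pow_apply]
  have := Real.cosh_sq c
  field_simp
  have h3 : Real.cosh c ^ 2 = Real.sinh c ^ 2 + 1 := this
  norm_num
  linear_combination (-Real.sinh c ^ 2) * h3

theorem sinh_le_mul_cosh (c : ℝ) (hc0 : 0 ≤ c) : Real.sinh c ≤ c * Real.cosh c := by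
  have hm : MonotoneOn (fun c => c * Real.cosh c - Real.sinh c) (Set.Ici 0) := by
    apply monotoneOn_of_hasDerivWithinAt_nonneg (f' := fun c => c * Real.sinh c) (convex_Ici 0)
    · fun_prop
    · intro x _
      refine HasDerivAt.hasDerivWithinAt ?_
      refine (((hasDerivAt_id x).mul (Real.hasDerivAt_cosh x)).sub
        (Real.hasDerivAt_sinh x)).congr_deriv ?_
      simp
    · intro x hx
      rw [interior_Ici, Set.mem_Ioi] at hx
      exact mul_nonneg hx.le (Real.sinh_nonneg_iff.2 hx.le)
  have := hm (Set.mem_Ici.2 le_rfl) (Set.mem_Ici.2 hc0) hc0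
  simp at this
  linarith

theorem hc_convex : ConvexOn ℝ (Set.Ioi 0) hc := by
  apply convexOn_of_hasDerivWithinAt2_nonneg (convex_Ioi 0)
    (f' := fun c => (Real.sinh c * Real.cosh c - c) / Real.sinh c ^ 2)
    (f'' := fun c => 2 * (c * Real.cosh c - Real.sinh c) / Real.sinh c ^ 3)
  · intro x hx
    exact (hc_deriv x hx).continuousAt.continuousWithinAt
  · intro x hx
    rw [interior_Ioi] at hx
    exact (hc_deriv x hx).hasDerivWithinAt
  · intro x hx
    rw [interior_Ioi] at hx
    exact (hc_deriv2 x hx).hasDerivWithinAt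
  · intro x hx
    rw [interior_Ioi] at hx
    have hs : 0 < Real.sinh x := Real.sinh_pos_iff.2 hx
    have := sinh_le_mul_cosh x (le_of_lt hx)
    apply div_nonneg _ (by positivity)
    linarith

theorem hc_strictMono : StrictMonoOn hc (Set.Ioi 0) := by
  apply strictMonoOn_of_hasDerivWithinAt_pos (convex_Ioi 0)
    (f' := fun c => (Real.sinh c * Real.cosh c - c) / Real.sinh c ^ 2)
  · intro x hx
    exact (hc_deriv x hx).continuousAt.continuousWithinAt
  · intro x hx
    rw [interior_Ioi] at hx
    exact (hc_deriv x hx).hasDerivWithinAt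
  · intro x hx
    rw [interior_Ioi] at hx
    exact hc_deriv_pos x hx

/-- the function in the first order condition. -/
noncomputable def phi (a t : ℝ) : ℝ := a * (t - 1) * t ^ a / (t ^ a - 1)

noncomputable def Hf (t a : ℝ) : ℝ := a * (t - 1) / 2 * ((t ^ a + 1) / (t ^ a - 1))

theorem rpow_ne_one' {t a : ℝ} (ht : 0 ≤ t) (ht1 : t ≠ 1) (ha : 0 < a) : t ^ a - 1 ≠ 0 := by
  rcases lt_or_gt_of_ne ht1 with h | h
  · have := Real.rpow_lt_one ht h ha
    linarith
  · have := Real.one_lt_rpow h ha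
    linarith

theorem phi_eq {t a : ℝ} (ht : 0 ≤ t) (ht1 : t ≠ 1) (ha : 0 < a) :
    phi a t = (t - 1) / 2 * a + Hf t a := by
  have h := rpow_ne_one' ht ht1 ha
  unfold phi Hf
  field_simp
  ring

theorem Hf_one {t : ℝ} (ht1 : t ≠ 1) : Hf t 1 = (t + 1) / 2 := by
  have : t - 1 ≠ 0 := sub_ne_zero.2 ht1
  unfold Hf
  rw [Real.rpow_one]
  field_simp

theorem hc_neg (c : ℝ) : hc (-c) = hc c := by
  unfold hc
  rw [Real.cosh_neg, Real.sinh_neg]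
  rw [neg_mul, neg_div_neg_eq]

theorem hc_abs (c : ℝ) : hc |c| = hc c := by
  rcases abs_choice c with h | h <;> rw [h]
  exact hc_neg c

theorem Hf_eq {t a : ℝ} (ht : 0 < t) (ht1 : t ≠ 1) (ha : 0 < a) :
    Hf t a = (t - 1) / Real.log t * hc (|Real.log t| / 2 * a) := by
  have hL : Real.log t ≠ 0 := Real.log_ne_zero_of_pos_of_ne_one ht ht1
  have e : |Real.log t| / 2 * a = |Real.log t * a / 2| := by
    rw [abs_div, abs_mul, abs_of_pos ha, abs_of_pos (two_pos (α := ℝ))]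
    ring
  rw [e, hc_abs]
  set c := Real.log t * a / 2 with hcdef
  have hta : t ^ a = Real.exp c * Real.exp c := by
    rw [Real.rpow_def_of_pos ht, ← Real.exp_add]
    congr 1
    rw [hcdef]; ring
  have h := rpow_ne_one' ht.le ht1 ha
  rw [hta] at h
  unfold Hf hc
  rw [hta, Real.cosh_eq, Real.sinh_eq, Real.exp_neg]
  have hE := Real.exp_pos c
  set E := Real.exp c
  have h2 : E - E⁻¹ ≠ 0 := by
    intro h0
    apply h
    field_simp at h0
    linarith
  have h3 : E ^ 2 - 1 ≠ 0 := by rwa [pow_two]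
  have e1 : (E + E⁻¹) / 2 / ((E - E⁻¹) / 2) = (E * E + 1) / (E * E - 1) := by
    field_simp
  rw [mul_div_assoc c, e1, hcdef]
  field_simp

theorem K_pos {t : ℝ} (ht : 0 < t) (ht1 : t ≠ 1) : 0 < (t - 1) / Real.log t := by
  rcases lt_or_gt_of_ne ht1 with h | h
  · exact div_pos_of_neg_of_neg (by linarith) (Real.log_neg ht h)
  · exact div_pos (by linarith) (Real.log_pos h)

theorem Hf_strictMono {t : ℝ} (ht : 0 < t) (ht1 : t ≠ 1) {a b : ℝ} (ha : 0 < a) (hab : a < b) :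
    Hf t a < Hf t b := by
  have hL : Real.log t ≠ 0 := Real.log_ne_zero_of_pos_of_ne_one ht ht1
  have hL' : 0 < |Real.log t| / 2 := by positivity
  rw [Hf_eq ht ht1 ha, Hf_eq ht ht1 (ha.trans hab)]
  apply mul_lt_mul_of_pos_left _ (K_pos ht ht1)
  exact hc_strictMono (mul_pos hL' ha) (mul_pos hL' (ha.trans hab))
    (mul_lt_mul_of_pos_left hab hL')

theorem Hf_slope {t : ℝ} (ht : 0 < t) (ht1 : t ≠ 1) {a b c : ℝ} (ha : 0 < a) (hab : a < b)
    (hbc : b < c) : (c - a) * Hf t b ≤ (c - b) * Hf t a + (b - a) * Hf t c := by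
  have hL : Real.log t ≠ 0 := Real.log_ne_zero_of_pos_of_ne_one ht ht1
  have hL' : 0 < |Real.log t| / 2 := by positivity
  have hb := ha.trans hab
  have hcc := hb.trans hbc
  rw [Hf_eq ht ht1 ha, Hf_eq ht ht1 hb, Hf_eq ht ht1 hcc]
  have h := hc_convex.secant_mono_aux1 (mul_pos hL' ha) (mul_pos hL' hcc)
    (mul_lt_mul_of_pos_left hab hL') (mul_lt_mul_of_pos_left hbc hL')
  have hK := K_pos ht ht1
  set k := |Real.log t| / 2
  set K := (t - 1) / Real.log t
  have h2 : k * ((c - a) * hc (k * b)) ≤ k * ((c - b) * hc (k * a) + (b - a) * hc (k * c)) := by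
    linarith
  have h3 := mul_le_mul_of_nonneg_left (le_of_mul_le_mul_left h2 hL') hK.le
  linarith

theorem single_crossing {t w a b : ℝ} (ht : 0 ≤ t) (ht1 : t < 1) (hw : 1 < w) (ha : 0 < a)
    (hab : a < b) (h : phi a t + phi a w = 2) : 2 < phi b t + phi b w := by
  have hb := ha.trans hab
  have hw0 : 0 < w := by linarith
  have mw := Hf_strictMono hw0 hw.ne' ha hab
  rcases ht.eq_or_lt with rfl | ht0
  · have e : ∀ c : ℝ, 0 < c → phi c 0 = 0 := by
      intro c hc
      unfold phi
      rw [Real.zero_rpow hc.ne']; simp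
    rw [e a ha] at h
    rw [e b hb]
    rw [phi_eq hw0.le hw.ne' ha] at h
    rw [phi_eq hw0.le hw.ne' hb]
    nlinarith
  · have mt := Hf_strictMono ht0 ht1.ne ha hab
    rw [phi_eq hw0.le hw.ne' ha, phi_eq ht ht1.ne ha] at h
    rw [phi_eq hw0.le hw.ne' hb, phi_eq ht ht1.ne hb]
    have o1 := Hf_one ht1.ne
    have o2 := Hf_one hw.ne'
    obtain ⟨m, hm⟩ : ∃ m, m = (t - 1) / 2 + (w - 1) / 2 := ⟨_, rfl⟩
    have hH : (a + 1) * m = (Hf t 1 + Hf w 1) - (Hf t a + Hf w a) := by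
      rw [o1, o2, hm]; linarith
    suffices 0 < (b - a) * m + ((Hf t b + Hf w b) - (Hf t a + Hf w a)) by
      rw [hm] at this
      linarith
    rcases le_or_gt a 1 with h1 | h1
    · have hm0 : 0 ≤ m := by
        have : 0 ≤ (a + 1) * m := by
          rw [hH]
          rcases h1.eq_or_lt with rfl | h1
          · simp
          · have := Hf_strictMono ht0 ht1.ne ha h1
            have := Hf_strictMono hw0 hw.ne' ha h1
            linarith
        exact nonneg_of_mul_nonneg_right this (by linarith)
      have := mul_nonneg (sub_pos.2 hab).le hm0
      linarith
    · have s1 := Hf_slope ht0 ht1.ne one_pos h1 hab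
      have s2 := Hf_slope hw0 hw.ne' one_pos h1 hab
      have m1 := Hf_strictMono ht0 ht1.ne one_pos h1
      have m2 := Hf_strictMono hw0 hw.ne' one_pos h1
      set A := Hf t a + Hf w a with hA
      set B := Hf t b + Hf w b with hB
      set C := Hf t 1 + Hf w 1 with hC
      have s : (b - 1) * A ≤ (b - a) * C + (a - 1) * B := by
        rw [hA, hB, hC]; linarith
      have hCA : C < A := by rw [hA, hC]; linarith
      have s' : (b - a) * (A - C) ≤ (a - 1) * (B - A) := by linarith
      have hmneg : m < 0 := by
        by_contra hcon
        push Not at hcon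
        have : 0 ≤ (a + 1) * m := mul_nonneg (by linarith) hcon
        linarith
      have e : (a - 1) * ((b - a) * m + (B - A)) ≥ (b - a) * (- 2 * m) := by
        have : A - C = - ((a + 1) * m) := by linarith
        rw [this] at s'
        linarith
      have e2 : 0 < (b - a) * (- 2 * m) := mul_pos (by linarith) (by linarith)
      exact pos_of_mul_pos_right (lt_of_lt_of_le e2 e) (by linarith)

/-! Bounds and monotonicity in `t`. -/

theorem phi_eq' {t a : ℝ} (ht : 0 < t) :
    phi a t = a * ((t ^ (-a) - 1) / (1 - t))⁻¹ := by
  unfold phi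
  rw [Real.rpow_neg ht.le]
  have := Real.rpow_pos_of_pos ht a
  set T := t ^ a
  have e : T⁻¹ - 1 = (1 - T) / T := by field_simp
  rw [e, inv_div, div_div_eq_mul_div, ← neg_div_neg_eq, neg_sub]
  ring

theorem bern {t a : ℝ} (ht : 0 < t) (ht1 : t ≠ 1) (ha : 0 < a) :
    a * (1 - t) < t ^ (-a) - 1 := by
  have h1 := Real.log_lt_sub_one_of_pos ht ht1
  have h2 := Real.add_one_le_exp (Real.log t * (-a))
  rw [Real.rpow_def_of_pos ht]
  nlinarith

theorem phi_zero {a : ℝ} (ha : 0 < a) : phi a 0 = 0 := by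
  unfold phi
  rw [Real.zero_rpow ha.ne']; simp

theorem phi_lt_one {t a : ℝ} (ht : 0 ≤ t) (ht1 : t < 1) (ha : 0 < a) : phi a t < 1 := by
  rcases ht.eq_or_lt with rfl | ht0
  · rw [phi_zero ha]; exact one_pos
  · rw [phi_eq' ht0, inv_div, ← mul_div_assoc]
    have h := bern ht0 ht1.ne ha
    have : 0 < a * (1 - t) := mul_pos ha (by linarith)
    rw [div_lt_one (by linarith)]
    exact h

theorem one_lt_phi {t a : ℝ} (ht1 : 1 < t) (ha : 0 < a) : 1 < phi a t := by
  have ht0 : 0 < t := by linarith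
  rw [phi_eq' ht0, inv_div, ← mul_div_assoc]
  have h := bern ht0 ht1.ne' ha
  have h3 : t ^ (-a) < 1 := Real.rpow_lt_one_of_one_lt_of_neg ht1 (by linarith)
  rw [← neg_div_neg_eq, one_lt_div (by linarith)]
  linarith

theorem convex_rpow_neg {a : ℝ} (ha : 0 < a) : ConvexOn ℝ (Set.Ioi 0) (fun t : ℝ => t ^ (-a)) := by
  apply convexOn_of_hasDerivWithinAt2_nonneg (convex_Ioi 0)
    (f' := fun t => (-a) * t ^ (-a - 1))
    (f'' := fun t => (-a) * ((-a - 1) * t ^ (-a - 1 - 1)))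
  · intro x hx
    exact (Real.hasDerivAt_rpow_const (Or.inl (ne_of_gt hx))).continuousAt.continuousWithinAt
  · intro x hx
    rw [interior_Ioi] at hx
    exact (Real.hasDerivAt_rpow_const (Or.inl (ne_of_gt hx))).hasDerivWithinAt
  · intro x hx
    rw [interior_Ioi] at hx
    exact ((Real.hasDerivAt_rpow_const (Or.inl (ne_of_gt hx))).const_mul (-a)).hasDerivWithinAt
  · intro x hx
    rw [interior_Ioi] at hx
    have := Real.rpow_nonneg (le_of_lt hx) (-a - 1 - 1)
    have : 0 ≤ a * (a + 1) * x ^ (-a - 1 - 1) := by positivity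
    linarith

theorem phi_pos {t a : ℝ} (ht : 0 < t) (ht1 : t ≠ 1) (ha : 0 < a) : 0 < phi a t := by
  unfold phi
  have hp := Real.rpow_pos_of_pos ht a
  rcases lt_or_gt_of_ne ht1 with h | h
  · have := Real.rpow_lt_one ht.le h ha
    rw [← neg_div_neg_eq]
    refine div_pos ?_ (by linarith)
    have : 0 < a * (1 - t) * t ^ a := mul_pos (mul_pos ha (by linarith)) hp
    linarith
  · have := Real.one_lt_rpow h ha
    exact div_pos (mul_pos (mul_pos ha (by linarith)) hp) (by linarith)

theorem phi_mono {s t a : ℝ} (hs : 0 ≤ s) (hst : s ≤ t) (hs1 : s ≠ 1) (ht1 : t ≠ 1) (ha : 0 < a) :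
    phi a s ≤ phi a t := by
  rcases hs.eq_or_lt with rfl | hs0
  · rw [phi_zero ha]
    rcases hst.eq_or_lt with rfl | h
    · rw [phi_zero ha]
    · exact (phi_pos h ht1 ha).le
  have ht0 := lt_of_lt_of_le hs0 hst
  have h := (convex_rpow_neg ha).secant_mono (a := 1) (x := s) (y := t)
    (Set.mem_Ioi.2 one_pos) hs0 ht0 hs1 ht1 hst
  have ps := phi_pos ht0 ht1 ha
  simp only [Real.one_rpow] at h
  rw [phi_eq' ht0] at ps ⊢
  rw [phi_eq' hs0]
  have : 0 < (t ^ (-a) - 1) / (1 - t) := inv_pos.1 (pos_of_mul_pos_right ps ha.le)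
  apply mul_le_mul_of_nonneg_left _ ha.le
  apply inv_anti₀ this
  have e : ∀ r : ℝ, (r ^ (-a) - 1) / (1 - r) = - ((r ^ (-a) - 1) / (r - 1)) := by
    intro r
    rw [← div_neg, neg_sub]
  rw [e, e]
  linarith

theorem phi_div {x y a : ℝ} (hx : 0 ≤ x) (hy : 0 < y) :
    phi a (x / y) = a * (x - y) * x ^ a / (y * (x ^ a - y ^ a)) := by
  unfold phi
  rw [Real.div_rpow hx hy.le]
  have hY := Real.rpow_pos_of_pos hy a
  have e : x ^ a / y ^ a - 1 = (x ^ a - y ^ a) / y ^ a := by field_simp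
  have e2 : x / y - 1 = (x - y) / y := by field_simp
  rw [e, e2, div_div_eq_mul_div, div_eq_div_iff_comm]
  by_cases h : x ^ a - y ^ a = 0
  · simp [h]
  · field_simp

theorem foc {x y z a : ℝ} (hx : 0 ≤ x) (hxy : x < y) (hyz : y < z) (ha : 0 < a)
    (hmax : ∀ v, x < v → v < z →
      x ^ a * v ^ a * (v - x) ^ 2 / (v ^ a - x ^ a) + v ^ a * z ^ a * (z - v) ^ 2 / (z ^ a - v ^ a)
      ≤ x ^ a * y ^ a * (y - x) ^ 2 / (y ^ a - x ^ a)
        + y ^ a * z ^ a * (z - y) ^ 2 / (z ^ a - y ^ a)) :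
    phi a (x / y) + phi a (z / y) = 2 := by
  have hy : 0 < y := by linarith
  have hz : 0 < z := by linarith
  have h1 : phi a (x / y) < 1 := phi_lt_one (by positivity) ((div_lt_one hy).2 hxy) ha
  have h2 : 1 < phi a (z / y) := one_lt_phi ((one_lt_div hy).2 hyz) ha
  have hXY : x ^ a < y ^ a := Real.rpow_lt_rpow hx hxy ha
  have hYZ : y ^ a < z ^ a := Real.rpow_lt_rpow hy.le hyz ha
  have hY : 0 < y ^ a := Real.rpow_pos_of_pos hy a
  have hr : HasDerivAt (fun v : ℝ => v ^ a) (a * y ^ a / y) y := by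
    refine (Real.hasDerivAt_rpow_const (Or.inl hy.ne')).congr_deriv ?_
    rw [Real.rpow_sub_one hy.ne']; ring
  have hid := hasDerivAt_id' y
  have hd := (((hr.const_mul (x ^ a)).mul ((hid.sub_const x).pow 2)).div (hr.sub_const (x ^ a))
      (sub_pos.2 hXY).ne').add
    (((hr.mul_const (z ^ a)).mul ((hid.const_sub z).pow 2)).div (hr.const_sub (z ^ a))
      (sub_pos.2 hYZ).ne')
  have hloc : IsLocalMax (fun v : ℝ => x ^ a * v ^ a * (v - x) ^ 2 / (v ^ a - x ^ a)
      + v ^ a * z ^ a * (z - v) ^ 2 / (z ^ a - v ^ a)) y := by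
    filter_upwards [Ioo_mem_nhds hxy hyz] with v hv
    exact hmax v hv.1 hv.2
  have h0 := hloc.hasDerivAt_eq_zero hd
  rw [phi_div hx hy] at h1 ⊢
  rw [phi_div hz.le hy] at h2 ⊢
  simp only [Pi.mul_apply, Pi.pow_apply] at h0
  set X := x ^ a
  set Y := y ^ a
  set Z := z ^ a
  have n1 : Y - X ≠ 0 := (sub_pos.2 hXY).ne'
  have n1' : X - Y ≠ 0 := (sub_neg.2 hXY).ne
  have n2 : Z - Y ≠ 0 := (sub_pos.2 hYZ).ne'
  set P := a * (x - y) * X / (y * (X - Y)) with hP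
  set R := a * (z - y) * Z / (y * (Z - Y)) with hR
  have hP' : (y - x) * X = P * y * (Y - X) / a := by
    rw [hP]; field_simp; ring
  have hR' : (z - y) * Z = R * y * (Z - Y) / a := by
    rw [hR]; field_simp
  have key : (Y * y / a) * (2 * P - P ^ 2 + (R ^ 2 - 2 * R)) = 0 := by
    rw [← h0, hP, hR]
    field_simp
    norm_num
    ring
  have k2 : 2 * P - P ^ 2 + (R ^ 2 - 2 * R) = 0 :=
    (mul_eq_zero.1 key).resolve_left (by positivity)
  have k3 : (R - P) * (P + R - 2) = 0 := by linear_combination k2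
  have := (mul_eq_zero.1 k3).resolve_left (by linarith)
  linarith

theorem xiSeq_update (l u : ℝ) (n : ℕ) (x : Fin (n - 1) → ℝ) (j : ℕ) (hj : 0 < j) (hjn : j < n)
    (v : ℝ) (i : ℕ) :
    xiSeq l u n (Function.update x ⟨j - 1, by omega⟩ v) i
      = if i = j then v else xiSeq l u n x i := by
  unfold xiSeq
  by_cases hij : i = j
  · subst hij
    simp [hj, hjn]
  · by_cases h : 0 < i ∧ i < n
    · have : i - 1 ≠ j - 1 := by omega
      simp [h, hij, Function.update, this]
    · simp [h, hij]

theorem foc_seq (l u : ℝ) (n : ℕ) (p : ℝ) (hp : 1 < p) (x : Fin (n - 1) → ℝ)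
    (hx : x ∈ domD l u n) (hmin : ∀ y ∈ domD l u n, Vp l u p n x ≤ Vp l u p n y)
    (hnn : ∀ i, 0 ≤ xiSeq l u n x i)
    (j : ℕ) (hj : 0 < j) (hjn : j < n) :
    phi (p - 1) (xiSeq l u n x (j - 1) / xiSeq l u n x j)
      + phi (p - 1) (xiSeq l u n x (j + 1) / xiSeq l u n x j) = 2 := by
  have d1 : xiSeq l u n x (j - 1) < xiSeq l u n x j := by
    have := hx (j - 1) (by omega)
    rwa [Nat.sub_add_cancel hj] at this
  have d2 := hx j hjn
  apply foc (hnn _) d1 d2 (by linarith)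
  intro v hv1 hv2
  have hup := xiSeq_update l u n x j hj hjn v
  set y := Function.update x ⟨j - 1, by omega⟩ v with hy
  have hyd : y ∈ domD l u n := by
    intro i hi
    rw [hup, hup]
    by_cases h1 : i = j
    · subst h1; simpa using hv2
    · by_cases h2 : i + 1 = j
      · have : i = j - 1 := by omega
        rw [if_neg h1, if_pos h2, this]
        exact hv1
      · rw [if_neg h1, if_neg h2]
        exact hx i hi
  have hV := hmin y hyd
  unfold Vp at hV
  have hc : 0 < (p - 1) ^ 2 / (6 * p) := by
    have : 0 < p - 1 := by linarith
    positivity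
  set T : (Fin (n - 1) → ℝ) → ℕ → ℝ := fun x i =>
    (xiSeq l u n x (i - 1)) ^ (p - 1) * (xiSeq l u n x i) ^ (p - 1)
        * (xiSeq l u n x i - xiSeq l u n x (i - 1)) ^ 2
        / ((xiSeq l u n x i) ^ (p - 1) - (xiSeq l u n x (i - 1)) ^ (p - 1)) with hT
  have hV' : ∑ i ∈ Finset.Icc 1 n, T y i ≤ ∑ i ∈ Finset.Icc 1 n, T x i := by
    refine le_of_mul_le_mul_left ?_ hc
    simp only [hT]
    linarith
  have hsub : ({j, j + 1} : Finset ℕ) ⊆ Finset.Icc 1 n := by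
    intro i hi
    simp only [Finset.mem_insert, Finset.mem_singleton] at hi
    rw [Finset.mem_Icc]; omega
  have hz : ∀ i ∈ Finset.Icc 1 n, i ∉ ({j, j + 1} : Finset ℕ) → T y i - T x i = 0 := by
    intro i hi hni
    simp only [Finset.mem_insert, Finset.mem_singleton, not_or] at hni
    rw [Finset.mem_Icc] at hi
    simp only [hT]
    rw [hup, hup, if_neg hni.1, if_neg (by omega)]
    simp
  have hs := Finset.sum_subset hsub hz
  rw [Finset.sum_sub_distrib, Finset.sum_sub_distrib, Finset.sum_pair (by omega),
    Finset.sum_pair (by omega)] at hs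
  have hfin : T y j + T y (j + 1) ≤ T x j + T x (j + 1) := by linarith
  have u1 : xiSeq l u n y (j - 1) = xiSeq l u n x (j - 1) := by rw [hup, if_neg (by omega)]
  have u2 : xiSeq l u n y j = v := by rw [hup, if_pos rfl]
  have u3 : xiSeq l u n y (j + 1) = xiSeq l u n x (j + 1) := by rw [hup, if_neg (by omega)]
  simp only [hT, Nat.add_sub_cancel, u1, u2, u3] at hfin
  exact hfin

theorem xiSeq_pos (l u : ℝ) (hl : 0 ≤ l) (n : ℕ) (x : Fin (n - 1) → ℝ)
    (hx : x ∈ domD l u n) (i : ℕ) (hi : i ≤ n) (h0 : 0 < i) : 0 < xiSeq l u n x i := by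
  have key : ∀ i ≤ n, 0 ≤ xiSeq l u n x i := by
    intro i
    induction i with
    | zero => intro _; simpa [xiSeq] using hl
    | succ k ih =>
      intro hk
      exact (ih (by omega)).trans (hx k (by omega)).le
  obtain ⟨k, rfl⟩ : ∃ k, i = k + 1 := ⟨i - 1, by omega⟩
  exact lt_of_le_of_lt (key k (by omega)) (hx k (by omega))

/-- The coordinates of the minimizer of `V_p` on `D` are strictly increasing in `p`:
if `1 < p < q`, `xp` minimizes `V_p` on `D`, and `xq` minimizes `V_q` on `D`,
then `xp i < xq i` for every `i`. -/
theorem minimizer_coordinates_increasing_in_p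
    (l u : ℝ) (hl : 0 ≤ l) (hlu : l < u) (n : ℕ) (hn : 2 ≤ n)
    (p q : ℝ) (hp : 1 < p) (hpq : p < q)
    (xp xq : Fin (n - 1) → ℝ)
    (hxp : xp ∈ domD l u n) (hxpmin : ∀ y ∈ domD l u n, Vp l u p n xp ≤ Vp l u p n y)
    (hxq : xq ∈ domD l u n) (hxqmin : ∀ y ∈ domD l u n, Vp l u q n xq ≤ Vp l u q n y) :
    ∀ i, xp i < xq i := by
  have hu : 0 < u := lt_of_le_of_lt hl hlu
  have hnn : ∀ x ∈ domD l u n, ∀ i, 0 ≤ xiSeq l u n x i := by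
    intro x hx i
    rcases Nat.eq_zero_or_pos i with rfl | h0
    · simpa [xiSeq] using hl
    · rcases le_or_gt i n with h | h
      · exact (xiSeq_pos l u hl n x hx i h h0).le
      · have h1 : ¬ (0 < i ∧ i < n) := by omega
        simp only [xiSeq, h1, dite_false, if_neg h0.ne']
        exact hu.le
  set X := xiSeq l u n xp with hX
  set Y := xiSeq l u n xq with hY
  -- maximal ratio
  obtain ⟨j, hjm, hj⟩ := Finset.exists_max_image (Finset.Ioo 0 n) (fun i => X i / Y i)
    ⟨1, by rw [Finset.mem_Ioo]; omega⟩
  rw [Finset.mem_Ioo] at hjm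
  have hYpos : ∀ i, 0 < i → i ≤ n → 0 < Y i := fun i h1 h2 => xiSeq_pos l u hl n xq hxq i h2 h1
  have hXpos : ∀ i, 0 < i → i ≤ n → 0 < X i := fun i h1 h2 => xiSeq_pos l u hl n xp hxp i h2 h1
  have hlt : X j / Y j < 1 := by
    by_contra hcon
    push Not at hcon
    have hYj := hYpos j hjm.1 hjm.2.le
    have hXj := hXpos j hjm.1 hjm.2.le
    have hle : ∀ i ≤ n, X i / X j ≤ Y i / Y j := by
      intro i hi
      have h1 : X i ≤ X j / Y j * Y i := by
        by_cases hb : 0 < i ∧ i < n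
        · have := hj i (Finset.mem_Ioo.2 hb)
          exact (div_le_iff₀ (hYpos i hb.1 hi)).1 this
        · have e : X i = Y i := by
            simp only [hX, hY, xiSeq, hb, dite_false]
          rw [e]
          exact le_mul_of_one_le_left (hnn xq hxq i) hcon
      rw [div_le_div_iff₀ hXj hYj]
      calc X i * Y j ≤ X j / Y j * Y i * Y j := mul_le_mul_of_nonneg_right h1 hYj.le
        _ = Y i * X j := by field_simp
    have fp := foc_seq l u n p hp xp hxp hxpmin (hnn xp hxp) j hjm.1 hjm.2
    have fq := foc_seq l u n q (hp.trans hpq) xq hxq hxqmin (hnn xq hxq) j hjm.1 hjm.2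
    have a1 : ∀ x ∈ domD l u n, xiSeq l u n x (j - 1) < xiSeq l u n x j := by
      intro x hx
      have := hx (j - 1) (by omega)
      rwa [Nat.sub_add_cancel hjm.1] at this
    have x1 : X (j - 1) / X j < 1 := (div_lt_one hXj).2 (a1 xp hxp)
    have y1 : Y (j - 1) / Y j < 1 := (div_lt_one hYj).2 (a1 xq hxq)
    have x2 : 1 < X (j + 1) / X j := (one_lt_div hXj).2 (hxp j hjm.2)
    have y2 : 1 < Y (j + 1) / Y j := (one_lt_div hYj).2 (hxq j hjm.2)
    have x0 : 0 ≤ X (j - 1) / X j := div_nonneg (hnn xp hxp _) hXj.le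
    have sc := single_crossing x0 x1 x2 (by linarith) (sub_lt_sub_right hpq 1) fp
    have m1 := phi_mono (a := q - 1) x0 (hle (j - 1) (by omega)) x1.ne y1.ne (by linarith)
    have m2 := phi_mono (a := q - 1) (by linarith) (hle (j + 1) (by omega)) x2.ne' y2.ne'
      (by linarith)
    linarith
  intro i
  have hi := i.2
  have h1 := hj (i + 1) (by rw [Finset.mem_Ioo]; omega)
  have h2 := lt_of_le_of_lt h1 hlt
  rw [div_lt_one (hYpos _ (by omega) (by omega))] at h2
  have hb : 0 < (i : ℕ) + 1 ∧ (i : ℕ) + 1 < n := by omega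
  simpa [hX, hY, xiSeq, hb] using h2
end

section
/- Let ℓ, u be reals with 0 ≤ ℓ < u and let n ≥ 2 be an integer. Consider the equally-spaced points ξ_i := ℓ + (i/n)·(u−ℓ) for i = 1, …, n−1. Then: (i) if 1 < p < 2, F_i(ξ) > 0 for every i = 1, …, n−1; (ii) if p > 2, F_i(ξ) < 0 for every i = 1, …, n−1. -/
/-- The stationarity map `F = (F_1, …, F_{n-1})`: here the coordinate `j : Fin (n-1)`
corresponds to the index `i = j + 1 ∈ {1, …, n-1}` of the paper. -/
noncomputable def Fmap (l u p : ℝ) (n : ℕ) (x : Fin (n - 1) → ℝ) (j : Fin (n - 1)) : ℝ :=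
  -((xiSeq l u n x ((j : ℕ) + 1)) ^ p + (p - 1) * (xiSeq l u n x ((j : ℕ) + 2)) ^ p
      - p * (xiSeq l u n x ((j : ℕ) + 1)) * (xiSeq l u n x ((j : ℕ) + 2)) ^ (p - 1))
    / ((xiSeq l u n x ((j : ℕ) + 2)) ^ (p - 1) - (xiSeq l u n x ((j : ℕ) + 1)) ^ (p - 1))
  + ((xiSeq l u n x ((j : ℕ) + 1)) ^ p + (p - 1) * (xiSeq l u n x (j : ℕ)) ^ p
      - p * (xiSeq l u n x ((j : ℕ) + 1)) * (xiSeq l u n x (j : ℕ)) ^ (p - 1))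
    / ((xiSeq l u n x ((j : ℕ) + 1)) ^ (p - 1) - (xiSeq l u n x (j : ℕ)) ^ (p - 1))

/-- The Jacobian matrix `J(ξ) = [∂F_i/∂ξ_j]` of the map `F` at `x`. -/
noncomputable def Jmat (l u p : ℝ) (n : ℕ) (x : Fin (n - 1) → ℝ) :
    Matrix (Fin (n - 1)) (Fin (n - 1)) ℝ :=
  Matrix.of fun i j => fderiv ℝ (fun y => Fmap l u p n y i) x (Pi.single j 1)

/-- Trapezoid defect of `t ^ (p-1)` on the segment from `x` to `y`. -/
noncomputable def trapH (p x y : ℝ) : ℝ :=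
  p / 2 * ((y - x) * (x ^ (p - 1) + y ^ (p - 1))) - (y ^ p - x ^ p)

lemma trapH_hasDerivAt (p x y : ℝ) (hy : 0 < y) :
    HasDerivAt (trapH p x)
      (p / 2 * (x ^ (p - 1) - y ^ (p - 1) - (p - 1) * (x - y) * y ^ (p - 1 - 1))) y := by
  have h1 : HasDerivAt (fun y : ℝ => y ^ p) (p * y ^ (p - 1)) y :=
    Real.hasDerivAt_rpow_const (Or.inl hy.ne')
  have h2 : HasDerivAt (fun y : ℝ => y ^ (p - 1)) ((p - 1) * y ^ (p - 1 - 1)) y :=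
    Real.hasDerivAt_rpow_const (Or.inl hy.ne')
  have h3 := ((((hasDerivAt_id y).sub_const x).mul (h2.const_add (x ^ (p - 1)))).const_mul
    (p / 2)).sub (h1.sub_const (x ^ p))
  refine (h3.congr_deriv ?_)
  simp only [id]
  ring

lemma trapH_cont (p x : ℝ) (hp : 1 < p) (s : Set ℝ) : ContinuousOn (trapH p x) s := by
  have h1 : Continuous (fun y : ℝ => y ^ p) := Real.continuous_rpow_const (by linarith)
  have h2 : Continuous (fun y : ℝ => y ^ (p - 1)) := Real.continuous_rpow_const (by linarith)
  unfold trapH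
  exact Continuous.continuousOn (by fun_prop)

lemma trapH_self (p x : ℝ) : trapH p x x = 0 := by simp [trapH]

lemma rpow_scale (q x y : ℝ) (hx : 0 ≤ x) (hy : 0 < y) :
    x ^ q - y ^ q - q * (x - y) * y ^ (q - 1)
      = y ^ q * ((1 + (x / y - 1)) ^ q - (1 + q * (x / y - 1))) := by
  have h : 1 + (x / y - 1) = x / y := by ring
  rw [h, Real.div_rpow hx hy.le, Real.rpow_sub_one hy.ne']
  have := (Real.rpow_pos_of_pos hy q).ne'
  field_simp
  ring

lemma trapH_pos (p x y : ℝ) (hp : 2 < p) (hx : 0 ≤ x) (hxy : x < y) : 0 < trapH p x y := by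
  have hm : StrictMonoOn (trapH p x) (Set.Ici x) := by
    refine strictMonoOn_of_deriv_pos (convex_Ici x) (trapH_cont p x (by linarith) _) ?_
    intro z hz
    rw [interior_Ici, Set.mem_Ioi] at hz
    have hz0 : 0 < z := hx.trans_lt hz
    rw [(trapH_hasDerivAt p x z hz0).deriv, rpow_scale _ x z hx hz0]
    have h0 : x / z < 1 := (div_lt_one hz0).2 hz
    have h1 : 0 ≤ x / z := by positivity
    have hb := one_add_mul_self_lt_rpow_one_add (s := x / z - 1) (by linarith)
      (by linarith) (p := p - 1) (by linarith)
    exact mul_pos (by linarith) (mul_pos (Real.rpow_pos_of_pos hz0 _) (by linarith))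
  have := hm (Set.mem_Ici.2 le_rfl) (Set.mem_Ici.2 hxy.le) hxy
  rwa [trapH_self] at this

lemma trapH_neg (p x y : ℝ) (hp1 : 1 < p) (hp : p < 2) (hx : 0 ≤ x) (hxy : x < y) :
    trapH p x y < 0 := by
  have hm : StrictAntiOn (trapH p x) (Set.Ici x) := by
    refine strictAntiOn_of_deriv_neg (convex_Ici x) (trapH_cont p x (by linarith) _) ?_
    intro z hz
    rw [interior_Ici, Set.mem_Ioi] at hz
    have hz0 : 0 < z := hx.trans_lt hz
    rw [(trapH_hasDerivAt p x z hz0).deriv, rpow_scale _ x z hx hz0]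
    have h0 : x / z < 1 := (div_lt_one hz0).2 hz
    have h1 : 0 ≤ x / z := by positivity
    have hb := rpow_one_add_lt_one_add_mul_self (s := x / z - 1) (by linarith)
      (by linarith) (p := p - 1) (by linarith) (by linarith)
    exact mul_neg_of_pos_of_neg (by linarith)
      (mul_neg_of_pos_of_neg (Real.rpow_pos_of_pos hz0 _) (by linarith))
  have := hm (Set.mem_Ici.2 le_rfl) (Set.mem_Ici.2 hxy.le) hxy
  rwa [trapH_self] at this

lemma F_local_eq (p a h : ℝ) (hp : 1 < p) (hh : 0 < h) (hc : 0 ≤ a - h) :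
    -(a ^ p + (p - 1) * (a + h) ^ p - p * a * (a + h) ^ (p - 1))
        / ((a + h) ^ (p - 1) - a ^ (p - 1))
      + (a ^ p + (p - 1) * (a - h) ^ p - p * a * (a - h) ^ (p - 1))
        / (a ^ (p - 1) - (a - h) ^ (p - 1))
    = -(trapH p a (a + h) / ((a + h) ^ (p - 1) - a ^ (p - 1))
      + trapH p (a - h) a / (a ^ (p - 1) - (a - h) ^ (p - 1))) := by
  have ha : 0 < a := by linarith
  have d1 : a ^ (p - 1) < (a + h) ^ (p - 1) :=
    Real.rpow_lt_rpow ha.le (by linarith) (by linarith)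
  have d2 : (a - h) ^ (p - 1) < a ^ (p - 1) :=
    Real.rpow_lt_rpow hc (by linarith) (by linarith)
  have key : ∀ x : ℝ, 0 ≤ x → x ^ p = x * x ^ (p - 1) := by
    intro x hx
    have := Real.rpow_add_of_nonneg hx (y := 1) (z := p - 1) (by norm_num) (by linarith)
    rw [Real.rpow_one] at this
    rw [← this]; congr 1; ring
  unfold trapH
  rw [key a ha.le, key (a + h) (by linarith), key (a - h) hc]
  have e1 := (sub_pos.2 d1).ne'
  have e2 := (sub_pos.2 d2).ne'
  generalize a ^ (p - 1) = A at *
  generalize (a + h) ^ (p - 1) = B at *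
  generalize (a - h) ^ (p - 1) = C at *
  field_simp
  ring

lemma xiSeq_eq (l u : ℝ) (n : ℕ) (hn : 2 ≤ n) (k : ℕ) (hk : k ≤ n) :
    xiSeq l u n (fun i : Fin (n - 1) => l + (((i : ℕ) + 1 : ℝ) / n) * (u - l)) k
      = l + ((k : ℝ) / n) * (u - l) := by
  have hn0 : (n : ℝ) ≠ 0 := by positivity
  unfold xiSeq
  split_ifs with h h'
  · have : ((k - 1 : ℕ) : ℝ) + 1 = k := by
      rw [Nat.cast_sub h.1]; simp
    simp only [this]
  · simp [h']
  · have : k = n := by omega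
    subst this
    field_simp
    ring

lemma Fmap_eq (l u : ℝ) (hl : 0 ≤ l) (hlu : l < u) (n : ℕ) (hn : 2 ≤ n) (p : ℝ) (hp : 1 < p)
    (i : Fin (n - 1)) : ∃ a h : ℝ, 0 < h ∧ 0 ≤ a - h ∧
      Fmap l u p n (fun i : Fin (n - 1) => l + (((i : ℕ) + 1 : ℝ) / n) * (u - l)) i
      = -(trapH p a (a + h) / ((a + h) ^ (p - 1) - a ^ (p - 1))
      + trapH p (a - h) a / (a ^ (p - 1) - (a - h) ^ (p - 1))) := by
  have hi := i.2
  have hn0 : (0 : ℝ) < n := by positivity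
  have hul : 0 < u - l := by linarith
  have hh : 0 < (u - l) / n := by positivity
  have e0 : l + ((i : ℕ) : ℝ) / n * (u - l)
      = (l + (((i : ℕ) + 1 : ℕ) : ℝ) / n * (u - l)) - (u - l) / n := by
    push_cast; ring
  have e2 : l + (((i : ℕ) + 2 : ℕ) : ℝ) / n * (u - l)
      = (l + (((i : ℕ) + 1 : ℕ) : ℝ) / n * (u - l)) + (u - l) / n := by
    push_cast; ring
  have hc : 0 ≤ (l + (((i : ℕ) + 1 : ℕ) : ℝ) / n * (u - l)) - (u - l) / n := by
    rw [← e0]; positivity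
  refine ⟨l + (((i : ℕ) + 1 : ℕ) : ℝ) / n * (u - l), (u - l) / n, hh, hc, ?_⟩
  rw [← F_local_eq p _ _ hp hh hc]
  unfold Fmap
  rw [xiSeq_eq l u n hn _ (by omega), xiSeq_eq l u n hn _ (by omega),
    xiSeq_eq l u n hn _ (by omega), e0, e2]

/-- At the equally-spaced points `ξᵢ = ℓ + (i/n)(u−ℓ)`: `F > 0` componentwise when
`1 < p < 2`, and `F < 0` componentwise when `p > 2`. -/
theorem Fmap_sign_at_equally_spaced
    (l u : ℝ) (hl : 0 ≤ l) (hlu : l < u) (n : ℕ) (hn : 2 ≤ n) (p : ℝ) :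
    ((1 < p ∧ p < 2) → ∀ i, 0 < Fmap l u p n
        (fun i : Fin (n - 1) => l + (((i : ℕ) + 1 : ℝ) / n) * (u - l)) i) ∧
    (2 < p → ∀ i, Fmap l u p n
        (fun i : Fin (n - 1) => l + (((i : ℕ) + 1 : ℝ) / n) * (u - l)) i < 0) := by
  constructor
  · rintro ⟨hp1, hp2⟩ i
    obtain ⟨a, h, hh, hc, e⟩ := Fmap_eq l u hl hlu n hn p hp1 i
    rw [e]
    have d1 : a ^ (p - 1) < (a + h) ^ (p - 1) :=
      Real.rpow_lt_rpow (by linarith) (by linarith) (by linarith)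
    have d2 : (a - h) ^ (p - 1) < a ^ (p - 1) :=
      Real.rpow_lt_rpow hc (by linarith) (by linarith)
    have t1 := div_neg_of_neg_of_pos
      (trapH_neg p a (a + h) hp1 hp2 (by linarith) (by linarith)) (sub_pos.2 d1)
    have t2 := div_neg_of_neg_of_pos
      (trapH_neg p (a - h) a hp1 hp2 hc (by linarith)) (sub_pos.2 d2)
    linarith
  · intro hp i
    obtain ⟨a, h, hh, hc, e⟩ := Fmap_eq l u hl hlu n hn p (by linarith) i
    rw [e]
    have d1 : a ^ (p - 1) < (a + h) ^ (p - 1) :=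
      Real.rpow_lt_rpow (by linarith) (by linarith) (by linarith)
    have d2 : (a - h) ^ (p - 1) < a ^ (p - 1) :=
      Real.rpow_lt_rpow hc (by linarith) (by linarith)
    have t1 := div_pos
      (trapH_pos p a (a + h) hp (by linarith) (by linarith)) (sub_pos.2 d1)
    have t2 := div_pos
      (trapH_pos p (a - h) a hp hc (by linarith)) (sub_pos.2 d2)
    linarith
end

section
/- Let ℓ, u be reals with 0 ≤ ℓ < u, let n ≥ 2 be an integer, and let p > 1 with p ≠ 2. Let x⁰ := (ℓ + (u−ℓ)/n, ℓ + 2(u−ℓ)/n, …, ℓ + (n−1)(u−ℓ)/n) ∈ D, and let x* ∈ D be the unique point with F(x*) = 0. Then the Newton sequence defined by x^{k+1} := x^k − J(x^k)^{−1}·F(x^k) is well defined (for every k, x^k ∈ D and the Jacobian J(x^k) of F at x^k is invertible), and: if 1 < p < 2 the sequence (x^k) is componentwise monotonically decreasing and converges to x*; if p > 2 the sequence (x^k) is componentwise monotonically increasing and converges to x*. -/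
/-- Intersection abscissa of tangents (a Stolarsky mean). -/
noncomputable def tm (p a b : ℝ) : ℝ := (p - 1) / p * (b ^ p - a ^ p) / (b ^ (p - 1) - a ^ (p - 1))

noncomputable def tA (p a b : ℝ) : ℝ :=
  (p - 1) * (tm p a b - a) * (a ^ (p - 1) / a) / (b ^ (p - 1) - a ^ (p - 1))

noncomputable def tB (p a b : ℝ) : ℝ :=
  (p - 1) * (b - tm p a b) * (b ^ (p - 1) / b) / (b ^ (p - 1) - a ^ (p - 1))

lemma rpow_split {p a : ℝ} (hp : 1 < p) (ha : 0 ≤ a) : a ^ p = a * a ^ (p - 1) := by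
  rcases ha.eq_or_lt with h | h
  · subst h; rw [Real.zero_rpow (by linarith)]; simp
  · rw [Real.rpow_sub_one h.ne']; field_simp

lemma pow_lt {p a b : ℝ} (hp : 1 < p) (ha : 0 ≤ a) (hab : a < b) :
    0 < b ^ (p - 1) - a ^ (p - 1) :=
  sub_pos.2 (Real.rpow_lt_rpow ha hab (by linarith))

lemma young_strict {p x y : ℝ} (hp : 1 < p) (hx : 0 ≤ x) (hy : 0 ≤ y) (hxy : x ≠ y) :
    p * x * y ^ (p - 1) < x ^ p + (p - 1) * y ^ p := by
  rcases hy.eq_or_lt with h | h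
  · subst h
    rw [Real.zero_rpow (by linarith), Real.zero_rpow (by linarith)]
    have : 0 < x := lt_of_le_of_ne hx (Ne.symm hxy)
    have := Real.rpow_pos_of_pos this p
    linarith
  · have h1 := one_add_mul_self_lt_rpow_one_add (s := x / y - 1) (by
      have : 0 ≤ x / y := by positivity
      linarith) (by
      intro h0
      apply hxy
      have : x / y = 1 := by linarith
      field_simp at this
      exact this) hp
    rw [show 1 + (x / y - 1) = x / y by ring, Real.div_rpow hx hy] at h1
    rw [rpow_split hp hy] at h1 ⊢
    have h2 : 0 < y ^ (p - 1) := Real.rpow_pos_of_pos h _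
    have h3 := mul_lt_mul_of_pos_right h1 (mul_pos h h2)
    rw [div_mul_cancel₀ _ (mul_pos h h2).ne'] at h3
    have : (1 + p * (x / y - 1)) * (y * y ^ (p - 1)) = (y + p * (x - y)) * y ^ (p - 1) := by
      field_simp
    rw [this] at h3
    linarith

lemma tm_lt {p a b : ℝ} (hp : 1 < p) (ha : 0 ≤ a) (hab : a < b) : tm p a b < b := by
  have hD := pow_lt hp ha hab
  have hb : 0 ≤ b := by linarith
  have hy := young_strict hp hb ha hab.ne'
  unfold tm
  rw [div_lt_iff₀ hD, div_mul_eq_mul_div, div_lt_iff₀ (by linarith)]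
  rw [rpow_split hp hb, rpow_split hp ha] at *
  linarith

lemma lt_tm {p a b : ℝ} (hp : 1 < p) (ha : 0 ≤ a) (hab : a < b) : a < tm p a b := by
  have hD := pow_lt hp ha hab
  have hb : 0 ≤ b := by linarith
  have hy := young_strict hp ha hb hab.ne
  unfold tm
  rw [lt_div_iff₀ hD, div_mul_eq_mul_div, lt_div_iff₀ (by linarith)]
  rw [rpow_split hp hb, rpow_split hp ha] at *
  linarith

lemma tA_pos {p a b : ℝ} (hp : 1 < p) (ha : 0 < a) (hab : a < b) : 0 < tA p a b := by
  have hD := pow_lt hp ha.le hab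
  have := lt_tm hp ha.le hab
  have h2 : 0 < a ^ (p - 1) := Real.rpow_pos_of_pos ha _
  unfold tA
  have h3 : 0 < tm p a b - a := by linarith
  have h4 : 0 < p - 1 := by linarith
  positivity

lemma tB_pos {p a b : ℝ} (hp : 1 < p) (ha : 0 ≤ a) (hab : a < b) : 0 < tB p a b := by
  have hD := pow_lt hp ha hab
  have := tm_lt hp ha hab
  have hb : 0 < b := by linarith
  have h2 : 0 < b ^ (p - 1) := Real.rpow_pos_of_pos hb _
  unfold tB
  have h3 : 0 < b - tm p a b := by linarith
  have h4 : 0 < p - 1 := by linarith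
  positivity

lemma tm_mul {p a b : ℝ} (hp : 1 < p) (ha : 0 ≤ a) (hab : a < b) :
    p * tm p a b * (b ^ (p - 1) - a ^ (p - 1)) =
      (p - 1) * (b * b ^ (p - 1) - a * a ^ (p - 1)) := by
  have hD := (pow_lt hp ha hab).ne'
  unfold tm
  rw [rpow_split hp ha, rpow_split hp (ha.trans hab.le)]
  field_simp

lemma tm_sub {p a b : ℝ} (hp : 1 < p) (ha : 0 ≤ a) (hab : a < b) :
    tm p a b - tB p a b * b =
      (p - 1) * (tm p a b - a) * a ^ (p - 1) / (b ^ (p - 1) - a ^ (p - 1)) := by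
  have hD := (pow_lt hp ha hab).ne'
  have hb : b ≠ 0 := by linarith
  have h := tm_mul hp ha hab
  unfold tB
  field_simp
  linarith

lemma tm_euler {p a b : ℝ} (hp : 1 < p) (ha : 0 < a) (hab : a < b) :
    tm p a b = tA p a b * a + tB p a b * b := by
  have h := tm_sub hp ha.le hab
  have hD := (pow_lt hp ha.le hab).ne'
  have : tA p a b * a = (p - 1) * (tm p a b - a) * a ^ (p - 1) / (b ^ (p - 1) - a ^ (p - 1)) := by
    unfold tA
    field_simp
  linarith

lemma tm_sub_nonneg {p a b : ℝ} (hp : 1 < p) (ha : 0 ≤ a) (hab : a < b) :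
    0 ≤ tm p a b - tB p a b * b := by
  rw [tm_sub hp ha hab]
  have hD := pow_lt hp ha hab
  have := lt_tm hp ha hab
  have h3 : 0 < tm p a b - a := by linarith
  have h4 : 0 < p - 1 := by linarith
  positivity

lemma tB_lt_one {p a b : ℝ} (hp : 1 < p) (ha : 0 ≤ a) (hab : a < b) : tB p a b < 1 := by
  have h1 := tm_sub_nonneg hp ha hab
  have h2 := tm_lt hp ha hab
  have hb : 0 < b := by linarith
  by_contra h
  push Not at h
  nlinarith

lemma tm_zero {p b : ℝ} (hp : 1 < p) (hb : 0 < b) : tm p 0 b = (p - 1) / p * b := by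
  have h := tm_mul hp le_rfl hb
  rw [Real.zero_rpow (by linarith)] at h
  have h2 : 0 < b ^ (p - 1) := Real.rpow_pos_of_pos hb _
  field_simp
  apply mul_right_cancel₀ h2.ne'
  linarith

lemma tm_zero_sub {p b : ℝ} (hp : 1 < p) (hb : 0 < b) : tm p 0 b - tB p 0 b * b = 0 := by
  rw [tm_sub hp le_rfl hb, Real.zero_rpow (by linarith)]; simp

lemma tm_hom {p a b c : ℝ} (ha : 0 ≤ a) (hb : 0 ≤ b) (hc : 0 < c) :
    tm p (c * a) (c * b) = c * tm p a b := by
  unfold tm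
  rw [Real.mul_rpow hc.le ha, Real.mul_rpow hc.le ha, Real.mul_rpow hc.le hb,
    Real.mul_rpow hc.le hb, ← mul_sub, ← mul_sub, Real.rpow_sub_one hc.ne']
  have h2 : c ^ p ≠ 0 := (Real.rpow_pos_of_pos hc _).ne'
  have : (p - 1) / p * (c ^ p * (b ^ p - a ^ p)) / (c ^ p / c * (b ^ (p - 1) - a ^ (p - 1))) =
    (c ^ p / c ^ p) * c * ((p - 1) / p * (b ^ p - a ^ p) / (b ^ (p - 1) - a ^ (p - 1))) := by
    simp only [div_eq_mul_inv, mul_inv, inv_inv]; ring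
  rw [this, div_self h2]; ring

/-! ### derivatives -/

lemma hasDerivAt_rpw {q b : ℝ} (hb : 0 < b) :
    HasDerivAt (fun x : ℝ => x ^ q) (q * (b ^ q / b)) b := by
  have := Real.hasDerivAt_rpow_const (x := b) (p := q) (Or.inl hb.ne')
  rwa [Real.rpow_sub_one hb.ne'] at this

noncomputable def psi (p a b : ℝ) : ℝ :=
  (p - 2) * (b * b ^ (p - 1) - a * a ^ (p - 1)) - p * (a * b ^ (p - 1) - b * a ^ (p - 1))

lemma chi_nonneg {p a b : ℝ} (ha : 0 < a) (hab : a ≤ b) (hp : 1 < p) :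
    0 ≤ (p - 2) * ((p - 2) * b ^ (p - 1) - (p - 1) * a * (b ^ (p - 1) / b) + a ^ (p - 1)) := by
  have hd : ∀ x, 0 < x → HasDerivAt (fun b : ℝ => (p - 2) * ((p - 2) * b ^ (p - 1)
      - (p - 1) * a * (b ^ (p - 1) / b) + a ^ (p - 1)))
      ((p - 2) ^ 2 * (p - 1) * (x ^ (p - 1) / x ^ 2) * (x - a)) x := by
    intro x hx
    have h := hasDerivAt_rpw (q := p - 1) hx
    have h2 := (((h.const_mul (p - 2)).sub ((h.div (hasDerivAt_id x) hx.ne').const_mul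
      ((p - 1) * a))).add_const (a ^ (p - 1))).const_mul (p - 2)
    refine h2.congr_deriv ?_
    simp only [id]
    field_simp
    ring
  have hm : MonotoneOn (fun b : ℝ => (p - 2) * ((p - 2) * b ^ (p - 1)
      - (p - 1) * a * (b ^ (p - 1) / b) + a ^ (p - 1))) (Set.Ici a) := by
    apply monotoneOn_of_deriv_nonneg (convex_Ici a)
    · intro x hx
      exact (hd x (lt_of_lt_of_le ha hx)).continuousAt.continuousWithinAt
    · intro x hx
      rw [interior_Ici] at hx
      exact (hd x (lt_trans ha hx)).differentiableAt.differentiableWithinAt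
    · intro x hx
      rw [interior_Ici] at hx
      have hx' : a < x := hx
      have hx0 : 0 < x := ha.trans hx'
      rw [(hd x hx0).deriv]
      have : 0 < x ^ (p - 1) := Real.rpow_pos_of_pos hx0 _
      have h3 : 0 < x - a := by linarith
      have h4 : 0 < p - 1 := by linarith
      positivity
  have := hm (Set.mem_Ici.2 le_rfl) (Set.mem_Ici.2 hab) hab
  refine le_trans (le_of_eq ?_) this
  simp only
  field_simp
  ring

lemma psi_nonneg {p a b : ℝ} (ha : 0 < a) (hab : a ≤ b) (hp : 1 < p) :
    0 ≤ (p - 2) * psi p a b := by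
  have hd : ∀ x, 0 < x → HasDerivAt (fun b : ℝ => (p - 2) * psi p a b)
      (p * ((p - 2) * ((p - 2) * x ^ (p - 1)
      - (p - 1) * a * (x ^ (p - 1) / x) + a ^ (p - 1)))) x := by
    intro x hx
    have h := hasDerivAt_rpw (q := p - 1) hx
    have h2 := ((((((hasDerivAt_id x).mul h).sub_const (a * a ^ (p - 1))).const_mul (p - 2)).sub
      (((h.const_mul a).sub ((hasDerivAt_id x).mul_const (a ^ (p - 1)))).const_mul p))).const_mul
      (p - 2)
    refine h2.congr_deriv ?_
    simp only [id]
    field_simp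
    ring
  have hm : MonotoneOn (fun b : ℝ => (p - 2) * psi p a b) (Set.Ici a) := by
    apply monotoneOn_of_deriv_nonneg (convex_Ici a)
    · intro x hx
      exact (hd x (lt_of_lt_of_le ha hx)).continuousAt.continuousWithinAt
    · intro x hx
      rw [interior_Ici] at hx
      exact (hd x (lt_trans ha hx)).differentiableAt.differentiableWithinAt
    · intro x hx
      rw [interior_Ici] at hx
      have hx' : a < x := hx
      have hx0 : 0 < x := ha.trans hx'
      rw [(hd x hx0).deriv]
      exact mul_nonneg (by linarith) (chi_nonneg ha hx'.le hp)
  have := hm (Set.mem_Ici.2 le_rfl) (Set.mem_Ici.2 hab) hab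
  refine le_trans (le_of_eq ?_) this
  simp only [psi]
  ring

/-- Comparison with the midpoint. -/
lemma tm_mid {p a b : ℝ} (hp : 1 < p) (ha : 0 ≤ a) (hab : a < b) :
    0 ≤ (p - 2) * (tm p a b - (a + b) / 2) := by
  have hb : 0 < b := by linarith
  rcases ha.eq_or_lt with h | h
  · subst h
    rw [tm_zero hp hb]
    have : (p - 2) * ((p - 1) / p * b - (0 + b) / 2) = (p - 2) ^ 2 * (b / (2 * p)) := by
      field_simp; ring
    rw [this]; positivity
  · have h1 := psi_nonneg h hab.le hp
    have h2 := tm_mul hp ha hab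
    have hD := pow_lt hp ha hab
    have h3 : (p - 2) * psi p a b = (p - 2) * (tm p a b - (a + b) / 2) *
        (2 * p * (b ^ (p - 1) - a ^ (p - 1))) := by
      unfold psi
      linear_combination (-(2 * (p - 2))) * h2
    rw [h3] at h1
    exact nonneg_of_mul_nonneg_left h1 (by positivity)

lemma tm_eq {p a b : ℝ} (hp : 1 < p) (ha : 0 ≤ a) (hab : a < b) :
    tm p a b = (p - 1) / p * (b * b ^ (p - 1) - a * a ^ (p - 1)) /
      (b ^ (p - 1) - a ^ (p - 1)) := by
  unfold tm
  rw [rpow_split hp ha, rpow_split hp (ha.trans hab.le)]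

lemma hasDerivAt_tm {p a b : ℝ} (hp : 1 < p) (ha : 0 ≤ a) (hab : a < b) :
    HasDerivAt (fun x => tm p a x) (tB p a b) b := by
  have hb : 0 < b := by linarith
  have h := hasDerivAt_rpw (q := p - 1) hb
  have hD := (pow_lt hp ha hab).ne'
  have hA := hasDerivAt_rpw (q := p) hb
  have h2 := ((hA.sub_const (a ^ p)).const_mul ((p - 1) / p)).div (h.sub_const (a ^ (p - 1))) hD
  refine h2.congr_deriv ?_
  unfold tB
  rw [tm_eq hp ha hab, rpow_split hp ha, rpow_split hp hb.le]
  field_simp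

lemma hasDerivAt_tB {p a b : ℝ} (hp : 1 < p) (ha : 0 < a) (hab : a < b) :
    HasDerivAt (fun x => tB p a x) ((p - 1) ^ 2 / p * (b ^ (p - 1) / b ^ 2) * a ^ (p - 1) *
      psi p a b / (b ^ (p - 1) - a ^ (p - 1)) ^ 3) b := by
  have hb : 0 < b := by linarith
  have h := hasDerivAt_rpw (q := p - 1) hb
  have hD := (pow_lt hp ha.le hab).ne'
  have h1 := hasDerivAt_tm hp ha.le hab
  have h2 := ((((hasDerivAt_id b).sub h1).const_mul (p - 1)).mul
    (h.div (hasDerivAt_id b) hb.ne')).div (h.sub_const (a ^ (p - 1))) hD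
  refine h2.congr_deriv ?_
  simp only [id, Pi.mul_apply, Pi.div_apply, Pi.sub_apply]
  unfold tB psi
  rw [tm_eq hp ha.le hab]
  generalize b ^ (p - 1) = B at *
  generalize a ^ (p - 1) = A at *
  field_simp
  ring

lemma tB_mono {p a : ℝ} (hp : 1 < p) (ha : 0 < a) :
    MonotoneOn (fun x => (p - 2) * tB p a x) (Set.Ioi a) := by
  have hd := fun x (hx : a < x) => (hasDerivAt_tB hp ha hx).const_mul (p - 2)
  apply monotoneOn_of_deriv_nonneg (convex_Ioi a)
  · intro x hx
    exact (hd x hx).continuousAt.continuousWithinAt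
  · intro x hx
    rw [interior_Ioi] at hx
    exact (hd x hx).differentiableAt.differentiableWithinAt
  · intro x hx
    rw [interior_Ioi] at hx
    have hx' : a < x := hx
    have hx0 : 0 < x := ha.trans hx'
    rw [(hd x hx').deriv]
    have h1 := psi_nonneg ha hx'.le hp
    have hD := pow_lt hp ha.le hx'
    have h5 : 0 < x ^ (p - 1) := Real.rpow_pos_of_pos hx0 _
    have h6 : 0 < a ^ (p - 1) := Real.rpow_pos_of_pos ha _
    have : (p - 2) * ((p - 1) ^ 2 / p * (x ^ (p - 1) / x ^ 2) * a ^ (p - 1) *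
      psi p a x / (x ^ (p - 1) - a ^ (p - 1)) ^ 3) =
      ((p - 2) * psi p a x) * ((p - 1) ^ 2 / p * (x ^ (p - 1) / x ^ 2) * a ^ (p - 1)
       / (x ^ (p - 1) - a ^ (p - 1)) ^ 3) := by ring
    rw [this]
    exact mul_nonneg h1 (by positivity)

lemma tm_tangent {p a b d : ℝ} (hp : 1 < p) (ha : 0 < a) (hab : a < b) (had : a < d) :
    0 ≤ (p - 2) * (tm p a d - tm p a b - tB p a b * (d - b)) := by
  have hd := fun x (hx : a < x) => (hasDerivAt_tm hp ha.le hx).const_mul (p - 2)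
  have hm := tB_mono hp ha
  rcases lt_trichotomy b d with h | h | h
  · obtain ⟨c, hc, he⟩ := exists_hasDerivAt_eq_slope (fun x => (p - 2) * tm p a x)
      (fun x => (p - 2) * tB p a x) h
      (fun x hx => (hd x (lt_of_lt_of_le hab hx.1)).continuousAt.continuousWithinAt)
      (fun x hx => hd x (hab.trans hx.1))
    have := hm (Set.mem_Ioi.2 hab) (Set.mem_Ioi.2 (hab.trans hc.1)) hc.1.le
    simp only at this
    rw [he, le_div_iff₀ (by linarith)] at this
    linarith
  · subst h; simp
  · obtain ⟨c, hc, he⟩ := exists_hasDerivAt_eq_slope (fun x => (p - 2) * tm p a x)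
      (fun x => (p - 2) * tB p a x) h
      (fun x hx => (hd x (lt_of_lt_of_le had hx.1)).continuousAt.continuousWithinAt)
      (fun x hx => hd x (had.trans hx.1))
    have := hm (Set.mem_Ioi.2 (had.trans hc.1)) (Set.mem_Ioi.2 hab) hc.2.le
    simp only at this
    rw [he, div_le_iff₀ (by linarith)] at this
    linarith

lemma tm_grad {p a b c d : ℝ} (hp : 1 < p) (ha : 0 < a) (hab : a < b) (hc : 0 < c) (hcd : c < d) :
    0 ≤ (p - 2) * (tm p c d - (tA p a b * c + tB p a b * d)) := by
  have h1 : a < a / c * d := by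
    rw [div_mul_eq_mul_div, lt_div_iff₀ hc]; nlinarith
  have h := tm_tangent hp ha hab h1
  have hh := tm_hom (p := p) (a := c) (b := d) (c := a / c) hc.le (by linarith) (by positivity)
  rw [div_mul_cancel₀ _ hc.ne'] at hh
  rw [hh] at h
  have he := tm_euler hp ha hab
  have : (p - 2) * (a / c * tm p c d - tm p a b - tB p a b * (a / c * d - b)) =
    (a / c) * ((p - 2) * (tm p c d - (tA p a b * c + tB p a b * d))) := by
    rw [he]; field_simp; ring
  rw [this] at h
  exact nonneg_of_mul_nonneg_right h (by positivity)

lemma tA_add_tB {p a b : ℝ} (hp : 1 < p) (ha : 0 < a) (hab : a < b) :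
    0 ≤ (p - 2) * (1 - (tA p a b + tB p a b)) := by
  by_contra hneg
  push Not at hneg
  have hA := tA_pos hp ha hab
  have hB := tB_pos hp ha.le hab
  have hB1 := tB_lt_one hp ha.le hab
  rcases lt_trichotomy p 2 with h | h | h
  · have hs : tA p a b + tB p a b < 1 := by nlinarith
    set e := 1 - (tA p a b + tB p a b) with he
    have h1 := tm_grad hp ha hab one_pos (show (1:ℝ) < 1 + e by linarith)
    have h2 := lt_tm hp zero_le_one (show (1:ℝ) < 1 + e by linarith)
    have h3 : tm p 1 (1 + e) ≤ tA p a b * 1 + tB p a b * (1 + e) := by nlinarith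
    nlinarith
  · subst h; simp at hneg
  · have hs : 1 < tA p a b + tB p a b := by nlinarith
    set e := (tA p a b + tB p a b) - 1 with he
    have h1 := tm_grad hp ha hab one_pos (show (1:ℝ) < 1 + e by linarith)
    have h2 := tm_lt hp zero_le_one (show (1:ℝ) < 1 + e by linarith)
    have h3 : tA p a b * 1 + tB p a b * (1 + e) ≤ tm p 1 (1 + e) := by nlinarith
    nlinarith

/-! ### tridiagonal maximum principle -/

def Lam (A B w : ℕ → ℝ) (i : ℕ) : ℝ :=
  2 * w (i + 1) - A (i + 1) * w (i + 1) - B (i + 1) * w (i + 2) - A i * w i - B i * w (i + 1)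

lemma max_principle (n : ℕ) (A B v w : ℕ → ℝ) (hA : ∀ i < n, 0 ≤ A i) (hB : ∀ i < n, 0 < B i)
    (hv0 : 0 ≤ v 0) (hv : ∀ i, 1 ≤ i → i ≤ n → 0 < v i)
    (hLv : ∀ i, i + 1 < n → 0 ≤ Lam A B v i)
    (hw0 : 0 ≤ w 0) (hwn : 0 ≤ w n)
    (hLw : ∀ i, i + 1 < n → 0 ≤ Lam A B w i) : ∀ i ≤ n, 0 ≤ w i := by
  by_contra hcon
  push Not at hcon
  obtain ⟨k, hkn, hk⟩ := hcon
  have hk1 : 1 ≤ k := by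
    rcases Nat.eq_zero_or_pos k with h | h
    · subst h; linarith
    · exact h
  obtain ⟨i0, hi0, hmin⟩ := Finset.exists_min_image (Finset.Icc 1 n) (fun i => w i / v i)
    ⟨k, Finset.mem_Icc.2 ⟨hk1, hkn⟩⟩
  set c := w i0 / v i0 with hc
  have hcneg : c < 0 := lt_of_le_of_lt (hmin k (Finset.mem_Icc.2 ⟨hk1, hkn⟩))
    (div_neg_of_neg_of_pos hk (hv k hk1 hkn))
  obtain ⟨m, hm, hmax⟩ := Finset.exists_max_image
    ((Finset.Icc 1 n).filter (fun i => w i / v i = c)) id ⟨i0, by simp [hi0, hc]⟩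
  rw [Finset.mem_filter, Finset.mem_Icc] at hm
  obtain ⟨⟨hm1, hmn⟩, hmc⟩ := hm
  have hge : ∀ i, 1 ≤ i → i ≤ n → c * v i ≤ w i := by
    intro i h1 h2
    have := hmin i (Finset.mem_Icc.2 ⟨h1, h2⟩)
    exact (le_div_iff₀ (hv i h1 h2)).1 this
  have hmeq : w m = c * v m := by
    rw [← hmc, div_mul_cancel₀ _ (hv m hm1 hmn).ne']
  have hmlt : m < n := by
    refine lt_of_le_of_ne hmn ?_
    rintro rfl
    have := hv m hm1 le_rfl
    nlinarith
  have hgt : c * v (m + 1) < w (m + 1) := by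
    refine lt_of_le_of_ne (hge _ (by omega) (by omega)) ?_
    intro h
    have hmem : m + 1 ∈ (Finset.Icc 1 n).filter (fun i => w i / v i = c) := by
      rw [Finset.mem_filter, Finset.mem_Icc]
      refine ⟨⟨by omega, by omega⟩, ?_⟩
      rw [← h, mul_div_cancel_right₀ _ (hv _ (by omega) (by omega)).ne']
    have := hmax _ hmem
    simp at this
  obtain ⟨j, rfl⟩ : ∃ j, m = j + 1 := ⟨m - 1, by omega⟩
  have hj : c * v j ≤ w j := by
    rcases Nat.eq_zero_or_pos j with h | h
    · subst h; nlinarith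
    · exact hge j h (by omega)
  have h1 := hLv j hmlt
  have h2 := hLw j hmlt
  have hAj := hA j (by omega)
  have hBj := hB (j + 1) hmlt
  unfold Lam at h1 h2
  rw [hmeq] at h2
  have e1 := mul_lt_mul_of_pos_left hgt hBj
  have e2 := mul_le_mul_of_nonneg_left hj hAj
  have e3 := mul_nonpos_of_nonpos_of_nonneg hcneg.le h1
  rw [show j + 1 + 1 = j + 2 by rfl] at e1
  linarith

structure Good (l u : ℝ) (n : ℕ) (X : ℕ → ℝ) : Prop where
  zero : X 0 = l
  last : X n = u
  lt : ∀ i < n, X i < X (i + 1)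

lemma Good.ge {l u : ℝ} {n : ℕ} {X : ℕ → ℝ} (h : Good l u n X) : ∀ i ≤ n, l ≤ X i := by
  intro i
  induction i with
  | zero => intro _; exact h.zero.ge
  | succ k ih => intro hk; exact (ih (by omega)).trans (h.lt k (by omega)).le

lemma Good.pos {l u : ℝ} {n : ℕ} {X : ℕ → ℝ} (h : Good l u n X) (hl : 0 ≤ l) :
    ∀ i, 1 ≤ i → i ≤ n → 0 < X i := by
  intro i h1 h2
  obtain ⟨j, rfl⟩ : ∃ j, i = j + 1 := ⟨i - 1, by omega⟩
  have := h.ge j (by omega)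
  have := h.lt j (by omega)
  linarith

noncomputable def GX (p : ℝ) (X : ℕ → ℝ) (i : ℕ) : ℝ :=
  2 * X (i + 1) - tm p (X (i + 1)) (X (i + 2)) - tm p (X i) (X (i + 1))

noncomputable def cA (p : ℝ) (X : ℕ → ℝ) (i : ℕ) : ℝ :=
  if i = 0 then 0 else tA p (X i) (X (i + 1))

noncomputable def cB (p : ℝ) (X : ℕ → ℝ) (i : ℕ) : ℝ := tB p (X i) (X (i + 1))

noncomputable def ct (p : ℝ) (X : ℕ → ℝ) (i : ℕ) : ℝ :=
  tm p (X i) (X (i + 1)) - cA p X i * X i - cB p X i * X (i + 1)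

section
variable {l u p : ℝ} {n : ℕ} {X : ℕ → ℝ}

lemma cA_zero : cA p X 0 = 0 := by simp [cA]

lemma cA_pos (hp : 1 < p) (hl : 0 ≤ l) (h : Good l u n X) {i : ℕ} (hi : i < n) (h1 : 1 ≤ i) :
    0 < cA p X i := by
  unfold cA
  rw [if_neg (by omega)]
  exact tA_pos hp (h.pos hl i h1 hi.le) (h.lt i hi)

lemma cA_nonneg (hp : 1 < p) (hl : 0 ≤ l) (h : Good l u n X) {i : ℕ} (hi : i < n) :
    0 ≤ cA p X i := by
  rcases Nat.eq_zero_or_pos i with h0 | h0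
  · subst h0; exact cA_zero.ge
  · exact (cA_pos hp hl h hi h0).le

lemma cB_pos (hp : 1 < p) (hl : 0 ≤ l) (h : Good l u n X) {i : ℕ} (hi : i < n) :
    0 < cB p X i := tB_pos hp (hl.trans (h.ge i hi.le)) (h.lt i hi)

lemma cB_lt_one (hp : 1 < p) (hl : 0 ≤ l) (h : Good l u n X) {i : ℕ} (hi : i < n) :
    cB p X i < 1 := tB_lt_one hp (hl.trans (h.ge i hi.le)) (h.lt i hi)

lemma ct_succ (hp : 1 < p) (hl : 0 ≤ l) (h : Good l u n X) {i : ℕ} (hi : i < n) (h1 : 1 ≤ i) :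
    ct p X i = 0 := by
  have := tm_euler hp (h.pos hl i h1 hi.le) (h.lt i hi)
  unfold ct cA cB
  rw [if_neg (by omega)]
  linarith

lemma ct_nonneg (hp : 1 < p) (hl : 0 ≤ l) (h : Good l u n X) {i : ℕ} (hi : i < n) :
    0 ≤ ct p X i := by
  rcases Nat.eq_zero_or_pos i with h0 | h0
  · subst h0
    have := tm_sub_nonneg hp (hl.trans (h.ge 0 hi.le)) (h.lt 0 hi)
    unfold ct
    rw [cA_zero]
    unfold cB
    linarith
  · exact (ct_succ hp hl h hi h0).ge

lemma c_sum (hp : 1 < p) (hl : 0 ≤ l) (h : Good l u n X) {i : ℕ} (hi : i < n) (h1 : 1 ≤ i) :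
    0 ≤ (p - 2) * (1 - (cA p X i + cB p X i)) := by
  unfold cA cB
  rw [if_neg (by omega)]
  exact tA_add_tB hp (h.pos hl i h1 hi.le) (h.lt i hi)

lemma c_lin {Z : ℕ → ℝ} (hp : 1 < p) (hl : 0 ≤ l) (h : Good l u n X) (hZ : Good l u n Z)
    {i : ℕ} (hi : i < n) :
    0 ≤ (p - 2) * (tm p (Z i) (Z (i + 1)) - (ct p X i + cA p X i * Z i + cB p X i * Z (i + 1))) := by
  rcases Nat.eq_zero_or_pos i with h0 | h0
  · subst h0
    have hx := h.lt 0 hi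
    have hz := hZ.lt 0 hi
    unfold ct
    rw [cA_zero]
    unfold cB
    rw [h.zero] at *
    rw [hZ.zero] at *
    rcases hl.eq_or_lt with h0 | h0
    · subst h0
      have e1 := tm_zero_sub hp hx
      rw [tm_zero hp hx] at *
      rw [tm_zero hp hz]
      have : tB p 0 (X (0 + 1)) = (p - 1) / p :=
        mul_right_cancel₀ hx.ne' (by linarith)
      rw [this]
      apply le_of_eq
      ring
    · have := tm_tangent hp h0 hx hz
      convert this using 2
      ring
  · rw [ct_succ hp hl h hi h0]
    unfold cA cB
    rw [if_neg (by omega)]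
    have := tm_grad hp (h.pos hl i h0 hi.le) (h.lt i hi) (hZ.pos hl i h0 hi.le) (hZ.lt i hi)
    convert this using 3
    ring

lemma ct_zero_ge (hp : 1 < p) (hp2 : p < 2) (hl : 0 ≤ l) (h : Good l u n X) (hn : 0 < n) :
    l ≤ ct p X 0 + cB p X 0 * l := by
  rcases hl.eq_or_lt with h0 | h0
  · have := ct_nonneg hp hl h hn
    rw [← h0]; linarith
  · have hx := h.lt 0 hn
    unfold ct
    rw [cA_zero]
    unfold cB
    rw [h.zero] at *
    have e1 := tm_euler hp h0 hx
    have e2 := tA_add_tB hp h0 hx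
    have e3 : 1 ≤ tA p l (X (0 + 1)) + tB p l (X (0 + 1)) := by nlinarith
    nlinarith

lemma GX_eq (i : ℕ) : GX p X i = Lam (cA p X) (cB p X) X i - ct p X i - ct p X (i + 1) := by
  unfold GX Lam ct; ring

lemma mp_good (hp : 1 < p) (hpne : p ≠ 2) (hl : 0 ≤ l) (h : Good l u n X)
    (hG : ∀ i, i + 1 < n → (p - 2) * GX p X i ≤ 0) (w : ℕ → ℝ) (hw0 : 0 ≤ w 0) (hwn : 0 ≤ w n)
    (hLw : ∀ i, i + 1 < n → 0 ≤ Lam (cA p X) (cB p X) w i) : ∀ i ≤ n, 0 ≤ w i := by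
  rcases lt_or_gt_of_ne hpne with h2 | h2
  · refine max_principle n (cA p X) (cB p X) X w (fun i hi => cA_nonneg hp hl h hi)
      (fun i hi => cB_pos hp hl h hi) (h.zero ▸ hl) (h.pos hl) ?_ hw0 hwn hLw
    intro i hi
    have h3 := hG i hi
    have h4 : 0 ≤ GX p X i := by nlinarith
    rw [GX_eq] at h4
    have := ct_nonneg hp hl h (i := i) (by omega)
    have := ct_nonneg hp hl h (i := i + 1) (by omega)
    linarith
  · refine max_principle n (cA p X) (cB p X) (fun _ => 1) w (fun i hi => cA_nonneg hp hl h hi)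
      (fun i hi => cB_pos hp hl h hi) zero_le_one (fun _ _ _ => zero_lt_one) ?_ hw0 hwn hLw
    have key : ∀ i < n, cA p X i + cB p X i ≤ 1 := by
      intro i hi
      rcases Nat.eq_zero_or_pos i with h0 | h0
      · subst h0; rw [cA_zero, zero_add]; exact (cB_lt_one hp hl h hi).le
      · have := c_sum hp hl h hi h0
        have := nonneg_of_mul_nonneg_right this (by linarith)
        linarith
    intro i hi
    have := key i (by omega)
    have := key (i + 1) hi
    unfold Lam
    linarith

/-- One Newton step, on the level of extended sequences. -/
lemma newton_step {Y : ℕ → ℝ} (hp : 1 < p) (hpne : p ≠ 2) (hl : 0 ≤ l) (h : Good l u n X)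
    (hn : 0 < n)
    (hG : ∀ i, i + 1 < n → (p - 2) * GX p X i ≤ 0) (hY0 : Y 0 = l) (hYn : Y n = u)
    (hY : ∀ i, i + 1 < n → Lam (cA p X) (cB p X) (fun i => X i - Y i) i = GX p X i) :
    (∀ i ≤ n, 0 ≤ (p - 2) * (Y i - X i)) ∧ Good l u n Y ∧
    (∀ i, i + 1 < n → (p - 2) * GX p Y i ≤ 0) ∧
    (∀ i, i + 1 < n → -((p - 2) * GX p X i) ≤ 2 * ((p - 2) * (Y (i + 1) - X (i + 1)))) ∧
    (∀ Z, Good l u n Z → (∀ i, i + 1 < n → GX p Z i = 0) → ∀ i ≤ n, 0 ≤ (p - 2) * (Z i - Y i)) := by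
  have hLY : ∀ i, i + 1 < n → Lam (cA p X) (cB p X) Y i = ct p X i + ct p X (i + 1) := by
    intro i hi
    have h1 := hY i hi
    have h2 := GX_eq (p := p) (X := X) i
    have h3 : Lam (cA p X) (cB p X) (fun i => X i - Y i) i =
      Lam (cA p X) (cB p X) X i - Lam (cA p X) (cB p X) Y i := by unfold Lam; ring
    linarith
  have h1 : ∀ i ≤ n, 0 ≤ (p - 2) * (Y i - X i) := by
    apply mp_good hp hpne hl h hG (fun i => (p - 2) * (Y i - X i))
    · simp [hY0, h.zero]
    · simp [hYn, h.last]
    · intro i hi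
      have e1 := hY i hi
      have e2 := hG i hi
      rw [← e1] at e2
      have : Lam (cA p X) (cB p X) (fun i => (p - 2) * (Y i - X i)) i =
        - ((p - 2) * Lam (cA p X) (cB p X) (fun i => X i - Y i) i) := by unfold Lam; ring
      rw [this]; linarith
  have hgood : Good l u n Y := by
    refine ⟨hY0, hYn, ?_⟩
    rcases lt_or_gt_of_ne hpne with h2 | h2
    · have hYpos : ∀ i ≤ n, 0 ≤ Y i := by
        apply mp_good hp hpne hl h hG Y (by rw [hY0]; exact hl)
          (by rw [hYn, ← h.last]; exact hl.trans (h.ge n le_rfl))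
        intro i hi
        rw [hLY i hi]
        have := ct_nonneg hp hl h (i := i) (by omega)
        have := ct_nonneg hp hl h (i := i + 1) (by omega)
        linarith
      have hYX : ∀ i ≤ n, Y i ≤ X i := by
        intro i hi
        have := h1 i hi
        nlinarith
      have main : ∀ k < n, Y (n - 1 - k) < Y (n - 1 - k + 1) := by
        intro k
        induction k with
        | zero =>
          intro _
          rw [show n - 1 - 0 + 1 = n by omega, hYn, ← h.last]
          have e := h.lt (n - 1) (by omega)
          rw [show n - 1 + 1 = n by omega] at e
          exact lt_of_le_of_lt (hYX (n - 1) (by omega)) e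
        | succ k ih =>
          intro hk
          have ih := ih (by omega)
          obtain ⟨i, hi⟩ : ∃ i, i = n - 1 - (k + 1) := ⟨_, rfl⟩
          rw [show n - 1 - k = i + 1 by omega] at ih
          rw [← hi]
          have hi1 : i + 1 < n := by omega
          have hL := hLY i hi1
          rw [ct_succ hp hl h hi1 (by omega)] at hL
          unfold Lam at hL
          have s1 := c_sum hp hl h hi1 (by omega)
          have s1' : 1 ≤ cA p X (i + 1) + cB p X (i + 1) := by nlinarith
          have b1 := cB_pos hp hl h hi1
          have y1 := hYpos (i + 1) (by omega)
          have m1 := mul_lt_mul_of_pos_left ih b1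
          have m2 := mul_le_mul_of_nonneg_right s1' y1
          have m3 : cA p X i * Y i + cB p X i * Y (i + 1) + ct p X i < Y (i + 1) := by
            rw [show i + 2 = i + 1 + 1 by rfl] at hL
            nlinarith
          rcases Nat.eq_zero_or_pos i with h0 | h0
          · rw [h0] at m3 ⊢
            rw [cA_zero] at m3
            have e1 := ct_zero_ge hp h2 hl h hn
            have e2 := cB_lt_one hp hl h hn
            rw [hY0]
            by_contra hc
            push Not at hc
            nlinarith
          · have s0 := c_sum hp hl h (i := i) (by omega) h0
            have s0' : 1 ≤ cA p X i + cB p X i := by nlinarith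
            have a0 := cA_pos hp hl h (i := i) (by omega) h0
            rw [ct_succ hp hl h (by omega) h0] at m3
            by_contra hc
            push Not at hc
            have m4 := mul_le_mul_of_nonneg_left hc a0.le
            have m5 := mul_le_mul_of_nonneg_right s0' y1
            nlinarith
      intro i hi
      have := main (n - 1 - i) (by omega)
      rwa [show n - 1 - (n - 1 - i) = i by omega] at this
    · have hYX : ∀ i ≤ n, X i ≤ Y i := by
        intro i hi
        have := nonneg_of_mul_nonneg_right (h1 i hi) (by linarith)
        linarith
      intro i
      induction i with
      | zero =>
        intro h0
        rw [hY0, ← h.zero]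
        exact lt_of_lt_of_le (h.lt 0 h0) (hYX _ (by omega))
      | succ i ih =>
        intro hi1
        have ih := ih (by omega)
        have hL := hLY i hi1
        rw [ct_succ hp hl h hi1 (by omega)] at hL
        unfold Lam at hL
        have s1 := nonneg_of_mul_nonneg_right (c_sum hp hl h hi1 (by omega)) (by linarith)
        have b1 := cB_pos hp hl h hi1
        have y1 : 0 < Y (i + 1) :=
          lt_of_lt_of_le (h.pos hl (i + 1) (by omega) (by omega)) (hYX _ (by omega))
        have m3 : cA p X i * Y i + cB p X i * Y (i + 1) + ct p X i < Y (i + 1) := by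
          rcases Nat.eq_zero_or_pos i with h0 | h0
          · rw [h0, cA_zero]
            have e2 := cB_lt_one hp hl h hn
            have e3 := hYX 1 (by omega)
            have e4 := tm_lt hp (hl.trans (h.ge 0 (by omega))) (h.lt 0 hn)
            have e5 : ct p X 0 = tm p (X 0) (X (0 + 1)) - cB p X 0 * X (0 + 1) := by
              unfold ct; rw [cA_zero]; ring
            rw [zero_add] at *
            nlinarith
          · have s0 := nonneg_of_mul_nonneg_right (c_sum hp hl h (i := i) (by omega) h0)
              (by linarith)
            have a0 := cA_pos hp hl h (i := i) (by omega) h0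
            rw [ct_succ hp hl h (by omega) h0]
            have m4 := mul_lt_mul_of_pos_left ih a0
            have m5 := mul_nonneg s0 y1.le
            nlinarith
        by_contra hc
        push Not at hc
        have m6 := mul_le_mul_of_nonneg_left hc b1.le
        have m7 := mul_nonneg s1 y1.le
        rw [show i + 2 = i + 1 + 1 by rfl] at hL
        nlinarith
  have hlin : ∀ Z, Good l u n Z → ∀ i, i + 1 < n →
      (p - 2) * (GX p Z i - (Lam (cA p X) (cB p X) Z i - ct p X i - ct p X (i + 1))) ≤ 0 := by
    intro Z hZ i hi
    have e1 := c_lin hp hl h hZ (i := i) (by omega)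
    have e2 := c_lin hp hl h hZ hi
    unfold GX Lam
    rw [show i + 2 = i + 1 + 1 by rfl]
    linarith
  refine ⟨h1, hgood, ?_, ?_, ?_⟩
  · intro i hi
    have := hlin Y hgood i hi
    rw [hLY i hi] at this
    convert this using 2
    ring
  · intro i hi
    rw [← hY i hi]
    unfold Lam
    have a0 := mul_nonneg (cA_nonneg hp hl h (i := i) (by omega)) (h1 i (by omega))
    have a1 := mul_nonneg (cA_nonneg hp hl h hi) (h1 (i + 1) (by omega))
    have b0 := mul_nonneg (cB_pos hp hl h (i := i) (by omega)).le (h1 (i + 1) (by omega))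
    have b1 := mul_nonneg (cB_pos hp hl h hi).le (h1 (i + 2) (by omega))
    nlinarith
  · intro Z hZ hZ0
    apply mp_good hp hpne hl h hG (fun i => (p - 2) * (Z i - Y i))
    · simp [hY0, hZ.zero]
    · simp [hYn, hZ.last]
    · intro i hi
      have e := hlin Z hZ i hi
      rw [hZ0 i hi] at e
      have e2 := hLY i hi
      have : Lam (cA p X) (cB p X) (fun i => (p - 2) * (Z i - Y i)) i =
        (p - 2) * (Lam (cA p X) (cB p X) Z i - Lam (cA p X) (cB p X) Y i) := by unfold Lam; ring
      rw [this, e2]; linarith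

end

/-! ### the Jacobian -/

lemma xiSeq_zero (l u : ℝ) (n : ℕ) (x : Fin (n - 1) → ℝ) : xiSeq l u n x 0 = l := by
  simp [xiSeq]

lemma xiSeq_last (l u : ℝ) (n : ℕ) (hn : 0 < n) (x : Fin (n - 1) → ℝ) : xiSeq l u n x n = u := by
  simp [xiSeq, hn.ne']

lemma xiSeq_succ (l u : ℝ) (n : ℕ) (x : Fin (n - 1) → ℝ) (j : Fin (n - 1)) :
    xiSeq l u n x (j + 1) = x j := by
  have := j.2
  unfold xiSeq
  rw [dif_pos ⟨by omega, by omega⟩]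
  simp

lemma xiSeq_succ' (l u : ℝ) (n : ℕ) (x : Fin (n - 1) → ℝ) (i : ℕ) (hi : i + 1 < n) :
    xiSeq l u n x (i + 1) = x ⟨i, by omega⟩ := xiSeq_succ l u n x ⟨i, by omega⟩

lemma mem_domD_iff {l u : ℝ} {n : ℕ} (hn : 0 < n) {x : Fin (n - 1) → ℝ} :
    x ∈ domD l u n ↔ Good l u n (xiSeq l u n x) :=
  ⟨fun h => ⟨xiSeq_zero _ _ _ _, xiSeq_last _ _ _ hn _, h⟩, fun h => h.lt⟩

noncomputable def xiL (n i : ℕ) : (Fin (n - 1) → ℝ) →L[ℝ] ℝ :=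
  if h : 0 < i ∧ i < n then ContinuousLinearMap.proj ⟨i - 1, by omega⟩ else 0

lemma xiL_apply (n i : ℕ) (w : Fin (n - 1) → ℝ) : xiL n i w = xiSeq 0 0 n w i := by
  unfold xiL xiSeq
  split_ifs <;> simp

lemma xi_hasFDerivAt (l u : ℝ) (n i : ℕ) (x : Fin (n - 1) → ℝ) :
    HasFDerivAt (fun y => xiSeq l u n y i) (xiL n i) x := by
  unfold xiL xiSeq
  split_ifs with h h2
  · exact (ContinuousLinearMap.proj (R := ℝ) (φ := fun _ : Fin (n - 1) => ℝ)
      ⟨i - 1, by omega⟩).hasFDerivAt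
  · exact hasFDerivAt_const _ _
  · exact hasFDerivAt_const _ _

lemma xi_continuous (l u : ℝ) (n i : ℕ) : Continuous (fun y => xiSeq l u n y i) :=
  continuous_iff_continuousAt.2 fun x => (xi_hasFDerivAt l u n i x).continuousAt

lemma domD_isOpen (l u : ℝ) (n : ℕ) : IsOpen (domD l u n) := by
  have : domD l u n = ⋂ i ∈ Finset.range n,
      {x | xiSeq l u n x i < xiSeq l u n x (i + 1)} := by
    ext x; simp [domD]
  rw [this]
  exact isOpen_biInter_finset fun i _ => isOpen_lt (xi_continuous l u n i) (xi_continuous l u n _)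

lemma Fmap_eq_s11 {l u p : ℝ} {n : ℕ} (hp : 1 < p) (hl : 0 ≤ l) (hn : 0 < n)
    {x : Fin (n - 1) → ℝ} (hx : x ∈ domD l u n) (j : Fin (n - 1)) :
    Fmap l u p n x j = p * GX p (xiSeq l u n x) j := by
  have hg := (mem_domD_iff hn).1 hx
  have hj := j.2
  unfold Fmap GX
  have h0 := hl.trans (hg.ge j (by omega))
  have h1 := hl.trans (hg.ge (j + 1) (by omega))
  have h2 := hl.trans (hg.ge (j + 2) (by omega))
  have l0 := hg.lt j (by omega)
  have l1 := hg.lt (j + 1) (by omega)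
  rw [show (j : ℕ) + 1 + 1 = j + 2 by rfl] at l1
  have d0 := (pow_lt hp h0 l0).ne'
  have d1 := (pow_lt hp h1 l1).ne'
  rw [tm_eq hp h0 l0, tm_eq hp h1 l1, rpow_split hp h0, rpow_split hp h1, rpow_split hp h2]
  generalize xiSeq l u n x (j + 1) ^ (p - 1) = B at *
  generalize xiSeq l u n x j ^ (p - 1) = A at *
  generalize xiSeq l u n x (j + 2) ^ (p - 1) = C at *
  field_simp
  ring

lemma tm_hasFDerivAt {E : Type*} [NormedAddCommGroup E] [NormedSpace ℝ E] {p : ℝ} (hp : 1 < p)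
    {a b : E → ℝ} {a' b' : E →L[ℝ] ℝ} {x : E} (ha : HasFDerivAt a a' x) (hb : HasFDerivAt b b' x)
    (h0 : 0 < a x) (hab : a x < b x) :
    HasFDerivAt (fun y => tm p (a y) (b y))
      (tA p (a x) (b x) • a' + tB p (a x) (b x) • b') x := by
  have hb0 := h0.trans hab
  have hD := (pow_lt hp h0.le hab).ne'
  have a1 := (hasDerivAt_rpw (q := p) h0).comp_hasFDerivAt x ha
  have a2 := (hasDerivAt_rpw (q := p - 1) h0).comp_hasFDerivAt x ha
  have b1 := (hasDerivAt_rpw (q := p) hb0).comp_hasFDerivAt x hb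
  have b2 := (hasDerivAt_rpw (q := p - 1) hb0).comp_hasFDerivAt x hb
  have hi := (hasDerivAt_inv hD).comp_hasFDerivAt x (b2.sub a2)
  have := ((b1.sub a1).const_mul ((p - 1) / p)).mul hi
  refine (this.congr_fderiv ?_).congr_of_eventuallyEq ?_
  · ext w
    simp only [add_apply, smul_apply,
      sub_apply, smul_eq_mul, Function.comp, Pi.sub_apply]
    unfold tA tB
    rw [tm_eq hp h0.le hab, rpow_split hp h0.le, rpow_split hp hb0.le]
    generalize a x ^ (p - 1) = A at *
    generalize b x ^ (p - 1) = B at *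
    field_simp
    ring
  · refine Filter.Eventually.of_forall fun y => ?_
    simp [tm, div_eq_mul_inv]

lemma Fmap_hasFDerivAt {l u p : ℝ} {n : ℕ} (hp : 1 < p) (hl : 0 ≤ l) (hn : 0 < n)
    {x : Fin (n - 1) → ℝ} (hx : x ∈ domD l u n) (j : Fin (n - 1)) :
    ∃ L : (Fin (n - 1) → ℝ) →L[ℝ] ℝ, HasFDerivAt (fun y => Fmap l u p n y j) L x ∧
      ∀ w, L w = p * Lam (cA p (xiSeq l u n x)) (cB p (xiSeq l u n x)) (xiSeq 0 0 n w) j := by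
  have hg := (mem_domD_iff hn).1 hx
  have hj := j.2
  have key : ∀ i < n, HasFDerivAt (fun y => tm p (xiSeq l u n y i) (xiSeq l u n y (i + 1)))
      (cA p (xiSeq l u n x) i • xiL n i + cB p (xiSeq l u n x) i • xiL n (i + 1)) x := by
    intro i hi
    rcases Nat.eq_zero_or_pos i with h0 | h0
    · subst h0
      rw [cA_zero, zero_smul]
      unfold cB
      have h := hg.lt 0 hi
      have h2 := hg.ge 0 hi.le
      simp only [xiSeq_zero] at h h2 ⊢
      rw [zero_add (_ • _)]
      exact (hasDerivAt_tm hp hl h).comp_hasFDerivAt x (xi_hasFDerivAt l u n (0 + 1) x)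
    · unfold cA cB
      rw [if_neg (by omega)]
      exact tm_hasFDerivAt hp (xi_hasFDerivAt l u n i x) (xi_hasFDerivAt l u n (i + 1) x)
        (hg.pos hl i h0 hi.le) (hg.lt i hi)
  have h1 := ((((xi_hasFDerivAt l u n (j + 1) x).const_mul 2).sub
    (key (j + 1) (by omega))).sub (key j (by omega))).const_mul p
  refine ⟨_, h1.congr_of_eventuallyEq ?_, ?_⟩
  · filter_upwards [(domD_isOpen l u n).mem_nhds hx] with y hy
    rw [Fmap_eq_s11 hp hl hn hy]
    rfl
  · intro w
    simp only [add_apply, smul_apply,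
      sub_apply, smul_eq_mul, xiL_apply]
    unfold Lam
    rw [show (j : ℕ) + 1 + 1 = j + 2 by rfl]
    ring

lemma Jmat_mulVec {l u p : ℝ} {n : ℕ} (hp : 1 < p) (hl : 0 ≤ l) (hn : 0 < n)
    {x : Fin (n - 1) → ℝ} (hx : x ∈ domD l u n) (w : Fin (n - 1) → ℝ) (j : Fin (n - 1)) :
    (Jmat l u p n x).mulVec w j =
      p * Lam (cA p (xiSeq l u n x)) (cB p (xiSeq l u n x)) (xiSeq 0 0 n w) j := by
  obtain ⟨L, hL, hw⟩ := Fmap_hasFDerivAt hp hl hn hx j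
  rw [← hw w]
  simp only [Matrix.mulVec, dotProduct, Jmat, Matrix.of_apply]
  rw [hL.fderiv]
  conv_rhs => rw [← Finset.univ_sum_single w]
  rw [map_sum]
  refine Finset.sum_congr rfl fun k _ => ?_
  have : (Pi.single k (w k) : Fin (n - 1) → ℝ) = w k • Pi.single k (1 : ℝ) := by
    rw [← Pi.single_smul]; simp
  rw [this, map_smul, smul_eq_mul, mul_comm]

lemma Jmat_isUnit {l u p : ℝ} {n : ℕ} (hp : 1 < p) (hpne : p ≠ 2) (hl : 0 ≤ l) (hn : 0 < n)
    {x : Fin (n - 1) → ℝ} (hx : x ∈ domD l u n)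
    (hG : ∀ i, i + 1 < n → (p - 2) * GX p (xiSeq l u n x) i ≤ 0) :
    IsUnit (Jmat l u p n x) := by
  have hg := (mem_domD_iff hn).1 hx
  rw [← Matrix.mulVec_injective_iff_isUnit]
  have key : ∀ w, (Jmat l u p n x).mulVec w = 0 → ∀ j, 0 ≤ w j := by
    intro w hw j
    have hj := j.2
    rw [← xiSeq_succ 0 0 n w j]
    refine mp_good hp hpne hl hg hG (xiSeq 0 0 n w) (by rw [xiSeq_zero])
      (by rw [xiSeq_last _ _ _ hn]) ?_ _ (by omega)
    intro i hi
    have h1 := Jmat_mulVec hp hl hn hx w ⟨i, by omega⟩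
    rw [hw] at h1
    have : p ≠ 0 := by linarith
    simp only [Pi.zero_apply, zero_eq_mul, this, false_or] at h1
    exact h1.ge
  intro w1 w2 h
  have h1 := key (w1 - w2) (by rw [Matrix.mulVec_sub]; simpa [sub_eq_zero] using h)
  have h2 := key (w2 - w1) (by rw [Matrix.mulVec_sub]; simpa [sub_eq_zero] using h.symm)
  ext j
  have := h1 j
  have := h2 j
  simp only [Pi.sub_apply] at *
  linarith

/-- One Newton step, on the level of vectors. -/
lemma newton_step_vec {l u p : ℝ} {n : ℕ} (hp : 1 < p) (hpne : p ≠ 2) (hl : 0 ≤ l) (hn : 0 < n)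
    {x y : Fin (n - 1) → ℝ} (hx : x ∈ domD l u n)
    (hG : ∀ i, i + 1 < n → (p - 2) * GX p (xiSeq l u n x) i ≤ 0)
    (hy : y = x - (Jmat l u p n x)⁻¹.mulVec (fun i => Fmap l u p n x i)) :
    (∀ i ≤ n, 0 ≤ (p - 2) * (xiSeq l u n y i - xiSeq l u n x i)) ∧ Good l u n (xiSeq l u n y) ∧
    (∀ i, i + 1 < n → (p - 2) * GX p (xiSeq l u n y) i ≤ 0) ∧
    (∀ i, i + 1 < n → -((p - 2) * GX p (xiSeq l u n x) i) ≤
      2 * ((p - 2) * (xiSeq l u n y (i + 1) - xiSeq l u n x (i + 1)))) ∧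
    (∀ Z, Good l u n Z → (∀ i, i + 1 < n → GX p Z i = 0) →
      ∀ i ≤ n, 0 ≤ (p - 2) * (Z i - xiSeq l u n y i)) := by
  have hg := (mem_domD_iff hn).1 hx
  refine newton_step hp hpne hl hg hn hG (xiSeq_zero _ _ _ _) (xiSeq_last _ _ _ hn _) ?_
  intro i hi
  have hu := Jmat_isUnit hp hpne hl hn hx hG
  have h1 : (Jmat l u p n x).mulVec (x - y) = fun i => Fmap l u p n x i := by
    rw [hy, sub_sub_cancel, Matrix.mulVec_mulVec, Matrix.mul_nonsing_inv _
      ((Matrix.isUnit_iff_isUnit_det _).1 hu), Matrix.one_mulVec]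
  have h2 := congrFun h1 ⟨i, by omega⟩
  rw [Jmat_mulVec hp hl hn hx, Fmap_eq_s11 hp hl hn hx] at h2
  have h3 : xiSeq 0 0 n (x - y) = fun i => xiSeq l u n x i - xiSeq l u n y i := by
    ext k
    unfold xiSeq
    split_ifs <;> simp
  rw [h3] at h2
  exact mul_left_cancel₀ (by linarith) h2

/-! ### limits -/

lemma tm_tendsto {p : ℝ} (hp : 1 < p) {a b : ℕ → ℝ} {α β : ℝ} (ha : ∀ k, 0 ≤ a k)
    (hab : ∀ k, a k < b k) (hα : Filter.Tendsto a Filter.atTop (nhds α))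
    (hβ : Filter.Tendsto b Filter.atTop (nhds β)) :
    Filter.Tendsto (fun k => tm p (a k) (b k)) Filter.atTop
      (nhds (if α < β then tm p α β else α)) := by
  have hα0 : 0 ≤ α := ge_of_tendsto' hα ha
  have hle : α ≤ β := le_of_tendsto_of_tendsto' hα hβ fun k => (hab k).le
  split_ifs with h
  · unfold tm
    have e1 := (hβ.rpow_const (p := p) (Or.inr (by linarith)))
    have e2 := (hα.rpow_const (p := p) (Or.inr (by linarith)))
    have e3 := (hβ.rpow_const (p := p - 1) (Or.inr (by linarith)))
    have e4 := (hα.rpow_const (p := p - 1) (Or.inr (by linarith)))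
    exact ((e1.sub e2).const_mul _).div (e3.sub e4) (pow_lt hp hα0 h).ne'
  · have : β = α := by linarith
    subst this
    exact tendsto_of_tendsto_of_tendsto_of_le_of_le hα hβ
      (fun k => (lt_tm hp (ha k) (hab k)).le) (fun k => (tm_lt hp (ha k) (hab k)).le)

lemma limit_good {l u p : ℝ} {n : ℕ} (hp : 1 < p) (hl : 0 ≤ l) (hlu : l < u) (hn : 0 < n)
    {X : ℕ → ℕ → ℝ} {Y : ℕ → ℝ} (hX : ∀ k, Good l u n (X k))
    (hlim : ∀ i ≤ n, Filter.Tendsto (fun k => X k i) Filter.atTop (nhds (Y i)))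
    (hG : ∀ i, i + 1 < n → Filter.Tendsto (fun k => GX p (X k) i) Filter.atTop (nhds 0)) :
    Good l u n Y ∧ ∀ i, i + 1 < n → GX p Y i = 0 := by
  have hY0 : Y 0 = l := tendsto_nhds_unique (hlim 0 hn.le) (by simp [fun k => (hX k).zero])
  have hYn : Y n = u := tendsto_nhds_unique (hlim n le_rfl) (by simp [fun k => (hX k).last])
  have hle : ∀ i < n, Y i ≤ Y (i + 1) := fun i hi =>
    le_of_tendsto_of_tendsto' (hlim i hi.le) (hlim (i + 1) hi) fun k => ((hX k).lt i hi).le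
  have hpos : ∀ i ≤ n, 0 ≤ Y i := fun i hi =>
    ge_of_tendsto' (hlim i hi) fun k => hl.trans ((hX k).ge i hi)
  have hT : ∀ i < n, Filter.Tendsto (fun k => tm p (X k i) (X k (i + 1))) Filter.atTop
      (nhds (if Y i < Y (i + 1) then tm p (Y i) (Y (i + 1)) else Y i)) := fun i hi =>
    tm_tendsto hp (fun k => hl.trans ((hX k).ge i hi.le)) (fun k => (hX k).lt i hi)
      (hlim i hi.le) (hlim (i + 1) hi)
  have heq : ∀ i, i + 1 < n → 2 * Y (i + 1)
      - (if Y (i + 1) < Y (i + 1 + 1) then tm p (Y (i + 1)) (Y (i + 1 + 1)) else Y (i + 1))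
      - (if Y i < Y (i + 1) then tm p (Y i) (Y (i + 1)) else Y i) = 0 := by
    intro i hi
    refine tendsto_nhds_unique ?_ (hG i hi)
    exact (((hlim (i + 1) hi.le).const_mul 2).sub (hT (i + 1) hi)).sub (hT i (by omega))
  have hiff : ∀ i, i + 1 < n → (Y i < Y (i + 1) ↔ Y (i + 1) < Y (i + 1 + 1)) := by
    intro i hi
    have e := heq i hi
    have e1 := hle i (by omega)
    have e2 := hle (i + 1) hi
    constructor
    · intro h
      by_contra h2
      rw [if_neg h2, if_pos h] at e
      have := tm_lt hp (hpos i (by omega)) h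
      linarith
    · intro h
      by_contra h2
      rw [if_neg h2, if_pos h] at e
      have := lt_tm hp (hpos (i + 1) (by omega)) h
      linarith
  have hall : ∀ i < n, (Y 0 < Y 1 ↔ Y i < Y (i + 1)) := by
    intro i
    induction i with
    | zero => intro _; rfl
    | succ i ih => intro hi; exact (ih (by omega)).trans (hiff i hi)
  have h01 : Y 0 < Y 1 := by
    by_contra h
    have : ∀ i ≤ n, Y i = l := by
      intro i
      induction i with
      | zero => intro _; exact hY0
      | succ i ih =>
        intro hi
        have e := (hall i (by omega)).not.1 h
        have e2 := hle i (by omega)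
        have e3 := ih (by omega)
        linarith
    have := this n le_rfl
    linarith
  have hlt : ∀ i < n, Y i < Y (i + 1) := fun i hi => (hall i hi).1 h01
  refine ⟨⟨hY0, hYn, hlt⟩, fun i hi => ?_⟩
  have e := heq i hi
  rw [if_pos (hlt i (by omega)), if_pos (hlt (i + 1) hi)] at e
  exact e

/-- Monotone convergence of Newton's method started from the equally-spaced points:
the iterates stay in `D` with invertible Jacobians, decrease componentwise to the
unique zero `x*` of `F` when `1 < p < 2`, and increase componentwise to `x*`
when `p > 2`. -/
theorem newton_monotone_convergence
    (l u : ℝ) (hl : 0 ≤ l) (hlu : l < u) (n : ℕ) (hn : 2 ≤ n)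
    (p : ℝ) (hp : 1 < p) (hpne : p ≠ 2)
    (xstar : Fin (n - 1) → ℝ) (hstar : xstar ∈ domD l u n)
    (hFstar : ∀ i, Fmap l u p n xstar i = 0)
    (huniq : ∀ y ∈ domD l u n, (∀ i, Fmap l u p n y i = 0) → y = xstar)
    (seq : ℕ → Fin (n - 1) → ℝ)
    (hseq0 : seq 0 = fun i : Fin (n - 1) => l + (((i : ℕ) + 1 : ℝ) / n) * (u - l))
    (hseqS : ∀ k, seq (k + 1) =
      seq k - (Jmat l u p n (seq k))⁻¹.mulVec (fun i => Fmap l u p n (seq k) i)) :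
    (∀ k, seq k ∈ domD l u n ∧ IsUnit (Jmat l u p n (seq k))) ∧
    (p < 2 → ∀ k i, seq (k + 1) i ≤ seq k i) ∧
    (2 < p → ∀ k i, seq k i ≤ seq (k + 1) i) ∧
    Filter.Tendsto seq Filter.atTop (nhds xstar) := by
  have hn0 : 0 < n := by omega
  have hp0 : p ≠ 0 := by linarith
  have hnR : (0 : ℝ) < n := by exact_mod_cast hn0
  -- the initial point
  have hx0 : ∀ i ≤ n, xiSeq l u n (seq 0) i = l + ((i : ℝ) / n) * (u - l) := by
    intro i hi
    rcases Nat.eq_zero_or_pos i with h | h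
    · subst h; simp [xiSeq_zero]
    · rcases hi.eq_or_lt with h2 | h2
      · subst h2; rw [xiSeq_last _ _ _ hn0]; field_simp; ring
      · obtain ⟨j, rfl⟩ : ∃ j, i = j + 1 := ⟨i - 1, by omega⟩
        rw [xiSeq_succ' _ _ _ _ _ h2, hseq0]
        push_cast
        rfl
  have hstep : ∀ i, i + 1 ≤ n → xiSeq l u n (seq 0) (i + 1) =
      xiSeq l u n (seq 0) i + (u - l) / n := by
    intro i hi
    rw [hx0 _ hi, hx0 i (by omega)]
    push_cast
    field_simp
    ring
  have hgap : 0 < (u - l) / n := div_pos (by linarith) hnR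
  have hgood0 : Good l u n (xiSeq l u n (seq 0)) := by
    refine ⟨xiSeq_zero _ _ _ _, xiSeq_last _ _ _ hn0 _, fun i hi => ?_⟩
    rw [hstep i hi]; linarith
  have hG0 : ∀ i, i + 1 < n → (p - 2) * GX p (xiSeq l u n (seq 0)) i ≤ 0 := by
    intro i hi
    have e1 := tm_mid hp (hl.trans (hgood0.ge i (by omega))) (hgood0.lt i (by omega))
    have e2 := tm_mid hp (hl.trans (hgood0.ge (i + 1) (by omega))) (hgood0.lt (i + 1) hi)
    have s1 := hstep i (by omega)
    have s2 := hstep (i + 1) (by omega)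
    unfold GX
    rw [show i + 2 = i + 1 + 1 by rfl]
    have s3 : 2 * xiSeq l u n (seq 0) (i + 1) =
      (xiSeq l u n (seq 0) i + xiSeq l u n (seq 0) (i + 1)) / 2 +
      (xiSeq l u n (seq 0) (i + 1) + xiSeq l u n (seq 0) (i + 1 + 1)) / 2 := by linarith
    rw [s3]
    linarith
  have hinv : ∀ k, Good l u n (xiSeq l u n (seq k)) ∧
      ∀ i, i + 1 < n → (p - 2) * GX p (xiSeq l u n (seq k)) i ≤ 0 := by
    intro k
    induction k with
    | zero => exact ⟨hgood0, hG0⟩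
    | succ k ih =>
      have := newton_step_vec hp hpne hl hn0 ((mem_domD_iff hn0).2 ih.1) ih.2 (hseqS k)
      exact ⟨this.2.1, this.2.2.1⟩
  have hst := fun k => newton_step_vec hp hpne hl hn0 ((mem_domD_iff hn0).2 (hinv k).1)
    (hinv k).2 (hseqS k)
  have hmon : ∀ k j, 0 ≤ (p - 2) * (seq (k + 1) j - seq k j) := by
    intro k j
    have hj := j.2
    have := (hst k).1 (j + 1) (by omega)
    rwa [xiSeq_succ, xiSeq_succ] at this
  have hdec : p < 2 → ∀ k i, seq (k + 1) i ≤ seq k i := by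
    intro h k i
    have := hmon k i
    nlinarith
  have hinc : 2 < p → ∀ k i, seq k i ≤ seq (k + 1) i := by
    intro h k i
    have := nonneg_of_mul_nonneg_right (hmon k i) (by linarith)
    linarith
  refine ⟨fun k => ⟨(mem_domD_iff hn0).2 (hinv k).1, Jmat_isUnit hp hpne hl hn0
    ((mem_domD_iff hn0).2 (hinv k).1) (hinv k).2⟩, hdec, hinc, ?_⟩
  -- every component is bounded
  have hlow : ∀ k j, l ≤ seq k j := by
    intro k j
    have hj := j.2
    have := (hinv k).1.ge (j + 1) (by omega)
    rwa [xiSeq_succ] at this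
  have hup : ∀ k j, seq k j ≤ u := by
    intro k j
    have hj := j.2
    have hm : ∀ m, m ≤ n → xiSeq l u n (seq k) (n - m) ≤ u := by
      intro m
      induction m with
      | zero => intro _; exact (hinv k).1.last.le
      | succ m ih =>
        intro hm
        have e1 := ih (by omega)
        have e2 := (hinv k).1.lt (n - (m + 1)) (by omega)
        rw [show n - (m + 1) + 1 = n - m by omega] at e2
        linarith
    have := hm (n - (j + 1)) (by omega)
    rwa [show n - (n - ((j : ℕ) + 1)) = j + 1 by omega, xiSeq_succ] at this
  have hconv : ∀ j, ∃ y, Filter.Tendsto (fun k => seq k j) Filter.atTop (nhds y) := by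
    intro j
    rcases lt_or_gt_of_ne hpne with h | h
    · exact ⟨_, tendsto_atTop_ciInf (antitone_nat_of_succ_le fun k => hdec h k j)
        ⟨l, by rintro _ ⟨k, rfl⟩; exact hlow k j⟩⟩
    · exact ⟨_, tendsto_atTop_ciSup (monotone_nat_of_le_succ fun k => hinc h k j)
        ⟨u, by rintro _ ⟨k, rfl⟩; exact hup k j⟩⟩
  choose y hy using hconv
  have hty : Filter.Tendsto seq Filter.atTop (nhds y) := tendsto_pi_nhds.2 hy
  have hlim : ∀ i ≤ n, Filter.Tendsto (fun k => xiSeq l u n (seq k) i) Filter.atTop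
      (nhds (xiSeq l u n y i)) := fun i _ => ((xi_continuous l u n i).tendsto y).comp hty
  have hGlim : ∀ i, i + 1 < n →
      Filter.Tendsto (fun k => GX p (xiSeq l u n (seq k)) i) Filter.atTop (nhds 0) := by
    intro i hi
    have t1 := hlim (i + 1) hi.le
    have t2 := t1.comp (Filter.tendsto_add_atTop_nat 1)
    have t3 := ((t2.sub t1).const_mul (p - 2)).const_mul 2
    rw [sub_self, mul_zero, mul_zero] at t3
    have t4 : Filter.Tendsto (fun k => -((p - 2) * GX p (xiSeq l u n (seq k)) i))
        Filter.atTop (nhds 0) :=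
      squeeze_zero (fun k => by have := (hinv k).2 i hi; linarith)
        (fun k => (hst k).2.2.2.1 i hi) t3
    have hne : p - 2 ≠ 0 := sub_ne_zero.2 hpne
    have t5 := t4.const_mul (-(p - 2)⁻¹)
    rw [mul_zero] at t5
    refine t5.congr fun k => ?_
    field_simp
  obtain ⟨hyg, hy0⟩ := limit_good hp hl hlu hn0 (fun k => (hinv k).1) hlim hGlim
  have hyD : y ∈ domD l u n := (mem_domD_iff hn0).2 hyg
  have : y = xstar := huniq y hyD fun j => by
    have hj := j.2
    rw [Fmap_eq_s11 hp hl hn0 hyD, hy0 j (by omega), mul_zero]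
  rw [← this]
  exact hty
end

section
/- Let ℓ, u be reals with 0 ≤ ℓ < u. (i) If 1 < p ≤ 2, then the function ξ1 ↦ V_p(ℓ, ξ1, u) is strictly convex on the open interval (ℓ, u). (ii) If p > 2, then the function ξ1 ↦ V_p(ℓ, ξ1, u) is quasiconvex on (ℓ, u). -/
/-- The volume `V_p(ℓ, ξ₁, u)` of the perspective relaxation of the piecewise-linear
under-estimator of `x^p` with the single non-boundary linearization point `ξ₁ = t`. -/
noncomputable def V1 (l u p t : ℝ) : ℝ :=
  -((p - 1) ^ 2 / (6 * p)) *
      (l ^ (p - 1) * t ^ (p - 1) * (t - l) ^ 2 / (t ^ (p - 1) - l ^ (p - 1))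
        + t ^ (p - 1) * u ^ (p - 1) * (u - t) ^ 2 / (u ^ (p - 1) - t ^ (p - 1)))
  + ((p - 1) / (6 * p)) * (u ^ (p + 1) - l ^ (p + 1)) - (1 / 6) * (u ^ p * l - u * l ^ p)

noncomputable def auxE (q x t : ℝ) : ℝ := x ^ q * t ^ q * (t - x) ^ 2 / (t ^ q - x ^ q)

noncomputable def auxP (q x t : ℝ) : ℝ := q * x ^ q * (t - x) / (t * (t ^ q - x ^ q))

lemma aux_ne {q x t : ℝ} (hq : 0 < q) (hx : 0 ≤ x) (ht : 0 < t) (hxt : x ≠ t) :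
    t ^ q - x ^ q ≠ 0 := by
  intro h
  apply hxt
  have h2 : x ^ q = t ^ q := by linarith
  exact (Real.rpow_left_inj hx ht.le hq.ne').1 h2

lemma auxE_deriv {q x t : ℝ} (hq : 0 < q) (hx : 0 ≤ x) (ht : 0 < t) (hxt : x ≠ t) :
    HasDerivAt (auxE q x) (t ^ (q + 1) / q * (1 - (1 - auxP q x t) ^ 2)) t := by
  have hne := aux_ne hq hx ht hxt
  have h1 : HasDerivAt (fun t : ℝ => t ^ q) (q * t ^ (q - 1)) t :=
    Real.hasDerivAt_rpow_const (Or.inl ht.ne')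
  have h2 : HasDerivAt (fun t : ℝ => (t - x) ^ 2) (2 * (t - x)) t := by
    refine (((hasDerivAt_id t).sub_const x).pow 2).congr_deriv ?_
    simp
  have h3 := ((h1.const_mul (x ^ q)).mul h2).div (h1.sub_const (x ^ q)) hne
  refine h3.congr_deriv ?_
  unfold auxP
  rw [Real.rpow_sub_one ht.ne', Real.rpow_add_one ht.ne']
  simp only [Pi.mul_apply]
  field_simp
  ring

lemma aux_bern {q x t : ℝ} (hq : 0 < q) (hx : 0 < x) (ht : 0 < t) (hxt : x ≠ t) :
    q * x ^ q * (t - x) < t * (t ^ q - x ^ q) := by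
  have h := one_add_mul_self_lt_rpow_one_add (s := t / x - 1) (p := q + 1)
    (by have : 0 < t / x := by positivity
        linarith)
    (by intro h
        apply hxt
        have : t / x = 1 := by linarith
        rw [div_eq_one_iff_eq hx.ne'] at this
        exact this.symm) (by linarith)
  rw [add_sub_cancel, Real.div_rpow ht.le hx.le, Real.rpow_add_one ht.ne',
    Real.rpow_add_one hx.ne', lt_div_iff₀ (by positivity)] at h
  have e : (1 + (q + 1) * (t / x - 1)) * (x ^ q * x) = x ^ q * ((q + 1) * t - q * x) := by
    field_simp
    ring
  rw [e] at h
  nlinarith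

lemma auxP_lt {q x t : ℝ} (hq : 0 < q) (hx : 0 ≤ x) (hxt : x < t) : auxP q x t < 1 := by
  have ht : 0 < t := by linarith
  rcases hx.eq_or_lt with rfl | hx'
  · simp [auxP, Real.zero_rpow hq.ne']
  have hlt : x ^ q < t ^ q := Real.rpow_lt_rpow hx hxt hq
  unfold auxP
  rw [div_lt_one (mul_pos ht (by linarith))]
  exact aux_bern hq hx' ht hxt.ne

lemma auxP_gt {q x t : ℝ} (hq : 0 < q) (ht : 0 < t) (hxt : t < x) : 1 < auxP q x t := by
  have hx : 0 < x := by linarith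
  have hlt : t ^ q < x ^ q := Real.rpow_lt_rpow ht.le hxt hq
  unfold auxP
  rw [← neg_div_neg_eq, one_lt_div (by nlinarith)]
  have := aux_bern hq hx ht hxt.ne'
  linarith

lemma auxP_anti {q x s t : ℝ} (hq : 0 < q) (hx : 0 ≤ x) (hs : 0 < s) (hst : s ≤ t)
    (hsx : x ≠ s) (htx : x ≠ t) : auxP q x t ≤ auxP q x s := by
  have ht : 0 < t := by linarith
  rcases hx.eq_or_lt with rfl | hx'
  · simp [auxP, Real.zero_rpow hq.ne']
  have hc : ConvexOn ℝ (Set.Ici (0 : ℝ)) (fun t : ℝ => t ^ (q + 1) + (-x ^ q) * t) := by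
    apply (convexOn_rpow (by linarith : 1 ≤ q + 1)).add
    exact ((LinearMap.mul ℝ ℝ (-x ^ q)).convexOn (convex_Ici 0))
  have key : ∀ t : ℝ, 0 < t → x ≠ t →
      slope (fun t : ℝ => t ^ (q + 1) + (-x ^ q) * t) x t = t * (t ^ q - x ^ q) / (t - x) := by
    intro t ht hxt
    rw [slope_def_field, Real.rpow_add_one ht.ne', Real.rpow_add_one hx'.ne']
    congr 1
    ring
  have hm := hc.slope_mono (x := x) hx (a := s) ⟨hs.le, fun h => hsx h.symm⟩ (b := t)
    ⟨ht.le, fun h => htx h.symm⟩ hst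
  rw [key s hs hsx, key t ht htx] at hm
  have hpos : ∀ t : ℝ, 0 < t → x ≠ t → 0 < t * (t ^ q - x ^ q) / (t - x) := by
    intro t ht hxt
    rcases lt_or_gt_of_ne hxt with h | h
    · have := Real.rpow_lt_rpow hx h hq
      exact div_pos (mul_pos ht (by linarith)) (by linarith)
    · have := Real.rpow_lt_rpow ht.le h hq
      exact div_pos_of_neg_of_neg (by nlinarith) (by linarith)
  have hP : ∀ t : ℝ, auxP q x t = q * x ^ q / (t * (t ^ q - x ^ q) / (t - x)) := by
    intro t
    unfold auxP
    rw [div_div_eq_mul_div]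
  rw [hP, hP]
  exact div_le_div_of_nonneg_left (by positivity) (hpos s hs hsx) hm

lemma aux_sinh {q a b : ℝ} (hq : 0 < q) (hq1 : q ≤ 1) (ha : 0 < a) (hab : a ≤ b) :
    Real.sinh a / Real.sinh (q * a) ≤ Real.sinh b / Real.sinh (q * b) := by
  have hd : ∀ y : ℝ, HasDerivAt (fun y => Real.sinh (q * y)) (Real.cosh (q * y) * q) y := by
    intro y
    have := ((hasDerivAt_id y).const_mul q).sinh
    simpa using this
  have hd' : ∀ y : ℝ, HasDerivAt (fun y => Real.cosh (q * y)) (Real.sinh (q * y) * q) y := by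
    intro y
    have := ((hasDerivAt_id y).const_mul q).cosh
    simpa using this
  have hN : ∀ y : ℝ, 0 < y → 0 ≤ Real.cosh y * Real.sinh (q * y)
      - Real.sinh y * (Real.cosh (q * y) * q) := by
    have hm : MonotoneOn (fun y => Real.cosh y * Real.sinh (q * y)
      - Real.sinh y * (Real.cosh (q * y) * q)) (Set.Ici 0) := by
      have hdd : ∀ y : ℝ, HasDerivAt (fun y => Real.cosh y * Real.sinh (q * y)
        - Real.sinh y * (Real.cosh (q * y) * q))
          ((1 - q ^ 2) * (Real.sinh y * Real.sinh (q * y))) y := by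
        intro y
        refine (((Real.hasDerivAt_cosh y).mul (hd y)).sub ((Real.hasDerivAt_sinh y).mul
          ((hd' y).mul_const q))).congr_deriv ?_
        ring
      apply monotoneOn_of_deriv_nonneg (convex_Ici 0)
      · exact fun y _ => (hdd y).continuousAt.continuousWithinAt
      · exact fun y _ => (hdd y).differentiableAt.differentiableWithinAt
      · intro y hy
        rw [interior_Ici] at hy
        have hy : 0 < y := hy
        rw [(hdd y).deriv]
        have h1 : 0 < Real.sinh y := Real.sinh_pos_iff.2 hy
        have h2 : 0 < Real.sinh (q * y) := Real.sinh_pos_iff.2 (by positivity)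
        have h3 : 0 ≤ 1 - q ^ 2 := by nlinarith
        positivity
    intro y hy
    have := hm (Set.mem_Ici.2 le_rfl) (Set.mem_Ici.2 hy.le) hy.le
    simpa using this
  have hm : MonotoneOn (fun y => Real.sinh y / Real.sinh (q * y)) (Set.Ioi 0) := by
    have hdd : ∀ y : ℝ, 0 < y → HasDerivAt (fun y => Real.sinh y / Real.sinh (q * y))
        ((Real.cosh y * Real.sinh (q * y) - Real.sinh y * (Real.cosh (q * y) * q))
          / Real.sinh (q * y) ^ 2) y := by
      intro y hy
      have h2 : 0 < Real.sinh (q * y) := Real.sinh_pos_iff.2 (by positivity)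
      exact (Real.hasDerivAt_sinh y).div (hd y) h2.ne'
    apply monotoneOn_of_deriv_nonneg (convex_Ioi 0)
    · exact fun y hy => (hdd y hy).continuousAt.continuousWithinAt
    · rw [interior_Ioi]
      exact fun y hy => (hdd y hy).differentiableAt.differentiableWithinAt
    · intro y hy
      rw [interior_Ioi] at hy
      rw [(hdd y hy).deriv]
      exact div_nonneg (hN y hy) (sq_nonneg _)
  exact hm ha (lt_of_lt_of_le ha hab) hab

lemma auxP_sinh {q u t : ℝ} (hq : 0 < q) (ht : 0 < t) (htu : t < u) :
    t ^ ((q + 1) / 2) * auxP q u t = u ^ ((q + 1) / 2) * q *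
      (Real.sinh ((Real.log u - Real.log t) / 2) /
        Real.sinh (q * ((Real.log u - Real.log t) / 2))) := by
  have hu : 0 < u := by linarith
  obtain ⟨A, rfl⟩ : ∃ A, u = Real.exp A := ⟨_, (Real.exp_log hu).symm⟩
  obtain ⟨B, rfl⟩ : ∃ B, t = Real.exp B := ⟨_, (Real.exp_log ht).symm⟩
  have hBA : B < A := Real.exp_lt_exp.1 htu
  unfold auxP
  rw [Real.log_exp, Real.log_exp]
  simp only [← Real.exp_mul]
  have h1 : ∀ X Y : ℝ, Real.exp X - Real.exp Y
      = 2 * Real.exp ((X + Y) / 2) * Real.sinh ((X - Y) / 2) := by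
    intro X Y
    rw [Real.sinh_eq]
    have e1 : Real.exp X = Real.exp ((X + Y) / 2) * Real.exp ((X - Y) / 2) := by
      rw [← Real.exp_add]; ring_nf
    have e2 : Real.exp Y = Real.exp ((X + Y) / 2) * Real.exp (-((X - Y) / 2)) := by
      rw [← Real.exp_add]; ring_nf
    rw [e1, e2]; ring
  have hs : 0 < Real.sinh (q * ((A - B) / 2)) :=
    Real.sinh_pos_iff.2 (mul_pos hq (by linarith))
  have e1 : Real.exp B - Real.exp A = -(2 * Real.exp ((A + B) / 2) * Real.sinh ((A - B) / 2)) := by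
    rw [← h1]; ring
  have e2 : Real.exp (B * q) - Real.exp (A * q)
      = -(2 * Real.exp ((A * q + B * q) / 2) * Real.sinh (q * ((A - B) / 2))) := by
    rw [show q * ((A - B) / 2) = (A * q - B * q) / 2 by ring, ← h1]; ring
  rw [e1, e2]
  have e3 : Real.exp (B * ((q + 1) / 2)) * Real.exp (A * q) * Real.exp ((A + B) / 2)
      = Real.exp (A * ((q + 1) / 2)) * (Real.exp B * Real.exp ((A * q + B * q) / 2)) := by
    simp only [← Real.exp_add]
    ring_nf
  generalize Real.sinh (q * ((A - B) / 2)) = S1 at *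
  generalize Real.sinh ((A - B) / 2) = S2 at *
  have p1 := Real.exp_pos ((A * q + B * q) / 2)
  generalize Real.exp ((A * q + B * q) / 2) = X1 at *
  generalize Real.exp ((A + B) / 2) = X2 at *
  generalize Real.exp (B * ((q + 1) / 2)) = X3 at *
  generalize Real.exp (A * ((q + 1) / 2)) = X4 at *
  generalize Real.exp (A * q) = X5 at *
  generalize Real.exp B = X6 at *
  have e4 : X3 * (q * X5 * -(2 * X2 * S2) / (X6 * -(2 * X1 * S1)))
      = (X3 * X5 * X2) * q * S2 / (X6 * X1 * S1) := by
    field_simp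
  rw [e4, e3]
  field_simp

lemma auxH_lower {q x s t : ℝ} (hq : 0 < q) (hx : 0 ≤ x) (hxs : x < s) (hst : s < t) :
    s ^ (q + 1) / q * (1 - auxP q x s) ^ 2 < t ^ (q + 1) / q * (1 - auxP q x t) ^ 2 := by
  have hs : 0 < s := by linarith
  have h1 := auxP_lt hq hx hxs
  have h2 := auxP_anti hq hx hs hst.le hxs.ne (by linarith : x < t).ne
  have h3 : s ^ (q + 1) < t ^ (q + 1) := Real.rpow_lt_rpow hs.le hst (by linarith)
  have h4 : s ^ (q + 1) / q < t ^ (q + 1) / q := div_lt_div_of_pos_right h3 hq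
  have h5 : (1 - auxP q x s) ^ 2 ≤ (1 - auxP q x t) ^ 2 :=
    pow_le_pow_left₀ (by linarith) (by linarith) 2
  have h6 : 0 < (1 - auxP q x s) ^ 2 := pow_pos (by linarith) 2
  have h7 : 0 < s ^ (q + 1) / q := by positivity
  nlinarith

lemma auxH_upper {q u s t : ℝ} (hq : 0 < q) (hq1 : q ≤ 1) (hs : 0 < s) (hst : s < t)
    (htu : t < u) :
    t ^ (q + 1) / q * (1 - auxP q u t) ^ 2 < s ^ (q + 1) / q * (1 - auxP q u s) ^ 2 := by
  have ht : 0 < t := by linarith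
  have hu : 0 < u := by linarith
  have e : ∀ t : ℝ, 0 < t → t ^ (q + 1) / q * (1 - auxP q u t) ^ 2
      = (t ^ ((q + 1) / 2) * auxP q u t - t ^ ((q + 1) / 2)) ^ 2 / q := by
    intro t ht
    have : t ^ (q + 1) = t ^ ((q + 1) / 2) * t ^ ((q + 1) / 2) := by
      rw [← Real.rpow_add ht]; ring_nf
    rw [this]; ring
  rw [e t ht, e s hs]
  apply div_lt_div_of_pos_right _ hq
  have hP := auxP_gt hq ht htu
  have h3 : s ^ ((q + 1) / 2) < t ^ ((q + 1) / 2) := Real.rpow_lt_rpow hs.le hst (by linarith)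
  have h4 : t ^ ((q + 1) / 2) * auxP q u t ≤ s ^ ((q + 1) / 2) * auxP q u s := by
    rw [auxP_sinh hq ht htu, auxP_sinh hq hs (hst.trans htu)]
    have l1 := Real.log_lt_log hs hst
    have l2 := Real.log_lt_log ht htu
    exact mul_le_mul_of_nonneg_left (aux_sinh hq hq1 (by linarith) (by linarith)) (by positivity)
  have h5 : 0 < t ^ ((q + 1) / 2) := by positivity
  exact pow_lt_pow_left₀ (by linarith) (by nlinarith) two_ne_zero

lemma aux_V1_deriv {l u p t : ℝ} (hl : 0 ≤ l) (hp : 1 < p) (ht : t ∈ Set.Ioo l u) :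
    HasDerivAt (V1 l u p) ((p - 1) ^ 2 / (6 * p) *
      (t ^ (p - 1 + 1) / (p - 1) * (1 - auxP (p - 1) l t) ^ 2
        - t ^ (p - 1 + 1) / (p - 1) * (1 - auxP (p - 1) u t) ^ 2)) t := by
  obtain ⟨h1, h2⟩ := ht
  have ht : 0 < t := by linarith
  have hq : 0 < p - 1 := by linarith
  have e : V1 l u p = fun t => -((p - 1) ^ 2 / (6 * p)) * (auxE (p - 1) l t - auxE (p - 1) u t)
     + (((p - 1) / (6 * p)) * (u ^ (p + 1) - l ^ (p + 1)) - (1 / 6) * (u ^ p * l - u * l ^ p)) := by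
    funext t
    unfold V1 auxE
    have : t ^ (p - 1) * u ^ (p - 1) * (u - t) ^ 2 / (u ^ (p - 1) - t ^ (p - 1))
      = - (u ^ (p - 1) * t ^ (p - 1) * (t - u) ^ 2 / (t ^ (p - 1) - u ^ (p - 1))) := by
      rw [← div_neg]
      congr 1 <;> ring
    rw [this]; ring
  rw [e]
  refine ((((auxE_deriv hq hl ht h1.ne).sub
    (auxE_deriv hq (by linarith) ht h2.ne')).const_mul _).add_const _).congr_deriv ?_
  ring

/-- For `1 < p ≤ 2`, `ξ₁ ↦ V_p(ℓ, ξ₁, u)` is strictly convex on `(ℓ, u)`;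
for `p > 2` it is quasiconvex on `(ℓ, u)`. -/
theorem V1_strictConvex_or_quasiconvex (l u : ℝ) (hl : 0 ≤ l) (hlu : l < u)
    (p : ℝ) (hp : 1 < p) :
    (p ≤ 2 → StrictConvexOn ℝ (Set.Ioo l u) (V1 l u p)) ∧
    (2 < p → QuasiconvexOn ℝ (Set.Ioo l u) (V1 l u p)) := by
  have hq : 0 < p - 1 := by linarith
  have hc : 0 < (p - 1) ^ 2 / (6 * p) := by positivity
  constructor
  · intro hp2
    apply StrictMonoOn.strictConvexOn_of_deriv (convex_Ioo l u)
    · exact fun t ht => (aux_V1_deriv hl hp ht).continuousAt.continuousWithinAt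
    · rw [interior_Ioo]
      intro s hs t ht hst
      rw [(aux_V1_deriv hl hp hs).deriv, (aux_V1_deriv hl hp ht).deriv]
      have h1 := auxH_lower hq hl hs.1 hst
      have h2 := auxH_upper hq (by linarith) (lt_of_le_of_lt hl hs.1) hst ht.2
      exact mul_lt_mul_of_pos_left (by linarith) hc
  · intro _
    have key : ∀ x ∈ Set.Ioo l u, ∀ y ∈ Set.Ioo l u, ∀ z ∈ Set.Ioo l u, x ≤ y → y ≤ z →
        V1 l u p y ≤ max (V1 l u p x) (V1 l u p z) := by
      intro x hx y hy z hz hxy hyz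
      have hf : ∀ t : ℝ, (t ^ (p - 1 + 1) / (p - 1) * (1 - auxP (p - 1) l t) ^ 2
        - t ^ (p - 1 + 1) / (p - 1) * (1 - auxP (p - 1) u t) ^ 2)
        = t ^ (p - 1 + 1) / (p - 1) * (auxP (p - 1) u t - auxP (p - 1) l t) *
          (2 - (auxP (p - 1) l t + auxP (p - 1) u t)) := by
        intro t; ring
      have hpos : ∀ t ∈ Set.Ioo l u,
          0 ≤ t ^ (p - 1 + 1) / (p - 1) * (auxP (p - 1) u t - auxP (p - 1) l t) := by
        intro t ht
        have h0 : 0 < t := lt_of_le_of_lt hl ht.1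
        have h1 := auxP_lt hq hl ht.1
        have h2 := auxP_gt hq h0 ht.2
        have : 0 ≤ auxP (p - 1) u t - auxP (p - 1) l t := by linarith
        positivity
      have hanti : ∀ s ∈ Set.Ioo l u, ∀ t ∈ Set.Ioo l u, s ≤ t →
          auxP (p - 1) l t + auxP (p - 1) u t ≤ auxP (p - 1) l s + auxP (p - 1) u s := by
        intro s hs t ht hst
        have h0 : 0 < s := lt_of_le_of_lt hl hs.1
        exact add_le_add (auxP_anti hq hl h0 hst hs.1.ne ht.1.ne)
          (auxP_anti hq (by linarith) h0 hst hs.2.ne' ht.2.ne')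
      rcases le_total 2 (auxP (p - 1) l y + auxP (p - 1) u y) with h | h
      · apply le_max_of_le_left
        have hsub : Set.Icc x y ⊆ Set.Ioo l u :=
          fun t ht => ⟨lt_of_lt_of_le hx.1 ht.1, lt_of_le_of_lt ht.2 hy.2⟩
        have : AntitoneOn (V1 l u p) (Set.Icc x y) := by
          apply antitoneOn_of_deriv_nonpos (convex_Icc x y)
          · exact fun t ht => (aux_V1_deriv hl hp (hsub ht)).continuousAt.continuousWithinAt
          · exact fun t ht => (aux_V1_deriv hl hp
              (hsub (interior_subset ht))).differentiableAt.differentiableWithinAt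
          · intro t ht
            have ht := interior_subset ht
            have ht' := hsub ht
            rw [(aux_V1_deriv hl hp ht').deriv, hf]
            have h3 := hanti t ht' y hy ht.2
            exact mul_nonpos_of_nonneg_of_nonpos hc.le
              (mul_nonpos_of_nonneg_of_nonpos (hpos t ht') (by linarith))
        exact this ⟨le_rfl, hxy⟩ ⟨hxy, le_rfl⟩ hxy
      · apply le_max_of_le_right
        have hsub : Set.Icc y z ⊆ Set.Ioo l u :=
          fun t ht => ⟨lt_of_lt_of_le hy.1 ht.1, lt_of_le_of_lt ht.2 hz.2⟩
        have : MonotoneOn (V1 l u p) (Set.Icc y z) := by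
          apply monotoneOn_of_deriv_nonneg (convex_Icc y z)
          · exact fun t ht => (aux_V1_deriv hl hp (hsub ht)).continuousAt.continuousWithinAt
          · exact fun t ht => (aux_V1_deriv hl hp
              (hsub (interior_subset ht))).differentiableAt.differentiableWithinAt
          · intro t ht
            have ht := interior_subset ht
            have ht' := hsub ht
            rw [(aux_V1_deriv hl hp ht').deriv, hf]
            have h3 := hanti y hy t ht' ht.1
            exact mul_nonneg hc.le (mul_nonneg (hpos t ht') (by linarith))
        exact this ⟨le_rfl, hyz⟩ ⟨hyz, le_rfl⟩ hyz
    intro r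
    rw [convex_iff_ordConnected]
    refine ⟨fun x hx z hz y hy => ?_⟩
    have hyI : y ∈ Set.Ioo l u := ⟨lt_of_lt_of_le hx.1.1 hy.1, lt_of_le_of_lt hy.2 hz.1.2⟩
    exact ⟨hyI, (key x hx.1 y hyI z hz.1 hy.1 hy.2).trans (max_le hx.2 hz.2)⟩
end

section
/- Let ℓ, u be reals with 0 ≤ ℓ < u and let p > 2. Let ξ1* ∈ (ℓ, u) be the unique minimizer of ξ1 ↦ V_p(ℓ, ξ1, u) on (ℓ, u). Then the function ξ1 ↦ V_p(ℓ, ξ1, u) is convex on the interval (ξ1*, u). -/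
/-- One half of the volume function. -/
noncomputable def HH (q c t : ℝ) : ℝ := c ^ q * t ^ q * (t - c) ^ 2 / (t ^ q - c ^ q)

/-- Normalised reciprocal secant slope of `x ^ (-q)`. -/
noncomputable def NN (q c t : ℝ) : ℝ := q * c ^ q * (t - c) / (t * (t ^ q - c ^ q))

lemma pow_ne_aux {q c t : ℝ} (hq : 0 < q) (hc : 0 ≤ c) (ht : 0 < t) (hct : t ≠ c) :
    t ^ q - c ^ q ≠ 0 := by
  intro h
  apply hct
  exact (Real.rpow_left_inj ht.le hc hq.ne').1 (by linarith)

lemma HH_deriv {q c t : ℝ} (hq : 0 < q) (hc : 0 ≤ c) (ht : 0 < t) (hct : t ≠ c) :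
    HasDerivAt (HH q c) (t ^ (q + 1) / q * (1 - (1 - NN q c t) ^ 2)) t := by
  have hne := pow_ne_aux hq hc ht hct
  have h1 : HasDerivAt (fun t : ℝ => t ^ q) (q * t ^ (q - 1)) t :=
    Real.hasDerivAt_rpow_const (Or.inl ht.ne')
  have h2 : HasDerivAt (fun t : ℝ => (t - c) ^ 2) (2 * (t - c)) t := by
    refine (((hasDerivAt_id t).sub_const c).pow 2).congr_deriv ?_
    simp
  have h3 := (((h1.const_mul (c ^ q)).mul h2).div (h1.sub_const (c ^ q)) hne)
  refine h3.congr_deriv ?_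
  simp only [Pi.mul_apply, NN]
  rw [Real.rpow_add_one ht.ne', Real.rpow_sub_one ht.ne']
  generalize t ^ q = T at *
  generalize c ^ q = C at *
  field_simp
  ring

lemma tangent {q c t : ℝ} (hq : 0 < q) (hc : 0 ≤ c) (ht : 0 < t) :
    q * c ^ q * (t - c) ≤ t * (t ^ q - c ^ q) := by
  rcases hc.eq_or_lt with rfl | hc
  · rw [Real.zero_rpow hq.ne']
    have := Real.rpow_pos_of_pos ht q
    simp only [mul_zero, zero_mul, sub_zero]
    positivity
  · have h := one_add_mul_self_le_rpow_one_add (s := (t - c) / c) (p := q + 1)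
      (by rw [le_div_iff₀ hc]; linarith) (by linarith)
    have e : 1 + (t - c) / c = t / c := by field_simp; ring
    rw [e, Real.div_rpow ht.le hc.le, Real.rpow_add_one ht.ne', Real.rpow_add_one hc.ne'] at h
    have hC := Real.rpow_pos_of_pos hc q
    rw [le_div_iff₀ (by positivity)] at h
    have e2 : (1 + (q + 1) * ((t - c) / c)) * (c ^ q * c)
      = c ^ q * c + (q + 1) * c ^ q * (t - c) := by field_simp
    rw [e2] at h
    linarith

/-- Secant slope whose reciprocal gives `NN`. -/
lemma G_mono {q c s t : ℝ} (hq : 0 < q) (hc : 0 ≤ c) (hs : 0 < s) (hst : s ≤ t)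
    (hsc : s ≠ c) (htc : t ≠ c) :
    s * (s ^ q - c ^ q) / (s - c) ≤ t * (t ^ q - c ^ q) / (t - c) := by
  have hcv : ConvexOn ℝ (Set.Ici 0) (fun x : ℝ => x ^ (q + 1) + (-(c ^ q)) * x) := by
    refine (convexOn_rpow (by linarith)).add ⟨convex_Ici 0, ?_⟩
    intro x _ y _ a b _ _ _
    simp only [smul_eq_mul]
    exact le_of_eq (by ring)
  have h := hcv.secant_mono (a := c) (x := s) (y := t) hc hs.le (hs.le.trans hst) hsc htc hst
  have hcc : c ^ (q + 1) = c ^ q * c := Real.rpow_add_one' hc (by linarith)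
  simp only [Real.rpow_add_one hs.ne', Real.rpow_add_one (hs.trans_le hst).ne', hcc] at h
  have e : ∀ x : ℝ, x * (x ^ q - c ^ q)
      = x ^ q * x + -(c ^ q) * x - (c ^ q * c + -(c ^ q) * c) := by
    intro x; ring
  rw [e, e]
  exact h

lemma G_pos {q c t : ℝ} (hq : 0 < q) (hc : 0 ≤ c) (ht : 0 < t) (hct : t ≠ c) :
    0 < t * (t ^ q - c ^ q) / (t - c) := by
  rcases lt_or_gt_of_ne hct with h | h
  · have := Real.rpow_lt_rpow ht.le h hq
    exact div_pos_of_neg_of_neg (mul_neg_of_pos_of_neg ht (by linarith)) (by linarith)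
  · have := Real.rpow_lt_rpow hc h hq
    exact div_pos (mul_pos ht (by linarith)) (by linarith)

lemma NN_anti {q c s t : ℝ} (hq : 0 < q) (hc : 0 ≤ c) (hs : 0 < s) (hst : s ≤ t)
    (hsc : s ≠ c) (htc : t ≠ c) : NN q c t ≤ NN q c s := by
  have e : ∀ x, NN q c x = q * c ^ q / (x * (x ^ q - c ^ q) / (x - c)) := by
    intro x; rw [NN, div_div_eq_mul_div]
  rw [e, e]
  have hC : 0 ≤ c ^ q := Real.rpow_nonneg hc q
  exact div_le_div_of_nonneg_left (by positivity) (G_pos hq hc hs hsc)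
    (G_mono hq hc hs hst hsc htc)

lemma NN_le {q c t : ℝ} (hq : 0 < q) (hc : 0 ≤ c) (h : c < t) : NN q c t ≤ 1 := by
  have ht : 0 < t := hc.trans_lt h
  have := Real.rpow_lt_rpow hc h hq
  rw [NN, div_le_one (mul_pos ht (by linarith))]
  exact tangent hq hc ht

lemma NN_ge {q c t : ℝ} (hq : 0 < q) (ht : 0 < t) (h : t < c) : 1 ≤ NN q c t := by
  have := Real.rpow_lt_rpow ht.le h hq
  rw [NN, one_le_div_of_neg (mul_neg_of_pos_of_neg ht (by linarith))]
  exact tangent hq (ht.le.trans h.le) ht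

/-- For `p > 2`, `ξ₁ ↦ V_p(ℓ, ξ₁, u)` is convex to the right of its unique minimizer. -/
theorem V1_convexOn_right_of_minimizer (l u : ℝ) (hl : 0 ≤ l) (hlu : l < u)
    (p : ℝ) (hp : 2 < p) (xstar : ℝ) (hx : xstar ∈ Set.Ioo l u)
    (hmin : ∀ t ∈ Set.Ioo l u, V1 l u p xstar ≤ V1 l u p t)
    (huniq : ∀ t ∈ Set.Ioo l u, (∀ s ∈ Set.Ioo l u, V1 l u p t ≤ V1 l u p s) → t = xstar) :
    ConvexOn ℝ (Set.Ioo xstar u) (V1 l u p) := by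
  obtain ⟨q, hq⟩ : ∃ q, q = p - 1 := ⟨_, rfl⟩
  have hq0 : 0 < q := by linarith
  have hu0 : 0 ≤ u := hl.trans hlu.le
  have hK : 0 < (p - 1) ^ 2 / (6 * p) := by
    have : 0 < p - 1 := by linarith
    positivity
  set K := (p - 1) ^ 2 / (6 * p) with hKdef
  -- the derivative
  let D : ℝ → ℝ := fun t => K / q * (t ^ (q + 1) * ((1 - NN q l t) ^ 2 - (NN q u t - 1) ^ 2))
  have hV : V1 l u p = fun t => -K * (HH q l t - HH q u t)
      + (((p - 1) / (6 * p)) * (u ^ (p + 1) - l ^ (p + 1))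
      - (1 / 6) * (u ^ p * l - u * l ^ p)) := by
    funext t
    have e : t ^ q * u ^ q * (u - t) ^ 2 / (u ^ q - t ^ q) = - HH q u t := by
      rw [HH, ← neg_sub (u ^ q) (t ^ q), div_neg, neg_neg]
      congr 1; ring
    rw [V1, ← hKdef, ← hq, e]
    simp only [HH]
    ring
  have hD : ∀ t ∈ Set.Ioo l u, HasDerivAt (V1 l u p) (D t) t := by
    intro t ht
    have ht0 : 0 < t := hl.trans_lt ht.1
    rw [hV]
    refine ((((HH_deriv hq0 hl ht0 ht.1.ne').sub
      (HH_deriv hq0 hu0 ht0 ht.2.ne)).const_mul (-K)).add_const _).congr_deriv ?_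
    simp only [D]
    field_simp
    ring
  have hx0 : 0 < xstar := hl.trans_lt hx.1
  have hcrit : D xstar = 0 := by
    have hloc : IsLocalMin (V1 l u p) xstar := by
      filter_upwards [Ioo_mem_nhds hx.1 hx.2] with t ht using hmin t ht
    exact hloc.hasDerivAt_eq_zero (hD xstar hx)
  have hcrit' : (1 - NN q l xstar) ^ 2 - (NN q u xstar - 1) ^ 2 = 0 := by
    have h1 : K / q ≠ 0 := (div_pos hK hq0).ne'
    have h2 : xstar ^ (q + 1) ≠ 0 := (Real.rpow_pos_of_pos hx0 _).ne'
    simpa only [D, mul_eq_zero, h1, h2, false_or] using hcrit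
  have hE : ∀ s ∈ Set.Ioo l u, ∀ t ∈ Set.Ioo l u, s ≤ t →
      (1 - NN q l s) ^ 2 - (NN q u s - 1) ^ 2 ≤ (1 - NN q l t) ^ 2 - (NN q u t - 1) ^ 2 := by
    intro s hs t ht hst
    have hs0 : 0 < s := hl.trans_lt hs.1
    have ht0 : 0 < t := hl.trans_lt ht.1
    have a1 := NN_anti hq0 hl hs0 hst hs.1.ne' ht.1.ne'
    have a2 := NN_anti hq0 hu0 hs0 hst hs.2.ne ht.2.ne
    have a3 := NN_le hq0 hl hs.1
    have a4 := NN_ge hq0 ht0 ht.2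
    have b1 : (1 - NN q l s) ^ 2 ≤ (1 - NN q l t) ^ 2 :=
      pow_le_pow_left₀ (by linarith) (by linarith) 2
    have b2 : (NN q u t - 1) ^ 2 ≤ (NN q u s - 1) ^ 2 :=
      pow_le_pow_left₀ (by linarith) (by linarith) 2
    linarith
  have hsub : ∀ t ∈ Set.Ioo xstar u, t ∈ Set.Ioo l u := fun t ht => ⟨hx.1.trans ht.1, ht.2⟩
  apply MonotoneOn.convexOn_of_deriv (convex_Ioo _ _)
  · exact fun t ht => (hD t (hsub t ht)).continuousAt.continuousWithinAt
  · rw [interior_Ioo]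
    exact fun t ht => (hD t (hsub t ht)).differentiableAt.differentiableWithinAt
  · rw [interior_Ioo]
    intro s hs t ht hst
    rw [(hD s (hsub s hs)).deriv, (hD t (hsub t ht)).deriv]
    have hs0 : 0 < s := hx0.trans hs.1
    have ht0 : 0 < t := hx0.trans ht.1
    have h0 := hE xstar hx s (hsub s hs) hs.1.le
    rw [hcrit'] at h0
    have h1 := hE s (hsub s hs) t (hsub t ht) hst
    apply mul_le_mul_of_nonneg_left _ (div_pos hK hq0).le
    exact mul_le_mul (Real.rpow_le_rpow hs0.le hst (by linarith)) h1 h0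
      (Real.rpow_nonneg ht0.le _)
end

section
/- Let ℓ, u be reals with 0 ≤ ℓ < u and let p > 2. Define C := ((p−1)u^p + ℓ^p − p·u^{p−1}·ℓ)·(u^p + (p−1)ℓ^p − p·u·ℓ^{p−1}) / (6p·(u^{p−1} − ℓ^{p−1})) and h(ξ1) := C − V_p(ℓ, ξ1, u). Then h(ξ1) > 0 for all ξ1 ∈ (ℓ, u), and h is strictly log-concave on (ℓ, u) (i.e., ξ1 ↦ log h(ξ1) is strictly concave on (ℓ, u)). -/
theorem aux_sc (D : Set ℝ) (hD : Convex ℝ D) (ho : IsOpen D) (f f' f'' : ℝ → ℝ)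
    (h1 : ∀ x ∈ D, HasDerivAt f (f' x) x) (h2 : ∀ x ∈ D, HasDerivAt f' (f'' x) x)
    (h3 : ∀ x ∈ D, 0 < f'' x) : StrictConvexOn ℝ D f := by
  apply strictConvexOn_of_deriv2_pos' hD
  · intro x hx
    exact (h1 x hx).continuousAt.continuousWithinAt
  · intro x hx
    have e : deriv f =ᶠ[nhds x] f' := by
      filter_upwards [ho.mem_nhds hx] with y hy using (h1 y hy).deriv
    have : deriv^[2] f x = f'' x := by
      simp only [Function.iterate_succ, Function.iterate_zero, Function.comp, id]
      rw [e.deriv_eq, (h2 x hx).deriv]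
    rw [this]; exact h3 x hx

theorem aux_bern_s14 (q r : ℝ) (hq : 1 < q) (hr : 0 < r) (hr1 : r ≠ 1) :
    1 + q * (r - 1) < r ^ q := by
  have := one_add_mul_self_lt_rpow_one_add (s := r - 1) (by linarith) (by
    intro h; apply hr1; linarith) hq
  simpa using this

theorem aux_pow (q r : ℝ) (hr : 0 < r) : r ^ q = r ^ (q - 1) * r := by
  rw [Real.rpow_sub_one hr.ne']; field_simp

theorem aux_E (q r : ℝ) (hq : 1 < q) (hr : 1 < r) :
    (r + 1) * (r ^ q - 1) < q * (r - 1) * (r ^ q + 1) := by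
  let e : ℝ → ℝ := fun r => q * (r - 1) * (r ^ q + 1) - (r + 1) * (r ^ q - 1)
  have hd : ∀ x : ℝ, 0 < x → HasDerivAt e
      ((q * 1) * (x ^ q + 1) + q * (x - 1) * (q * x ^ (q - 1)) -
        (1 * (x ^ q - 1) + (x + 1) * (q * x ^ (q - 1)))) x := by
    intro x hx
    have hp := Real.hasDerivAt_rpow_const (x := x) (p := q) (Or.inl hx.ne')
    have hi := hasDerivAt_id x
    exact (((hi.sub_const 1).const_mul q).mul (hp.add_const 1)).sub
      ((hi.add_const 1).mul (hp.sub_const 1))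
  have hm : StrictMonoOn e (Set.Ici 1) := by
    apply strictMonoOn_of_deriv_pos (convex_Ici 1)
    · intro x hx
      exact (hd x (lt_of_lt_of_le one_pos hx)).continuousAt.continuousWithinAt
    · intro x hx
      rw [interior_Ici] at hx
      have hx1 : 1 < x := hx
      have hx0 : 0 < x := by linarith
      rw [(hd x hx0).deriv]
      have hb := aux_bern_s14 q x⁻¹ hq (inv_pos.2 hx0) (inv_lt_one_of_one_lt₀ hx1).ne
      rw [Real.inv_rpow hx0.le, aux_pow q x hx0] at hb
      have hv : 0 < x ^ (q - 1) := Real.rpow_pos_of_pos hx0 _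
      rw [aux_pow q x hx0]
      set v := x ^ (q - 1)
      have h2 : v * x * (1 + q * (x⁻¹ - 1)) < v * x * (v * x)⁻¹ :=
        mul_lt_mul_of_pos_left hb (by positivity)
      have h3 : v * x * (1 + q * (x⁻¹ - 1)) = v * x + q * v - q * v * x := by
        field_simp; ring
      have h4 : v * x * (v * x)⁻¹ = 1 := mul_inv_cancel₀ (by positivity)
      rw [h3, h4] at h2
      nlinarith
  have := hm (Set.mem_Ici.2 le_rfl) (Set.mem_Ici.2 hr.le) hr
  simp only [e] at this
  norm_num at this
  linarith

theorem aux_sinh_s14 (q y : ℝ) (hq : 1 < q) (hy : 0 ≤ y) :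
    q * Real.sinh y ≤ Real.sinh (q * y) := by
  let e : ℝ → ℝ := fun y => Real.sinh (q * y) - q * Real.sinh y
  have hd : ∀ x : ℝ, HasDerivAt e (Real.cosh (q * x) * (q * 1) - q * Real.cosh x) x := by
    intro x
    exact (((hasDerivAt_id x).const_mul q).sinh).sub ((Real.hasDerivAt_sinh x).const_mul q)
  have hm : MonotoneOn e (Set.Ici 0) := by
    apply monotoneOn_of_deriv_nonneg (convex_Ici 0)
    · intro x hx
      exact (hd x).continuousAt.continuousWithinAt
    · intro x hx
      exact (hd x).differentiableAt.differentiableWithinAt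
    · intro x hx
      rw [interior_Ici] at hx
      have hx0 : 0 < x := hx
      rw [(hd x).deriv]
      have : Real.cosh x ≤ Real.cosh (q * x) := by
        rw [Real.cosh_le_cosh, abs_of_pos hx0, abs_of_pos (by positivity)]
        nlinarith
      nlinarith
  have := hm (Set.mem_Ici.2 le_rfl) (Set.mem_Ici.2 hy) hy
  simp only [e] at this
  norm_num at this
  linarith

theorem aux_S (q r : ℝ) (hq : 1 < q) (hr : 0 < r) (hr1 : r < 1) :
    q ^ 2 * r ^ q * (1 - r) ^ 2 ≤ r * (1 - r ^ q) ^ 2 := by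
  obtain ⟨y, hy, rfl⟩ : ∃ y : ℝ, 0 < y ∧ r = Real.exp (-y) ^ 2 := by
    refine ⟨-Real.log r / 2, ?_, ?_⟩
    · have := Real.log_neg hr hr1
      linarith
    · rw [← Real.exp_nat_mul]
      push_cast
      rw [show (2 : ℝ) * -(-Real.log r / 2) = Real.log r by ring, Real.exp_log hr]
  have hw : (Real.exp (-y) ^ 2) ^ q = Real.exp (-(q * y)) ^ 2 := by
    rw [← Real.exp_nat_mul, ← Real.exp_mul, ← Real.exp_nat_mul]
    congr 1; push_cast; ring
  rw [hw]
  have hs := aux_sinh_s14 q y hq hy.le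
  have h0 : 0 ≤ Real.sinh y := Real.sinh_nonneg_iff.2 hy.le
  have e1 : 1 - Real.exp (-y) ^ 2 = 2 * Real.exp (-y) * Real.sinh y := by
    rw [Real.sinh_eq]
    have : Real.exp y * Real.exp (-y) = 1 := by rw [← Real.exp_add]; simp
    linear_combination -this
  have e2 : 1 - Real.exp (-(q * y)) ^ 2 = 2 * Real.exp (-(q * y)) * Real.sinh (q * y) := by
    rw [Real.sinh_eq]
    have : Real.exp (q * y) * Real.exp (-(q * y)) = 1 := by rw [← Real.exp_add]; simp
    linear_combination -this
  rw [e1, e2]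
  have h2 : (q * Real.sinh y) ^ 2 ≤ Real.sinh (q * y) ^ 2 := by
    apply pow_le_pow_left₀ (by positivity) hs
  have h3 := mul_le_mul_of_nonneg_left h2
    (show 0 ≤ 4 * Real.exp (-y) ^ 2 * Real.exp (-(q * y)) ^ 2 by positivity)
  linarith

theorem aux_f1 (q : ℝ) (hq : 1 < q) :
    StrictConvexOn ℝ (Set.Ioi 1) (fun r : ℝ => r ^ q * (r - 1) / (r ^ q - 1)) := by
  have key : StrictConvexOn ℝ (Set.Ioi 1) (fun r : ℝ => (r - 1) + (r - 1) / (r ^ q - 1)) := by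
    apply aux_sc _ (convex_Ioi 1) isOpen_Ioi _
      (fun r => 1 + ((r ^ q - 1) - (r - 1) * (q * r ^ (q - 1))) / (r ^ q - 1) ^ 2)
      (fun r => ((q * r ^ (q - 1) - (q * r ^ (q - 1) +
        (r - 1) * (q * ((q - 1) * r ^ (q - 1 - 1))))) * (r ^ q - 1) ^ 2 -
        ((r ^ q - 1) - (r - 1) * (q * r ^ (q - 1))) *
          (2 * (r ^ q - 1) * (q * r ^ (q - 1)))) / ((r ^ q - 1) ^ 2) ^ 2)
    · intro x hx
      have hx1 : 1 < x := hx
      have hx0 : 0 < x := by linarith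
      have hw : 1 < x ^ q := Real.one_lt_rpow hx1 (by linarith)
      have hp := Real.hasDerivAt_rpow_const (x := x) (p := q) (Or.inl hx0.ne')
      have hi := (hasDerivAt_id x).sub_const 1
      refine (hi.add (hi.div (hp.sub_const 1) (by linarith))).congr_deriv ?_
      simp
    · intro x hx
      have hx1 : 1 < x := hx
      have hx0 : 0 < x := by linarith
      have hw : 1 < x ^ q := Real.one_lt_rpow hx1 (by linarith)
      have hp := Real.hasDerivAt_rpow_const (x := x) (p := q) (Or.inl hx0.ne')
      have hp2 := Real.hasDerivAt_rpow_const (x := x) (p := q - 1) (Or.inl hx0.ne')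
      have hi := (hasDerivAt_id x).sub_const 1
      have hp' := hp.sub_const 1
      have hden : (x ^ q - 1) ^ 2 ≠ 0 := by
        have : 0 < x ^ q - 1 := by linarith
        positivity
      refine (((hp'.sub (hi.mul (hp2.const_mul q))).div (hp'.pow 2) hden).const_add 1).congr_deriv ?_
      simp
    · intro x hx
      have hx1 : 1 < x := hx
      have hx0 : 0 < x := by linarith
      have hw : 1 < x ^ q := Real.one_lt_rpow hx1 (by linarith)
      have hE := aux_E q x hq hx1
      have hz : 0 < x ^ (q - 1 - 1) := Real.rpow_pos_of_pos hx0 _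
      have e1 := aux_pow q x hx0
      have e2 := aux_pow (q - 1) x hx0
      rw [e2] at e1 ⊢
      have hw0 : 0 < x ^ q - 1 := by linarith
      apply div_pos _ (by positivity)
      set z := x ^ (q - 1 - 1)
      set w := x ^ q
      have : 0 < q * z * (w - 1) * (q * (x - 1) * (w + 1) - (x + 1) * (w - 1)) := by
        apply mul_pos (by positivity) (by linarith)
      refine this.trans_eq ?_
      rw [e1]; ring
  refine key.congr ?_
  intro x hx
  have hx1 : 1 < x := hx
  have hw : 1 < x ^ q := Real.one_lt_rpow hx1 (by linarith)
  have : x ^ q - 1 ≠ 0 := by linarith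
  simp only
  field_simp
  ring

theorem aux_f2 (q : ℝ) (hq : 1 < q) :
    StrictConcaveOn ℝ (Set.Ioo 0 1)
      (fun r : ℝ => Real.log (r ^ q * (1 - r) / (1 - r ^ q))) := by
  have key : StrictConvexOn ℝ (Set.Ioo 0 1)
      (fun r : ℝ => Real.log (1 - r ^ q) - Real.log (1 - r) - q * Real.log r) := by
    apply aux_sc _ (convex_Ioo 0 1) isOpen_Ioo _
      (fun r => (-(q * r ^ (q - 1))) / (1 - r ^ q) - (-1) / (1 - r) - q * r⁻¹)
      (fun r => ((-(q * ((q - 1) * r ^ (q - 1 - 1)))) * (1 - r ^ q) -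
        (-(q * r ^ (q - 1))) * (-(q * r ^ (q - 1)))) / (1 - r ^ q) ^ 2 -
        (0 * (1 - r) - (-1) * (-1)) / (1 - r) ^ 2 - q * (-(r ^ 2)⁻¹))
    · rintro x ⟨hx0, hx1⟩
      have hw : x ^ q < 1 := Real.rpow_lt_one hx0.le hx1 (by linarith)
      have hp := (Real.hasDerivAt_rpow_const (x := x) (p := q) (Or.inl hx0.ne')).const_sub 1
      have hi := (hasDerivAt_id x).const_sub 1
      exact ((hp.log (by linarith)).sub (hi.log (by simp; linarith))).sub
        ((Real.hasDerivAt_log hx0.ne').const_mul q)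
    · rintro x ⟨hx0, hx1⟩
      have hw : x ^ q < 1 := Real.rpow_lt_one hx0.le hx1 (by linarith)
      have hp := (Real.hasDerivAt_rpow_const (x := x) (p := q) (Or.inl hx0.ne')).const_sub 1
      have hp2 := Real.hasDerivAt_rpow_const (x := x) (p := q - 1) (Or.inl hx0.ne')
      have hi := (hasDerivAt_id x).const_sub 1
      exact (((hp2.const_mul q).neg.div hp (by linarith)).sub
        ((hasDerivAt_const x (-1 : ℝ)).div hi (by simp; linarith))).sub
        ((hasDerivAt_inv hx0.ne').const_mul q)
    · rintro x ⟨hx0, hx1⟩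
      have hw : x ^ q < 1 := Real.rpow_lt_one hx0.le hx1 (by linarith)
      have hS := aux_S q x hq hx0 hx1
      have hB := aux_bern_s14 q x hq hx0 hx1.ne
      have hz : 0 < x ^ (q - 1 - 1) := Real.rpow_pos_of_pos hx0 _
      have e1 := aux_pow q x hx0
      have e2 := aux_pow (q - 1) x hx0
      rw [e2] at e1 ⊢
      set z := x ^ (q - 1 - 1)
      set w := x ^ q
      have hD : 0 < 1 - w := by linarith
      have hr : 0 < 1 - x := by linarith
      have hz2 : z = w / x ^ 2 := by rw [e1]; field_simp
      have hnum : 0 < q * (1 - w) * (1 - x) ^ 2 + x ^ 2 * (1 - w) ^ 2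
          - q ^ 2 * w * (1 - x) ^ 2 := by
        have h1 : 0 < (1 - w) * (1 - x) * (q * (1 - x) - x * (1 - w)) := by
          apply mul_pos (by positivity)
          nlinarith
        nlinarith
      have : 0 < (q * (1 - w) * (1 - x) ^ 2 + x ^ 2 * (1 - w) ^ 2
          - q ^ 2 * w * (1 - x) ^ 2) / (x ^ 2 * (1 - x) ^ 2 * (1 - w) ^ 2) := by
        positivity
      refine this.trans_eq ?_
      rw [hz2]
      field_simp
      ring
  refine key.neg.congr ?_
  rintro x ⟨hx0, hx1⟩
  have hw : x ^ q < 1 := Real.rpow_lt_one hx0.le hx1 (by linarith)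
  have h0 : 0 < x ^ q := Real.rpow_pos_of_pos hx0 _
  have h1 : 0 < 1 - x := by linarith
  have h2 : 0 < 1 - x ^ q := by linarith
  simp only [Pi.neg_apply]
  rw [Real.log_div (by positivity) h2.ne', Real.log_mul h0.ne' h1.ne', Real.log_rpow hx0]
  ring

theorem aux_hold (X Y a α β : ℝ) (ha : 0 ≤ a) (hX : a < X) (hY : a < Y) (hα : 0 < α)
    (hβ : 0 < β) (hab : α + β = 1) :
    (X - a) ^ α * (Y - a) ^ β + a ≤ X ^ α * Y ^ β := by
  have hX0 : 0 < X := by linarith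
  have hY0 : 0 < Y := by linarith
  have h1 := Real.geom_mean_le_arith_mean2_weighted hα.le hβ.le
    (div_nonneg (sub_nonneg.2 hX.le) hX0.le) (div_nonneg (sub_nonneg.2 hY.le) hY0.le) hab
  have h2 := Real.geom_mean_le_arith_mean2_weighted hα.le hβ.le
    (div_nonneg ha hX0.le) (div_nonneg ha hY0.le) hab
  rw [Real.div_rpow (by linarith) hX0.le, Real.div_rpow (by linarith) hY0.le] at h1
  rw [Real.div_rpow (by linarith) hX0.le, Real.div_rpow (by linarith) hY0.le] at h2
  have haa : a ^ α * a ^ β = a := by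
    rw [← Real.rpow_add_of_nonneg ha hα.le hβ.le, hab, Real.rpow_one]
  have hXp := Real.rpow_pos_of_pos hX0 α
  have hYp := Real.rpow_pos_of_pos hY0 β
  rw [div_mul_div_comm] at h1 h2
  rw [haa] at h2
  have h3 : ((X - a) ^ α * (Y - a) ^ β + a) / (X ^ α * Y ^ β) ≤ 1 := by
    rw [add_div]
    refine (add_le_add h1 h2).trans_eq ?_
    field_simp
    linear_combination (X * Y) * hab
  rwa [div_le_one (by positivity)] at h3

theorem aux_k1 (q l u : ℝ) (hq : 1 < q) (hl : 0 ≤ l) :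
    ConvexOn ℝ (Set.Ioo l u) (fun x : ℝ => x ^ q * (x - l) / (x ^ q - l ^ q)) := by
  rcases hl.eq_or_lt with rfl | hl
  · refine (convexOn_id (convex_Ioo 0 u)).congr ?_
    rintro x ⟨hx, -⟩
    have := Real.rpow_pos_of_pos hx q
    simp only [id]
    rw [Real.zero_rpow (by linarith)]
    rw [sub_zero, sub_zero]
    field_simp
  · have hk : ∀ x, l < x → x ^ q * (x - l) / (x ^ q - l ^ q) =
        l * ((x / l) ^ q * (x / l - 1) / ((x / l) ^ q - 1)) := by
      intro x hx
      have h0 := Real.rpow_pos_of_pos hl q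
      have h1 := Real.rpow_lt_rpow hl.le hx (show 0 < q by linarith)
      have h2 : x ^ q - l ^ q ≠ 0 := by linarith
      rw [Real.div_rpow (by linarith) hl.le]
      have h3 : x ^ q / l ^ q - 1 ≠ 0 := by
        rw [div_sub_one h0.ne']; exact div_ne_zero h2 h0.ne'
      field_simp
    refine ⟨convex_Ioo l u, ?_⟩
    intro x hx y hy α β hα hβ hab
    have hz := (convex_Ioo l u) hx hy hα hβ hab
    have := (aux_f1 q hq).convexOn.2 (x := x / l) (y := y / l)
      ((one_lt_div hl).2 hx.1) ((one_lt_div hl).2 hy.1) hα hβ hab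
    simp only [smul_eq_mul] at this hz ⊢
    rw [hk _ hz.1, hk _ hx.1, hk _ hy.1,
      show (α * x + β * y) / l = α * (x / l) + β * (y / l) by ring]
    have := mul_le_mul_of_nonneg_left this hl.le
    linarith

theorem aux_k2 (q l u : ℝ) (hq : 1 < q) (hl : 0 ≤ l) (hlu : l < u) :
    StrictConcaveOn ℝ (Set.Ioo l u)
      (fun x : ℝ => Real.log (x ^ q * (u - x) / (u ^ q - x ^ q))) := by
  have hu : 0 < u := by linarith
  have hk : ∀ x ∈ Set.Ioo l u, Real.log (x ^ q * (u - x) / (u ^ q - x ^ q)) =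
      Real.log u + Real.log ((x / u) ^ q * (1 - x / u) / (1 - (x / u) ^ q)) := by
    rintro x ⟨hx, hxu⟩
    have hx0 : 0 < x := by linarith
    have h0 := Real.rpow_pos_of_pos hu q
    have h1 := Real.rpow_lt_rpow hx0.le hxu (show 0 < q by linarith)
    have h2 : 0 < u ^ q - x ^ q := by linarith
    have h5 : 0 < x ^ q := Real.rpow_pos_of_pos hx0 q
    have h4 : 0 < u - x := by linarith
    rw [Real.div_rpow (by linarith) hu.le]
    have e3 : 1 - x ^ q / u ^ q = (u ^ q - x ^ q) / u ^ q := by field_simp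
    have e4 : 1 - x / u = (u - x) / u := by field_simp
    rw [e3, e4, ← Real.log_mul hu.ne' (by positivity)]
    congr 1
    field_simp
  refine ⟨convex_Ioo l u, ?_⟩
  intro x hx y hy hxy α β hα hβ hab
  have hz := (convex_Ioo l u) hx hy hα.le hβ.le hab
  have := (aux_f2 q hq).2 (x := x / u) (y := y / u)
    ⟨div_pos (by linarith [hx.1]) hu, (div_lt_one hu).2 hx.2⟩
    ⟨div_pos (by linarith [hy.1]) hu, (div_lt_one hu).2 hy.2⟩
    (by intro h; apply hxy; field_simp at h; exact h) hα hβ hab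
  simp only [smul_eq_mul] at this hz ⊢
  rw [hk _ hz, hk _ hx, hk _ hy,
    show (α * x + β * y) / u = α * (x / u) + β * (y / u) by ring]
  have h1 : α * Real.log u + β * Real.log u = Real.log u := by rw [← add_mul, hab, one_mul]
  linarith

/-- The basic positivity, from convexity of `x ^ (-q)`. -/
theorem aux_pos (q l u x : ℝ) (hq : 1 < q) (hl : 0 ≤ l) (hx : l < x) (hxu : x < u) :
    l ^ q * u ^ q * (u - l) < x ^ q * (u ^ q * (u - x) + l ^ q * (x - l)) := by
  have hx0 : 0 < x := by linarith
  have hu : 0 < u := by linarith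
  have hb := Real.rpow_pos_of_pos hu q
  have ht := Real.rpow_pos_of_pos hx0 q
  rcases hl.eq_or_lt with rfl | hl
  · rw [Real.zero_rpow (by linarith)]
    have : 0 < u - x := by linarith
    simp; positivity
  · have ha := Real.rpow_pos_of_pos hl q
    have h1 := aux_bern_s14 q (x / l) hq (by positivity) ((one_lt_div hl).2 hx).ne'
    have h2 := aux_bern_s14 q (x / u) hq (by positivity) ((div_lt_one hu).2 hxu).ne
    rw [Real.div_rpow hx0.le hl.le] at h1
    rw [Real.div_rpow hx0.le hu.le] at h2
    set a := l ^ q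
    set b := u ^ q
    set t := x ^ q
    have d1 : 0 < u - x := by linarith
    have d2 : 0 < x - l := by linarith
    have d3 : 0 < u - l := by linarith
    have h1' := mul_lt_mul_of_pos_left h1 d1
    have h2' := mul_lt_mul_of_pos_left h2 d2
    have e : (u - x) * (1 + q * (x / l - 1)) + (x - l) * (1 + q * (x / u - 1)) =
        (u - l) + q * ((x - l) * (u - x) * (u - l) / (l * u)) := by
      field_simp; ring
    have e' : 0 < q * ((x - l) * (u - x) * (u - l) / (l * u)) := by
      have : 0 < q := by linarith
      positivity
    have h3 : u - l < (u - x) * (t / a) + (x - l) * (t / b) := by linarith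
    have h4 := mul_lt_mul_of_pos_left h3 (show 0 < a * b by positivity)
    refine h4.trans_eq ?_
    field_simp

theorem aux_id (l u a b t x : ℝ) (hlu : l < u) (hb : 0 < b) (h1 : a < t) (h2 : t < b) :
    a * t * (x - l) ^ 2 / (t - a) + t * b * (u - x) ^ 2 / (b - t)
      - a * b * (u - l) ^ 2 / (b - a) =
    b * (u - l) ^ 2 / (b - a) * ((1 - (b - a) / (b * (u - l)) * (t * (x - l) / (t - a)))
      * ((b - a) / (u - l) * (t * (u - x) / (b - t)) - a)) := by
  have e1 : t - a ≠ 0 := by linarith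
  have e2 : b - t ≠ 0 := by linarith
  have e3 : b - a ≠ 0 := by linarith
  have e4 : u - l ≠ 0 := by linarith
  field_simp
  ring

theorem aux_log1 (D : Set ℝ) (f : ℝ → ℝ) (hf : ConcaveOn ℝ D f) (h0 : ∀ x ∈ D, 0 < f x) :
    ConcaveOn ℝ D (fun x => Real.log (f x)) := by
  refine ⟨hf.1, ?_⟩
  intro x hx y hy α β hα hβ hab
  have h1 := hf.2 hx hy hα hβ hab
  have h2 := strictConcaveOn_log_Ioi.concaveOn.2 (h0 x hx) (h0 y hy) hα hβ hab
  refine h2.trans (Real.log_le_log ?_ h1)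
  exact (convex_Ioi (0 : ℝ)) (h0 x hx) (h0 y hy) hα hβ hab

theorem aux_log2 (D : Set ℝ) (k : ℝ → ℝ) (c a : ℝ) (hc : 0 < c) (ha : 0 ≤ a)
    (hk : StrictConcaveOn ℝ D (fun x => Real.log (k x)))
    (h0 : ∀ x ∈ D, a < c * k x) :
    StrictConcaveOn ℝ D (fun x => Real.log (c * k x - a)) := by
  refine ⟨hk.1, ?_⟩
  intro x hx y hy hxy α β hα hβ hab
  have hz := hk.1 hx hy hα.le hβ.le hab
  have h1 := hk.2 hx hy hxy hα hβ hab
  simp only [smul_eq_mul] at h1 hz ⊢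
  have kp : ∀ x ∈ D, 0 < k x := fun x hx => by
    have := h0 x hx
    exact pos_of_mul_pos_right (by linarith : 0 < c * k x) hc.le
  have X := h0 x hx
  have Y := h0 y hy
  have hH := aux_hold (c * k x) (c * k y) a α β ha X Y hα hβ hab
  have lX : 0 < c * k x := by linarith
  have lY : 0 < c * k y := by linarith
  have sX : 0 < c * k x - a := by linarith
  have sY : 0 < c * k y - a := by linarith
  have h2 : (c * k x) ^ α * (c * k y) ^ β < c * k (α * x + β * y) := by
    have kz := kp _ hz
    rw [← Real.log_lt_log_iff (by positivity) (by positivity),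
      Real.log_mul (by positivity) (by positivity), Real.log_rpow lX, Real.log_rpow lY,
      Real.log_mul hc.ne' (kp x hx).ne', Real.log_mul hc.ne' (kp y hy).ne',
      Real.log_mul hc.ne' kz.ne']
    have : α * Real.log c + β * Real.log c = Real.log c := by rw [← add_mul, hab, one_mul]
    linarith
  rw [← Real.log_rpow sX, ← Real.log_rpow sY, ← Real.log_mul (by positivity) (by positivity)]
  apply Real.log_lt_log (by positivity)
  linarith

/-- For `p > 2`, with
`C = ((p−1)uᵖ + ℓᵖ − p u^{p−1} ℓ)(uᵖ + (p−1)ℓᵖ − p u ℓ^{p−1})/(6p(u^{p−1} − ℓ^{p−1}))`,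
the function `h(ξ₁) = C − V_p(ℓ, ξ₁, u)` is positive on `(ℓ, u)` and strictly
log-concave there. -/
theorem V1_complement_strictly_log_concave (l u : ℝ) (hl : 0 ≤ l) (hlu : l < u)
    (p : ℝ) (hp : 2 < p) :
    (∀ t ∈ Set.Ioo l u,
      0 < ((p - 1) * u ^ p + l ^ p - p * u ^ (p - 1) * l)
            * (u ^ p + (p - 1) * l ^ p - p * u * l ^ (p - 1))
            / (6 * p * (u ^ (p - 1) - l ^ (p - 1)))
          - V1 l u p t) ∧
    StrictConcaveOn ℝ (Set.Ioo l u) (fun t =>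
      Real.log (((p - 1) * u ^ p + l ^ p - p * u ^ (p - 1) * l)
            * (u ^ p + (p - 1) * l ^ p - p * u * l ^ (p - 1))
            / (6 * p * (u ^ (p - 1) - l ^ (p - 1)))
          - V1 l u p t)) := by
  obtain ⟨q, rfl⟩ : ∃ q, p = q + 1 := ⟨p - 1, by ring⟩
  have hq : 1 < q := by linarith
  have hu : 0 < u := by linarith
  have hb : 0 < u ^ q := Real.rpow_pos_of_pos hu q
  have ha : 0 ≤ l ^ q := Real.rpow_nonneg hl q
  have hab : l ^ q < u ^ q := Real.rpow_lt_rpow hl hlu (by linarith)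
  have hba : 0 < u ^ q - l ^ q := by linarith
  have hul : 0 < u - l := by linarith
  let P1 : ℝ → ℝ := fun x =>
    1 - (u ^ q - l ^ q) / (u ^ q * (u - l)) * (x ^ q * (x - l) / (x ^ q - l ^ q))
  let P2 : ℝ → ℝ := fun x =>
    (u ^ q - l ^ q) / (u - l) * (x ^ q * (u - x) / (u ^ q - x ^ q)) - l ^ q
  have hP1 : ∀ x ∈ Set.Ioo l u, 0 < P1 x := by
    rintro x ⟨hx, hxu⟩
    have h := aux_pos q l u x hq hl hx hxu
    have h1 : l ^ q < x ^ q := Real.rpow_lt_rpow hl hx (by linarith)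
    have h2 : 0 < x ^ q - l ^ q := by linarith
    simp only [P1]
    rw [div_mul_div_comm, sub_pos, div_lt_one (by positivity)]
    linarith
  have hP2 : ∀ x ∈ Set.Ioo l u,
      l ^ q < (u ^ q - l ^ q) / (u - l) * (x ^ q * (u - x) / (u ^ q - x ^ q)) := by
    rintro x ⟨hx, hxu⟩
    have h := aux_pos q l u x hq hl hx hxu
    have h1 : x ^ q < u ^ q := Real.rpow_lt_rpow (by linarith) hxu (by linarith)
    have h2 : 0 < u ^ q - x ^ q := by linarith
    rw [div_mul_div_comm, lt_div_iff₀ (by positivity)]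
    linarith
  have hc1 : ConcaveOn ℝ (Set.Ioo l u) (fun x => Real.log (P1 x)) := by
    apply aux_log1 _ _ _ hP1
    have h := ((aux_k1 q l u hq hl).smul
      (show 0 ≤ (u ^ q - l ^ q) / (u ^ q * (u - l)) by positivity)).neg
    refine (h.add_const 1).congr ?_
    intro x hx
    simp only [P1, Pi.add_apply, Pi.neg_apply, smul_eq_mul]
    ring
  have hc2 : StrictConcaveOn ℝ (Set.Ioo l u) (fun x => Real.log (P2 x)) :=
    aux_log2 _ _ _ _ (by positivity) ha (aux_k2 q l u hq hl hlu) hP2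
  let K : ℝ := q ^ 2 / (6 * (q + 1)) * (u ^ q * (u - l) ^ 2 / (u ^ q - l ^ q))
  have hK : 0 < K := by
    have : 0 < q := by linarith
    positivity
  have hmain : ∀ x ∈ Set.Ioo l u,
      ((q + 1 - 1) * u ^ (q + 1) + l ^ (q + 1) - (q + 1) * u ^ (q + 1 - 1) * l)
            * (u ^ (q + 1) + (q + 1 - 1) * l ^ (q + 1) - (q + 1) * u * l ^ (q + 1 - 1))
            / (6 * (q + 1) * (u ^ (q + 1 - 1) - l ^ (q + 1 - 1)))
          - V1 l u (q + 1) x = K * (P1 x * P2 x) := by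
    rintro x ⟨hx, hxu⟩
    have h1 : l ^ q < x ^ q := Real.rpow_lt_rpow hl hx (by linarith)
    have h2 : x ^ q < u ^ q := Real.rpow_lt_rpow (by linarith) hxu (by linarith)
    have hid := aux_id l u (l ^ q) (u ^ q) (x ^ q) x hlu hb h1 h2
    have hq1 : q + 1 ≠ 0 := by linarith
    have hq2 : q + 1 + 1 ≠ 0 := by linarith
    simp only [V1, K, P1, P2]
    rw [mul_assoc (q ^ 2 / (6 * (q + 1))), ← hid]
    simp only [add_sub_cancel_right]
    rw [Real.rpow_add_one' hu.le hq2, Real.rpow_add_one' hl hq2,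
      Real.rpow_add_one' hu.le hq1, Real.rpow_add_one' hl hq1]
    generalize l ^ q * x ^ q * (x - l) ^ 2 / (x ^ q - l ^ q) = A
    generalize x ^ q * u ^ q * (u - x) ^ 2 / (u ^ q - x ^ q) = B
    clear hid hP1 hP2 hc1 hc2 hK h1 h2
    clear_value P1 P2 K
    have : u ^ q - l ^ q ≠ 0 := hba.ne'
    generalize l ^ q = a at this ⊢
    generalize u ^ q = b at this ⊢
    field_simp
    ring
  constructor
  · intro x hx
    rw [hmain x hx]
    have h1 := hP1 x hx
    have h2 : 0 < P2 x := sub_pos.2 (hP2 x hx)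
    positivity
  · refine ((hc1.add_strictConcaveOn hc2).add_const (Real.log K)).congr ?_
    intro x hx
    have h1 := hP1 x hx
    have h2 : 0 < P2 x := sub_pos.2 (hP2 x hx)
    simp only [Pi.add_apply]
    rw [hmain x hx, Real.log_mul hK.ne' (by positivity), Real.log_mul h1.ne' h2.ne']
    ring
end
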